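/- For each integer n ≥ 3 there exists a topological embedding A : 𝒞 × 𝒞 → ℝⁿ such that for each s ∈ 𝒞 the image 𝒜_s := A(𝒞 × {s}) is an everywhere wild Cantor set in ℝⁿ (i.e., 𝒜_s is locally wild at each of its points), and for every pair s ≠ t in 𝒞 the sets 𝒜_s and 𝒜_t are ambiently incomparable in ℝⁿ. -/

import Mathlib

open Set Topology Metric

noncomputable section

/-- The coordinate line `ℝ × {0}^{n-1}` in `ℝⁿ`. -/
def coordLine (n : ℕ) : Set (EuclideanSpace ℝ (Fin n)) :=
  {x | ∀ i : Fin n, (i : ℕ) ≠ 0 → x i = 0}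

/-- The coordinate hyperplane `ℝ^{n-1} × {0}` in `ℝⁿ`. -/
def coordHyperplane (n : ℕ) : Set (EuclideanSpace ℝ (Fin n)) :=
  {x | ∀ i : Fin n, (i : ℕ) = n - 1 → x i = 0}

/-- `X` can be ambiently embedded in `Y`: some self-homeomorphism of `ℝⁿ` takes `X` into `Y`. -/
def AmbientlyEmbeds {n : ℕ} (X Y : Set (EuclideanSpace ℝ (Fin n))) : Prop :=
  ∃ h : EuclideanSpace ℝ (Fin n) ≃ₜ EuclideanSpace ℝ (Fin n), h '' X ⊆ Y

/-- `X` and `Y` are ambiently incomparable. -/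
def AmbientlyIncomparable {n : ℕ} (X Y : Set (EuclideanSpace ℝ (Fin n))) : Prop :=
  ¬ AmbientlyEmbeds X Y ∧ ¬ AmbientlyEmbeds Y X

/-- `X ⊆ ℝⁿ` is locally hyperplanar at `x ∈ X`. -/
def LocallyHyperplanarAt {n : ℕ} (X : Set (EuclideanSpace ℝ (Fin n)))
    (x : EuclideanSpace ℝ (Fin n)) : Prop :=
  ∃ U ∈ 𝓝 x, ∃ h : U → EuclideanSpace ℝ (Fin n), Topology.IsEmbedding h ∧
    ∀ y : U, (y : EuclideanSpace ℝ (Fin n)) ∈ X → h y ∈ coordHyperplane n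

/-- A compact zero-dimensional set `K ⊆ ℝⁿ` is tame if a self-homeomorphism of `ℝⁿ`
moves it into the coordinate line. -/
def TameSet {n : ℕ} (K : Set (EuclideanSpace ℝ (Fin n))) : Prop :=
  ∃ h : EuclideanSpace ℝ (Fin n) ≃ₜ EuclideanSpace ℝ (Fin n), h '' K ⊆ coordLine n

/-- `K` is locally tame at `x`. -/
def LocallyTameAt {n : ℕ} (K : Set (EuclideanSpace ℝ (Fin n)))
    (x : EuclideanSpace ℝ (Fin n)) : Prop :=
  ∃ U ∈ 𝓝 x, TameSet (K ∩ closure U)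

/-- `K` is everywhere wild: locally wild at each of its points. -/
def EverywhereWild {n : ℕ} (K : Set (EuclideanSpace ℝ (Fin n))) : Prop :=
  ∀ x ∈ K, ¬ LocallyTameAt K x

/-- `K` is a Cantor set: homeomorphic to the middle-thirds Cantor set. -/
def IsCantorSet {X : Type*} [TopologicalSpace X] (K : Set X) : Prop :=
  Nonempty (↥K ≃ₜ ↥cantorSet)

/-- The unit cube `Iⁿ = [0,1]ⁿ` in `ℝⁿ`. -/
def unitCube (n : ℕ) : Set (EuclideanSpace ℝ (Fin n)) :=
  {x | ∀ i, x i ∈ Set.Icc (0 : ℝ) 1}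

/-- The open face `(0,1)^{n-1} × {0}` of the unit cube. -/
def openFace (n : ℕ) : Set (EuclideanSpace ℝ (Fin n)) :=
  {x | (∀ i : Fin n, (i : ℕ) < n - 1 → x i ∈ Set.Ioo (0 : ℝ) 1) ∧
    ∀ i : Fin n, (i : ℕ) = n - 1 → x i = 0}

namespace WildCantor

section Cocycle

theorem cocycle_self {X G : Type*} [Group G] {Φ : X → X → G} {U : Set X}
    (h : ∀ y ∈ U, ∀ z ∈ U, ∀ w ∈ U, Φ y z * Φ z w = Φ y w) {x : X} (hx : x ∈ U) :
    Φ x x = 1 := by simpa using h x hx x hx x hx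

theorem cocycle_symm {X G : Type*} [Group G] {Φ : X → X → G} {U : Set X}
    (h : ∀ y ∈ U, ∀ z ∈ U, ∀ w ∈ U, Φ y z * Φ z w = Φ y w) {x y : X} (hx : x ∈ U) (hy : y ∈ U) :
    Φ y x = (Φ x y)⁻¹ := by
  rw [eq_inv_iff_mul_eq_one, h y hy x hx y hy, cocycle_self h hy]

variable {X Y G : Type*} [TopologicalSpace X] [TopologicalSpace Y] [Group G]

/-- `Φ` satisfies the cocycle identity near each point of `A`. -/
def LC (Φ : X → X → G) (A : Set X) : Prop :=
  ∀ x ∈ A, ∃ U ∈ 𝓝 x, ∀ y ∈ U, ∀ z ∈ U, ∀ w ∈ U, Φ y z * Φ z w = Φ y w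

/-- `φ` is locally on `A` a primitive of `Φ`. -/
def Prim (Φ : X → X → G) (φ : X → G) (A : Set X) : Prop :=
  ∀ x ∈ A, ∃ U ∈ 𝓝[A] x, ∀ y ∈ U, ∀ z ∈ U, Φ y z = (φ y)⁻¹ * φ z

/-- `Φ` and `Ψ` are locally conjugate near the points of `A`. -/
def Gauge (Φ Ψ : X → X → G) (A : Set X) : Prop :=
  ∃ η : X → G, ∀ x ∈ A, ∃ U ∈ 𝓝 x, ∀ y ∈ U, ∀ y' ∈ U, Φ y y' = (η y)⁻¹ * Ψ y y' * η y'

/-- Pullback of a two-point function. -/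
def pb (Φ : X → X → G) (g : Y → X) : Y → Y → G := fun y y' => Φ (g y) (g y')

theorem LC.mono {Φ : X → X → G} {A B : Set X} (h : LC Φ A) (hB : B ⊆ A) : LC Φ B :=
  fun x hx => h x (hB hx)

theorem LC.pb {Φ : X → X → G} {A : Set X} (h : LC Φ A) {g : Y → X} {B : Set Y}
    (hg : ∀ y ∈ B, ContinuousAt g y) (hB : ∀ y ∈ B, g y ∈ A) : LC (pb Φ g) B := by
  intro y hy
  obtain ⟨U, hU, H⟩ := h (g y) (hB y hy)
  exact ⟨g ⁻¹' U, hg y hy hU, fun a ha b hb c hc => H _ ha _ hb _ hc⟩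

theorem Prim.mono {Φ : X → X → G} {φ : X → G} {A B : Set X} (h : Prim Φ φ A) (hB : B ⊆ A) :
    Prim Φ φ B := by
  intro x hx
  obtain ⟨U, hU, H⟩ := h x (hB hx)
  exact ⟨U, nhdsWithin_mono x hB hU, H⟩

theorem Prim.pb {Φ : X → X → G} {φ : X → G} {A : Set X} (h : Prim Φ φ A) {g : Y → X} {B : Set Y}
    (hg : ContinuousOn g B) (hB : MapsTo g B A) : Prim (pb Φ g) (φ ∘ g) B := by
  intro y hy
  obtain ⟨U, hU, H⟩ := h (g y) (hB hy)
  exact ⟨g ⁻¹' U, (hg y hy).tendsto_nhdsWithin hB hU, fun a ha b hb => H _ ha _ hb⟩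

theorem Gauge.mono {Φ Ψ : X → X → G} {A B : Set X} (h : Gauge Φ Ψ A) (hB : B ⊆ A) :
    Gauge Φ Ψ B := by
  obtain ⟨η, h⟩ := h
  exact ⟨η, fun x hx => h x (hB hx)⟩

theorem Gauge.pb {Φ Ψ : X → X → G} {A : Set X} (h : Gauge Φ Ψ A) {g : Y → X} {B : Set Y}
    (hg : ∀ y ∈ B, ContinuousAt g y) (hB : ∀ y ∈ B, g y ∈ A) : Gauge (pb Φ g) (pb Ψ g) B := by
  obtain ⟨η, h⟩ := h
  refine ⟨η ∘ g, fun y hy => ?_⟩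
  obtain ⟨U, hU, H⟩ := h (g y) (hB y hy)
  exact ⟨g ⁻¹' U, hg y hy hU, fun a ha b hb => H _ ha _ hb⟩

theorem Gauge.symm {Φ Ψ : X → X → G} {A : Set X} (h : Gauge Φ Ψ A) : Gauge Ψ Φ A := by
  obtain ⟨η, h⟩ := h
  refine ⟨fun x => (η x)⁻¹, fun x hx => ?_⟩
  obtain ⟨U, hU, H⟩ := h x hx
  refine ⟨U, hU, fun a ha b hb => ?_⟩
  rw [H a ha b hb]; group

theorem Gauge.trans {Φ Ψ Θ : X → X → G} {A : Set X} (h : Gauge Φ Ψ A) (h' : Gauge Ψ Θ A) :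
    Gauge Φ Θ A := by
  obtain ⟨η, h⟩ := h
  obtain ⟨ζ, h'⟩ := h'
  refine ⟨fun x => ζ x * η x, fun x hx => ?_⟩
  obtain ⟨U, hU, H⟩ := h x hx
  obtain ⟨V, hV, H'⟩ := h' x hx
  refine ⟨U ∩ V, Filter.inter_mem hU hV, fun a ha b hb => ?_⟩
  rw [H a ha.1 b hb.1, H' a ha.2 b hb.2]; group

theorem Gauge.of_eq {Φ Ψ : X → X → G} {A : Set X}
    (h : ∀ x ∈ A, ∃ U ∈ 𝓝 x, ∀ y ∈ U, ∀ y' ∈ U, Φ y y' = Ψ y y') : Gauge Φ Ψ A := by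
  refine ⟨1, fun x hx => ?_⟩
  obtain ⟨U, hU, H⟩ := h x hx
  exact ⟨U, hU, fun a ha b hb => by simp [H a ha b hb]⟩

/-- Two primitives on a preconnected set differ by a constant. -/
theorem Prim.unique {Φ : X → X → G} {φ ψ : X → G} {A : Set X} (h : Prim Φ φ A)
    (h' : Prim Φ ψ A) (hA : IsPreconnected A) {x y : X} (hx : x ∈ A) (hy : y ∈ A) :
    φ x * (ψ x)⁻¹ = φ y * (ψ y)⁻¹ := by
  refine hA.induction₂ (fun x y => φ x * (ψ x)⁻¹ = φ y * (ψ y)⁻¹) (fun x hx => ?_)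
    (fun _ _ _ _ _ _ h1 h2 => h1.trans h2) (fun _ _ _ _ h => h.symm) hx hy
  obtain ⟨U, hU, H⟩ := h x hx
  obtain ⟨V, hV, H'⟩ := h' x hx
  filter_upwards [hU, hV] with y hyU hyV
  have e := (H x (mem_of_mem_nhdsWithin hx hU) y hyU).symm.trans
    (H' x (mem_of_mem_nhdsWithin hx hV) y hyV)
  rw [inv_mul_eq_iff_eq_mul] at e
  rw [e]; group

theorem Prim.unique' {Φ : X → X → G} {φ ψ : X → G} {A : Set X} (h : Prim Φ φ A)
    (h' : Prim Φ ψ A) (hA : IsPreconnected A) {x y : X} (hx : x ∈ A) (hy : y ∈ A) :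
    (φ x)⁻¹ * φ y = (ψ x)⁻¹ * ψ y := by
  have := h.unique h' hA hx hy
  rw [mul_inv_eq_iff_eq_mul] at this
  rw [this]; group

/-- On a set where the cocycle identity holds, fixing one variable gives a primitive. -/
theorem prim_of_cocycle {Φ : X → X → G} {U : Set X}
    (h : ∀ y ∈ U, ∀ z ∈ U, ∀ w ∈ U, Φ y z * Φ z w = Φ y w) {x : X} (hx : x ∈ U) :
    Prim Φ (Φ x) U := fun y _ => ⟨U, self_mem_nhdsWithin, fun a ha b hb => by
  rw [← h x hx a ha b hb]; group⟩

theorem prim_Icc_glue {Φ : ℝ → ℝ → G} {A : Set ℝ} (h : LC Φ A) {a b c : ℝ} (hab : a ≤ b)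
    (hbc : b ≤ c) (hb : b ∈ A) {φ ψ : ℝ → G} (h1 : Prim Φ φ (Icc a b)) (h2 : Prim Φ ψ (Icc b c)) :
    ∃ χ, Prim Φ χ (Icc a c) := by
  refine ⟨fun t => if t ≤ b then φ t else φ b * (ψ b)⁻¹ * ψ t, fun x hx => ?_⟩
  have key : ∀ t, b ≤ t → (if t ≤ b then φ t else φ b * (ψ b)⁻¹ * ψ t) =
      φ b * (ψ b)⁻¹ * ψ t := by
    intro t ht
    split_ifs with h'
    · rw [le_antisymm h' ht]; group
    · rfl
  rcases lt_trichotomy x b with hxb | rfl | hxb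
  · obtain ⟨U, hU, H⟩ := h1 x ⟨hx.1, hxb.le⟩
    refine ⟨U ∩ Iio b, ?_, fun y hy z hz => ?_⟩
    · have : 𝓝[Icc a c] x ≤ 𝓝[Icc a b] x := by
        refine nhdsWithin_le_of_mem ?_
        filter_upwards [self_mem_nhdsWithin, mem_nhdsWithin_of_mem_nhds (Iio_mem_nhds hxb)]
          with y hy hy' using ⟨hy.1, le_of_lt hy'⟩
      exact Filter.inter_mem (this hU) (mem_nhdsWithin_of_mem_nhds (Iio_mem_nhds hxb))
    · simp only [if_pos (le_of_lt (mem_Iio.1 hy.2)), if_pos (le_of_lt (mem_Iio.1 hz.2))]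
      exact H y hy.1 z hz.1
  · obtain ⟨U, hU, H⟩ := h1 x ⟨hx.1, le_rfl⟩
    obtain ⟨V, hV, H'⟩ := h2 x ⟨le_rfl, hx.2⟩
    obtain ⟨W, hW, HW⟩ := h x hb
    have hxU := mem_of_mem_nhdsWithin (right_mem_Icc.2 hab) hU
    have hxV := mem_of_mem_nhdsWithin (left_mem_Icc.2 hbc) hV
    have hxW := mem_of_mem_nhds hW
    rw [mem_nhdsWithin_iff_eventually] at hU hV
    refine ⟨W ∩ {y | y ∈ Icc a c ∧ (y ∈ Icc a x → y ∈ U) ∧ (y ∈ Icc x c → y ∈ V)}, ?_, ?_⟩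
    · filter_upwards [self_mem_nhdsWithin, mem_nhdsWithin_of_mem_nhds hW,
        mem_nhdsWithin_of_mem_nhds hU, mem_nhdsWithin_of_mem_nhds hV] with y h1 h2 h3 h4
      exact ⟨h2, h1, h3, h4⟩
    · have base : ∀ y ∈ W ∩ {y | y ∈ Icc a c ∧ (y ∈ Icc a x → y ∈ U) ∧ (y ∈ Icc x c → y ∈ V)},
          Φ x y = (φ x)⁻¹ * (if y ≤ x then φ y else φ x * (ψ x)⁻¹ * ψ y) := by
        intro y hy
        split_ifs with hle
        · exact H x hxU y (hy.2.2.1 ⟨hy.2.1.1, hle⟩)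
        · rw [H' x hxV y (hy.2.2.2 ⟨(not_le.1 hle).le, hy.2.1.2⟩)]; group
      intro y hy z hz
      rw [← HW y hy.1 x hxW z hz.1, cocycle_symm HW hxW hy.1, base y hy, base z hz]
      group
  · obtain ⟨V, hV, H⟩ := h2 x ⟨hxb.le, hx.2⟩
    refine ⟨V ∩ Ioi b, ?_, fun y hy z hz => ?_⟩
    · have : 𝓝[Icc a c] x ≤ 𝓝[Icc b c] x := by
        refine nhdsWithin_le_of_mem ?_
        filter_upwards [self_mem_nhdsWithin, mem_nhdsWithin_of_mem_nhds (Ioi_mem_nhds hxb)]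
          with y hy hy' using ⟨le_of_lt hy', hy.2⟩
      exact Filter.inter_mem (this hV) (mem_nhdsWithin_of_mem_nhds (Ioi_mem_nhds hxb))
    · simp only [key y (le_of_lt hy.2), key z (le_of_lt hz.2)]
      rw [H y hy.1 z hz.1]; group

theorem exists_prim_Icc {Φ : ℝ → ℝ → G} {a b : ℝ} (h : LC Φ (Icc a b)) (hab : a ≤ b) :
    ∃ φ, Prim Φ φ (Icc a b) := by
  suffices H : ∀ x ∈ Icc a b, ∀ y ∈ Icc a b, x ≤ y → ∃ φ, Prim Φ φ (Icc x y) from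
    H a (left_mem_Icc.2 hab) b (right_mem_Icc.2 hab) hab
  intro x hx y hy
  refine isPreconnected_Icc.induction₂' (s := Icc a b)
    (fun x y => x ≤ y → ∃ φ, Prim Φ φ (Icc x y)) (fun x hx => ?_) ?_ hx hy
  · obtain ⟨U, hU, H⟩ := h x hx
    obtain ⟨l, u, hlu, hs⟩ := mem_nhds_iff_exists_Ioo_subset.1 hU
    refine mem_nhdsWithin_of_mem_nhds ?_
    filter_upwards [Ioo_mem_nhds hlu.1 hlu.2] with y hy
    exact ⟨fun hxy => ⟨_, (prim_of_cocycle H (mem_of_mem_nhds hU)).mono fun t ht =>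
        hs ⟨hlu.1.trans_le ht.1, ht.2.trans_lt hy.2⟩⟩,
      fun hxy => ⟨_, (prim_of_cocycle H (mem_of_mem_nhds hU)).mono fun t ht =>
        hs ⟨hy.1.trans_le ht.1, ht.2.trans_lt hlu.2⟩⟩⟩
  · intro x y z hx hy hz h1 h2 hxz
    rcases le_total x y with hxy | hxy
    · rcases le_total y z with hyz | hyz
      · obtain ⟨φ, hφ⟩ := h1 hxy
        obtain ⟨ψ, hψ⟩ := h2 hyz
        exact prim_Icc_glue h hxy hyz hy hφ hψ
      · obtain ⟨φ, hφ⟩ := h1 hxy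
        exact ⟨φ, hφ.mono (Icc_subset_Icc_right hyz)⟩
    · obtain ⟨φ, hφ⟩ := h2 (hxy.trans hxz)
      exact ⟨φ, hφ.mono (Icc_subset_Icc_left hxy)⟩

/-- Homotopic maps pull a local cocycle back to gauge equivalent ones. -/
theorem gauge_of_homotopy {Φ : X → X → G} {A : Set X} (h : LC Φ A) {H : ℝ → Y → X} {B : Set Y}
    (hc : ∀ t ∈ Icc (0 : ℝ) 1, ∀ y ∈ B, ContinuousAt (fun p : ℝ × Y => H p.1 p.2) (t, y))
    (hA : ∀ t ∈ Icc (0 : ℝ) 1, ∀ y ∈ B, H t y ∈ A) (hB : IsOpen B) :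
    Gauge (pb Φ (H 1)) (pb Φ (H 0)) B := by
  have hex : ∀ y : Y, ∃ ψ : ℝ → G, y ∈ B → Prim (fun t t' => Φ (H t y) (H t' y)) ψ (Icc 0 1) := by
    intro y
    by_cases hy : y ∈ B
    · obtain ⟨ψ, hψ⟩ := exists_prim_Icc (Φ := pb Φ fun t => H t y) (a := 0) (b := 1)
        (h.pb (fun t ht => (hc t ht y hy).comp (f := fun t : ℝ => (t, y)) (by fun_prop))
          fun t ht => hA t ht y hy) zero_le_one
      exact ⟨ψ, fun _ => hψ⟩
    · exact ⟨1, fun h => absurd h hy⟩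
  choose ψ hψ using hex
  refine ⟨fun y => (ψ y 0)⁻¹ * ψ y 1, fun y0 hy0 => ?_⟩
  let P : ℝ → Prop := fun t => ∃ V ∈ 𝓝 y0, ∀ y ∈ V, ∀ y' ∈ V,
    Φ (H t y) (H t y') =
      ((ψ y 0)⁻¹ * ψ y t)⁻¹ * Φ (H 0 y) (H 0 y') * ((ψ y' 0)⁻¹ * ψ y' t)
  have hP0 : P 0 := ⟨univ, Filter.univ_mem, fun y _ y' _ => by simp⟩
  suffices hP : P 0 → P 1 from hP hP0
  refine isPreconnected_Icc.induction₂' (s := Icc (0 : ℝ) 1) (fun a b => P a → P b)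
    (fun t ht => ?_) (fun _ _ _ _ _ _ h1 h2 h => h2 (h1 h))
    (left_mem_Icc.2 zero_le_one) (right_mem_Icc.2 zero_le_one)
  obtain ⟨U, hU, HU⟩ := h _ (hA t ht y0 hy0)
  have := hc t ht y0 hy0 hU
  rw [Filter.mem_map, nhds_prod_eq, Filter.mem_prod_iff] at this
  obtain ⟨I', hI', V, hV, hIV⟩ := this
  obtain ⟨l, u, hlu, hs⟩ := mem_nhds_iff_exists_Ioo_subset.1 hI'
  have trans : ∀ a ∈ Ioo l u ∩ Icc 0 1, ∀ b ∈ Ioo l u ∩ Icc 0 1, P a → P b := by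
    rintro a ha b hb ⟨W, hW, hWP⟩
    refine ⟨V ∩ W ∩ B, Filter.inter_mem (Filter.inter_mem hV hW) (hB.mem_nhds hy0),
      fun y hy y' hy' => ?_⟩
    have hm : ∀ c ∈ Ioo l u, ∀ y ∈ V, H c y ∈ U := fun c hc y hy =>
      hIV (show ((c, y) : ℝ × Y) ∈ I' ×ˢ V from ⟨hs hc, hy⟩)
    have tr : ∀ y ∈ V ∩ W ∩ B, (ψ y a)⁻¹ * ψ y b = Φ (H a y) (H b y) := by
      intro y hy
      have c1 : ∀ c ∈ Ioo l u ∩ Icc 0 1, ∀ d ∈ Ioo l u ∩ Icc 0 1, ∀ e ∈ Ioo l u ∩ Icc 0 1,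
          Φ (H c y) (H d y) * Φ (H d y) (H e y) = Φ (H c y) (H e y) := fun c hc d hd e he =>
        HU _ (hm c hc.1 y hy.1.1) _ (hm d hd.1 y hy.1.1) _ (hm e he.1 y hy.1.1)
      have := ((hψ y hy.2).mono inter_subset_right).unique'
        (prim_of_cocycle (Φ := fun t t' => Φ (H t y) (H t' y)) c1 ha)
        ((ordConnected_Ioo.inter ordConnected_Icc).isPreconnected) ha hb
      rw [this, cocycle_self HU (hm a ha.1 y hy.1.1), inv_one, one_mul]
    have e1 : Φ (H b y) (H b y') =
        Φ (H b y) (H a y) * Φ (H a y) (H a y') * Φ (H a y') (H b y') := by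
      rw [HU _ (hm b hb.1 y hy.1.1) _ (hm a ha.1 y hy.1.1) _ (hm a ha.1 y' hy'.1.1),
        HU _ (hm b hb.1 y hy.1.1) _ (hm a ha.1 y' hy'.1.1) _ (hm b hb.1 y' hy'.1.1)]
    rw [e1, hWP y hy.1.2 y' hy'.1.2, cocycle_symm HU (hm a ha.1 y hy.1.1) (hm b hb.1 y hy.1.1),
      ← tr y hy, ← tr y' hy']
    group
  have hmem : Ioo l u ∩ Icc 0 1 ∈ 𝓝[Icc (0 : ℝ) 1] t :=
    Filter.inter_mem (mem_nhdsWithin_of_mem_nhds (Ioo_mem_nhds hlu.1 hlu.2)) self_mem_nhdsWithin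
  filter_upwards [hmem] with b hb
  exact ⟨trans t ⟨hlu, ht⟩ b hb, trans b hb t ⟨hlu, ht⟩⟩

/-- A primitive on a set yields gauge triviality and conversely on open sets. -/
theorem Gauge.exists_prim {Φ Ψ : X → X → G} {A : Set X} (h : Gauge Φ Ψ A) {ψ : X → G}
    (hψ : Prim Ψ ψ A) : ∃ φ, Prim Φ φ A := by
  obtain ⟨η, h⟩ := h
  refine ⟨fun x => ψ x * η x, fun x hx => ?_⟩
  obtain ⟨U, hU, H⟩ := h x hx
  obtain ⟨V, hV, H'⟩ := hψ x hx
  refine ⟨U ∩ V, Filter.inter_mem (mem_nhdsWithin_of_mem_nhds hU) hV, fun a ha b hb => ?_⟩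
  rw [H a ha.1 b hb.1, H' a ha.2 b hb.2]; group

theorem exists_prim_of_contractible {Φ : X → X → G} (h : LC Φ univ) {H : ℝ → X → X} {x0 : X}
    (hc : Continuous (fun p : ℝ × X => H p.1 p.2)) (h0 : ∀ x, H 0 x = x0) (h1 : ∀ x, H 1 x = x) :
    ∃ φ, Prim Φ φ univ := by
  have hg := gauge_of_homotopy h (H := H) (B := univ) (fun _ _ _ _ => hc.continuousAt)
    (fun _ _ _ _ => mem_univ _) isOpen_univ
  have e1 : pb Φ (H 1) = Φ := by funext a b; simp [pb, h1]
  rw [e1] at hg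
  refine hg.exists_prim (ψ := 1) fun x _ => ⟨univ, Filter.univ_mem, fun a _ b _ => ?_⟩
  obtain ⟨U, hU, HU⟩ := h x0 (mem_univ _)
  simp [pb, h0, cocycle_self HU (mem_of_mem_nhds hU)]

end Cocycle

section Tame

variable {F G : Type*} [NormedAddCommGroup F] [NormedSpace ℝ F] [Group G]

theorem isPreconnected_punctured_ball (hF : 1 < Module.rank ℝ F) (r : ℝ) :
    IsPreconnected (ball (0 : F) r \ {0}) := by
  have : ball (0 : F) r \ {0} = (fun p : ℝ × F => p.1 • p.2) '' (Ioo 0 r ×ˢ sphere (0 : F) 1) := by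
    ext v
    simp only [mem_sdiff, mem_ball_zero_iff, mem_singleton_iff, mem_image, mem_prod, mem_Ioo,
      mem_sphere_zero_iff_norm, Prod.exists]
    constructor
    · rintro ⟨h1, h2⟩
      have h3 : 0 < ‖v‖ := norm_pos_iff.2 h2
      exact ⟨‖v‖, ‖v‖⁻¹ • v, ⟨⟨h3, h1⟩, by rw [norm_smul, norm_inv, norm_norm]; field_simp⟩,
        by rw [smul_smul, mul_inv_cancel₀ h3.ne', one_smul]⟩
    · rintro ⟨a, w, ⟨⟨h1, h2⟩, h3⟩, rfl⟩
      refine ⟨by rw [norm_smul, h3, Real.norm_of_nonneg h1.le]; linarith, ?_⟩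
      rw [← ne_eq, ← norm_pos_iff, norm_smul, h3, Real.norm_of_nonneg h1.le]; linarith
  rw [this]
  exact (isPreconnected_Ioo.prod (isPreconnected_sphere hF 0 1)).image _ (by fun_prop)

/-- A local cocycle off a bounded subset of a line in codimension at least two is trivial. -/
theorem exists_prim_off_line (hF : 1 < Module.rank ℝ F) {K : Set (ℝ × F)} (hK : IsClosed K)
    (hline : ∀ p ∈ K, p.2 = 0) {t0 : ℝ} (ht0 : (t0, (0 : F)) ∉ K) {Φ : ℝ × F → ℝ × F → G}
    (h : LC Φ Kᶜ) : ∃ φ, Prim Φ φ Kᶜ := by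
  let B : Set (ℝ × F) := {p | p.2 ≠ 0}
  have hB : IsOpen B := isOpen_ne_fun continuous_snd continuous_const
  have hBK : ∀ p ∈ B, p ∈ Kᶜ := fun p hp hK => hp (hline p hK)
  obtain ⟨φ, hφ⟩ : ∃ φ, Prim Φ φ B := by
    have g := gauge_of_homotopy h (Y := ℝ × F) (B := B)
      (H := fun s p => (t0 + s * (p.1 - t0), p.2))
      (fun _ _ _ _ => Continuous.continuousAt (by fun_prop)) (fun s _ y hy => hBK _ hy) hB
    have e : pb Φ (fun p : ℝ × F => (t0 + 1 * (p.1 - t0), p.2)) = Φ := by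
      funext a b; simp [pb]
    rw [e] at g
    have l : LC (pb Φ (fun p : ℝ × F => (t0 + 0 * (p.1 - t0), p.2))) univ := by
      refine h.pb (fun _ _ => Continuous.continuousAt (by fun_prop)) fun y _ hy => ?_
      have := hline _ hy
      simp only at this
      simp only [this, zero_mul, add_zero] at hy
      exact ht0 hy
    obtain ⟨ψ, hψ⟩ := exists_prim_of_contractible l (H := fun s x => s • x) (x0 := 0)
      (by fun_prop) (by simp) (by simp)
    exact g.exists_prim (hψ.mono (subset_univ _))
  have hloc : ∀ x : ℝ × F, ∃ g : G, x ∈ Kᶜ → x ∉ B → ∃ U ∈ 𝓝 x,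
      (∀ y ∈ U, ∀ z ∈ U, ∀ w ∈ U, Φ y z * Φ z w = Φ y w) ∧ ∀ y ∈ U, y ∈ B → φ y = g * Φ x y := by
    intro x
    by_cases hx : x ∈ Kᶜ ∧ x ∉ B
    · obtain ⟨V, hV, HV⟩ := h x hx.1
      obtain ⟨t, v⟩ := x
      obtain rfl : v = 0 := not_not.1 hx.2
      obtain ⟨r, hr, hrV⟩ := Metric.mem_nhds_iff.1 hV
      let S : Set (ℝ × F) := ball t r ×ˢ (ball (0 : F) r \ {0})
      have hSB : S ⊆ B := fun p hp => hp.2.2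
      have hSV : S ⊆ V := fun p hp => hrV (by
        rw [← ball_prod_same]; exact ⟨hp.1, hp.2.1⟩)
      have hS : IsPreconnected S := by
        refine IsPreconnected.prod ?_ (isPreconnected_punctured_ball hF r)
        exact (convex_ball t r).isPreconnected
      obtain ⟨g, hg⟩ : ∃ g, ∀ y ∈ S, φ y * (Φ (t, 0) y)⁻¹ = g := by
        rcases S.eq_empty_or_nonempty with h0 | ⟨y, hy⟩
        · exact ⟨1, by simp [h0]⟩
        · exact ⟨φ y * (Φ (t, 0) y)⁻¹, fun z hz => (hφ.mono hSB).unique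
            ((prim_of_cocycle HV (mem_of_mem_nhds hV)).mono hSV) hS hz hy⟩
      refine ⟨g, fun _ _ => ⟨ball (t, 0) r, ball_mem_nhds _ hr,
        fun y hy z hz w hw => HV y (hrV hy) z (hrV hz) w (hrV hw), fun y hy hyB => ?_⟩⟩
      rw [← ball_prod_same] at hy
      rw [← hg y ⟨hy.1, hy.2, hyB⟩]; group
    · exact ⟨1, fun h1 h2 => absurd ⟨h1, h2⟩ hx⟩
  choose g hg using hloc
  classical
  refine ⟨fun x => if x ∈ B then φ x else g x, fun x hx => ?_⟩
  by_cases hxB : x ∈ B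
  · obtain ⟨U, hU, HU⟩ := hφ x hxB
    rw [hB.nhdsWithin_eq hxB] at hU
    refine ⟨U ∩ B, mem_nhdsWithin_of_mem_nhds (Filter.inter_mem hU (hB.mem_nhds hxB)),
      fun y hy z hz => ?_⟩
    simp only [if_pos hy.2, if_pos hz.2]
    exact HU y hy.1 z hz.1
  · obtain ⟨U, hU, HU, Hg⟩ := hg x hx hxB
    have hxU := mem_of_mem_nhds hU
    have key : ∀ y ∈ interior U ∩ Kᶜ, (if y ∈ B then φ y else g y) = g x * Φ x y := by
      rintro y ⟨hyU, hyK⟩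
      split_ifs with hyB
      · exact Hg y (interior_subset hyU) hyB
      · obtain ⟨V, hV, HV, Hg'⟩ := hg y hyK hyB
        have hdense : ∃ w ∈ B, w ∈ V ∩ interior U := by
          have : Nontrivial F := by
            by_contra hn
            rw [not_nontrivial_iff_subsingleton] at hn
            simp at hF
          obtain ⟨e, he⟩ := exists_ne (0 : F)
          have hc : Filter.Tendsto (fun s : ℝ => (y.1, y.2 + s • e)) (𝓝[≠] 0) (𝓝 y) := by
            have : ContinuousAt (fun s : ℝ => (y.1, y.2 + s • e)) 0 :=
              Continuous.continuousAt (by fun_prop)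
            have h2 := this.tendsto
            simp only [zero_smul, add_zero, Prod.mk.eta] at h2
            exact h2.mono_left nhdsWithin_le_nhds
          have := Filter.mem_map.1 (hc (Filter.inter_mem hV (isOpen_interior.mem_nhds hyU)))
          obtain ⟨s, hs1, hs2⟩ := (Filter.nonempty_of_mem (Filter.inter_mem this self_mem_nhdsWithin))
          refine ⟨_, ?_, hs1⟩
          have hy2 : y.2 = 0 := not_not.1 hyB
          simp only [B, mem_ofPred_eq, hy2, zero_add]
          exact smul_ne_zero hs2 he
        obtain ⟨w, hwB, hwV, hwU⟩ := hdense
        have e1 := Hg' w hwV hwB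
        rw [Hg w (interior_subset hwU) hwB,
          ← HU x hxU y (interior_subset hyU) w (interior_subset hwU), ← mul_assoc] at e1
        exact (mul_right_cancel e1).symm
    refine ⟨interior U ∩ Kᶜ, mem_nhdsWithin_of_mem_nhds
      (Filter.inter_mem (interior_mem_nhds.2 hU) (hK.isOpen_compl.mem_nhds hx)),
      fun y hy z hz => ?_⟩
    simp only [key y hy, key z hz]
    rw [← HU y (interior_subset hy.1) x hxU z (interior_subset hz.1),
      cocycle_symm HU hxU (interior_subset hy.1)]
    group

/-- Off a tame compact set every local cocycle is trivial. -/
theorem exists_prim_off_tame {n : ℕ} (hn : 3 ≤ n) {K : Set (EuclideanSpace ℝ (Fin n))}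
    (hK : IsCompact K) (ht : TameSet K)
    {Φ : EuclideanSpace ℝ (Fin n) → EuclideanSpace ℝ (Fin n) → G} (h : LC Φ Kᶜ) :
    ∃ φ, Prim Φ φ Kᶜ := by
  obtain ⟨m, rfl⟩ : ∃ m, n = m + 1 := ⟨n - 1, by omega⟩
  obtain ⟨f, hf⟩ := ht
  let e : EuclideanSpace ℝ (Fin (m + 1)) ≃ₜ ℝ × (Fin m → ℝ) :=
    { toFun := fun x => (x 0, fun i => x i.succ)
      invFun := fun p => WithLp.toLp 2 (Fin.cons p.1 p.2)
      left_inv := fun x => by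
        ext i; refine Fin.cases ?_ (fun i => ?_) i <;> simp
      right_inv := fun p => by ext <;> simp
      continuous_toFun := by fun_prop
      continuous_invFun := by
        refine (PiLp.continuous_toLp 2 _).comp (continuous_pi fun i => ?_)
        refine Fin.cases ?_ (fun i => ?_) i
        · simpa using continuous_fst
        · simp only [Fin.cons_succ]; fun_prop }
  let g := f.trans e
  have hgK : IsCompact (g '' K) := hK.image g.continuous
  have hcompl : ∀ p, p ∈ (g '' K)ᶜ → g.symm p ∈ Kᶜ := fun p hp hK => hp ⟨_, hK, by simp⟩
  obtain ⟨t0, ht0⟩ : ∃ t0 : ℝ, (t0, (0 : Fin m → ℝ)) ∉ g '' K := by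
    obtain ⟨C, hC⟩ := hgK.isBounded.exists_norm_le
    refine ⟨C + 1, fun hm => ?_⟩
    have h1 := (norm_fst_le _).trans (hC _ hm)
    have h2 := le_abs_self (C + 1)
    rw [Real.norm_eq_abs] at h1
    simp only at h1
    linarith
  have hrank : 1 < Module.rank ℝ (Fin m → ℝ) := by
    simp only [rank_fun', Fintype.card_fin]
    exact_mod_cast (by omega : 1 < m)
  obtain ⟨φ, hφ⟩ := exists_prim_off_line hrank hgK.isClosed (fun p hp => by
    obtain ⟨x, hx, rfl⟩ := hp
    have := hf ⟨x, hx, rfl⟩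
    funext i
    exact this i.succ (by simp)) ht0
    (h.pb (fun p _ => g.symm.continuous.continuousAt) hcompl)
  have := hφ.pb (g := g) (B := Kᶜ) g.continuous.continuousOn
    (fun x hx ⟨y, hy, hyx⟩ => hx (by rwa [← g.injective hyx]))
  refine ⟨φ ∘ g, ?_⟩
  have e1 : pb (pb Φ g.symm) g = Φ := by funext a b; simp [pb]
  rwa [e1] at this

end Tame

section Angular

variable {X G : Type*} [TopologicalSpace X] [Group G]

/-- The angular cocycle on `ℂ ∖ {0}` with holonomy `x`. -/
def ac (x : G) (w w' : ℂ) : G := x ^ (round ((w.arg - w'.arg) / (2 * Real.pi)) : ℤ)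

theorem ac_eq_zpow (x : G) {w w' : ℂ} {a a' : ℝ} {k k' : ℤ} (h : w.arg = a + 2 * Real.pi * k)
    (h' : w'.arg = a' + 2 * Real.pi * k') (ha : |a - a'| < Real.pi) :
    ac x w w' = x ^ (k - k') := by
  have hp := Real.pi_pos
  have e : (w.arg - w'.arg) / (2 * Real.pi) =
      ((k - k' : ℤ) : ℝ) + (a - a') / (2 * Real.pi) := by
    rw [h, h']; push_cast; field_simp; ring
  have h0 : round ((a - a') / (2 * Real.pi)) = 0 := by
    rw [abs_lt] at ha
    rw [round_eq_zero_iff]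
    constructor
    · rw [le_div_iff₀ (by positivity)]; linarith
    · rw [div_lt_iff₀ (by positivity)]; linarith
  rw [ac, e, round_intCast_add, h0, add_zero]

theorem ac_eq_one (x : G) {w w' : ℂ} (h : |w.arg - w'.arg| < Real.pi) : ac x w w' = 1 := by
  simpa using ac_eq_zpow x (w := w) (w' := w') (k := 0) (k' := 0) (by simp) (by simp) h

theorem ac_eq_one_of_re_pos (x : G) {w w' : ℂ} (h : 0 < w.re) (h' : 0 < w'.re) :
    ac x w w' = 1 := by
  apply ac_eq_one
  have h1 := Complex.abs_arg_lt_pi_div_two_iff.2 (Or.inl h)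
  have h2 := Complex.abs_arg_lt_pi_div_two_iff.2 (Or.inl h')
  rw [abs_lt] at *
  constructor <;> linarith [h1.1, h1.2, h2.1, h2.2]

theorem arg_mem_of_im_pos {w : ℂ} (h : 0 < w.im) : 0 < w.arg ∧ w.arg < Real.pi := by
  constructor
  · refine lt_of_le_of_ne (Complex.arg_nonneg_iff.2 h.le) fun e => ?_
    have := (Complex.arg_eq_zero_iff.1 e.symm).2
    exact h.ne' this
  · refine lt_of_le_of_ne (Complex.arg_le_pi w) fun e => ?_
    exact h.ne' (Complex.arg_eq_pi_iff.1 e).2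

theorem ac_eq_one_of_im_pos (x : G) {w w' : ℂ} (h : 0 < w.im) (h' : 0 < w'.im) :
    ac x w w' = 1 := by
  apply ac_eq_one
  have h1 := arg_mem_of_im_pos h
  have h2 := arg_mem_of_im_pos h'
  rw [abs_lt]
  constructor <;> linarith

theorem ac_eq_one_of_im_neg (x : G) {w w' : ℂ} (h : w.im < 0) (h' : w'.im < 0) :
    ac x w w' = 1 := by
  apply ac_eq_one
  have h1 := Complex.arg_neg_iff.2 h
  have h2 := Complex.arg_neg_iff.2 h'
  have := Complex.neg_pi_lt_arg w
  have := Complex.neg_pi_lt_arg w'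
  rw [abs_lt]
  constructor <;> linarith

theorem arg_gt_of_re_neg {w : ℂ} (h : w.re < 0) (h' : 0 ≤ w.im) : Real.pi / 2 < w.arg := by
  by_contra! hc
  have h0 := Complex.arg_nonneg_iff.2 h'
  have := Complex.abs_arg_le_pi_div_two_iff.1 (abs_le.2 ⟨by linarith [Real.pi_pos], hc⟩)
  linarith

theorem arg_lt_of_re_neg {w : ℂ} (h : w.re < 0) (h' : w.im < 0) : w.arg < -(Real.pi / 2) := by
  by_contra! hc
  have h0 := Complex.arg_neg_iff.2 h'
  have := Complex.abs_arg_le_pi_div_two_iff.1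
    (abs_le.2 ⟨hc, h0.le.trans (half_pos Real.pi_pos).le⟩)
  linarith

theorem ac_of_re_neg (x : G) {w w' : ℂ} (h : w.re < 0) (h' : w'.re < 0) :
    ac x w w' = if 0 ≤ w.im then (if 0 ≤ w'.im then 1 else x) else
      (if 0 ≤ w'.im then x⁻¹ else 1) := by
  have hp := Real.pi_pos
  have a1 := Complex.neg_pi_lt_arg w
  have a2 := Complex.neg_pi_lt_arg w'
  have b1 := Complex.arg_le_pi w
  have b2 := Complex.arg_le_pi w'
  split_ifs with h1 h2 h2
  · have := arg_gt_of_re_neg h h1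
    have := arg_gt_of_re_neg h' h2
    exact ac_eq_one x (by rw [abs_lt]; constructor <;> linarith)
  · have := arg_gt_of_re_neg h h1
    have := arg_lt_of_re_neg h' (not_le.1 h2)
    have := ac_eq_zpow x (w := w) (w' := w') (a := w.arg - 2 * Real.pi) (a' := w'.arg)
      (k := 1) (k' := 0) (by push_cast; ring) (by simp)
      (by rw [abs_lt]; constructor <;> linarith)
    simpa using this
  · have := arg_lt_of_re_neg h (not_le.1 h1)
    have := arg_gt_of_re_neg h' h2
    have := ac_eq_zpow x (w := w) (w' := w') (a := w.arg + 2 * Real.pi) (a' := w'.arg)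
      (k := -1) (k' := 0) (by push_cast; ring) (by simp)
      (by rw [abs_lt]; constructor <;> linarith)
    simpa using this
  · have := arg_lt_of_re_neg h (not_le.1 h1)
    have := arg_lt_of_re_neg h' (not_le.1 h2)
    exact ac_eq_one x (by rw [abs_lt]; constructor <;> linarith)

/-- Near a point where `F ≠ 0`, `arg F` is, up to multiples of `2π`, a continuous function. -/
theorem exists_arg_lift {F : X → ℂ} {x : X} (hF : ContinuousAt F x) (h0 : F x ≠ 0) :
    ∃ b : X → ℝ, ContinuousAt b x ∧ ∀ᶠ y in 𝓝 x, ∃ k : ℤ, (F y).arg = b y + 2 * Real.pi * k := by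
  refine ⟨fun y => (F x).arg + (F y / F x).arg, ?_, ?_⟩
  · refine continuousAt_const.add ?_
    refine (Complex.continuousAt_arg ?_).comp (f := fun y => F y / F x) (hF.div_const _)
    rw [div_self h0]; exact Complex.one_mem_slitPlane
  · filter_upwards [hF.eventually_ne h0] with y hy
    have := Complex.arg_mul_coe_angle h0 (div_ne_zero hy h0)
    rw [mul_div_cancel₀ _ h0, ← Real.Angle.coe_add, Real.Angle.angle_eq_iff_two_pi_dvd_sub] at this
    obtain ⟨k, hk⟩ := this
    exact ⟨k, by linarith⟩

theorem exists_nhds_abs_sub_lt {b : X → ℝ} {x : X} (hb : ContinuousAt b x) :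
    ∃ U ∈ 𝓝 x, ∀ y ∈ U, ∀ z ∈ U, |b y - b z| < Real.pi := by
  refine ⟨_, hb (ball_mem_nhds (b x) (half_pos Real.pi_pos)), fun y hy z hz => ?_⟩
  simp only [mem_preimage, mem_ball, Real.dist_eq] at hy hz
  rw [abs_lt] at *
  constructor <;> linarith [hy.1, hy.2, hz.1, hz.2]

theorem lc_ac (x : G) : LC (ac x) {w | w ≠ 0} := by
  intro w0 h0
  obtain ⟨b, hb, hk⟩ := exists_arg_lift (F := id) continuousAt_id h0
  obtain ⟨U, hU, H⟩ := exists_nhds_abs_sub_lt hb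
  refine ⟨_, Filter.inter_mem hU hk, fun y hy z hz w hw => ?_⟩
  obtain ⟨k1, h1⟩ := hy.2
  obtain ⟨k2, h2⟩ := hz.2
  obtain ⟨k3, h3⟩ := hw.2
  simp only [id] at h1 h2 h3
  rw [ac_eq_zpow x h1 h2 (H y hy.1 z hz.1), ac_eq_zpow x h2 h3 (H z hz.1 w hw.1),
    ac_eq_zpow x h1 h3 (H y hy.1 w hw.1), ← zpow_add]
  congr 1; ring

theorem gauge_ac {A : Set X} (hA : IsOpen A) {F K H : X → ℂ} {p : ℕ} (x : G)
    (hF : ∀ y ∈ A, F y = K y ^ p * H y) (hK : ∀ y ∈ A, ContinuousAt K y ∧ K y ≠ 0)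
    (hH : ∀ y ∈ A, ContinuousAt H y ∧ H y ∈ Complex.slitPlane) :
    Gauge (pb (ac x) F) (pb (ac (x ^ p)) K) A := by
  have hk : ∀ y, ∃ k : ℤ, y ∈ A → (F y).arg = p * (K y).arg + (H y).arg + 2 * Real.pi * k := by
    intro y
    by_cases hy : y ∈ A
    · have := Complex.arg_mul_coe_angle (pow_ne_zero p (hK y hy).2)
        (Complex.slitPlane_ne_zero (hH y hy).2)
      rw [← hF y hy, Complex.arg_pow_coe_angle, ← Real.Angle.coe_nsmul, ← Real.Angle.coe_add,
        Real.Angle.angle_eq_iff_two_pi_dvd_sub] at this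
      obtain ⟨k, hk⟩ := this
      exact ⟨k, fun _ => by rw [nsmul_eq_mul] at hk; linarith⟩
    · exact ⟨0, fun h => absurd h hy⟩
  choose k hk using hk
  refine ⟨fun y => x ^ (- k y), fun y0 hy0 => ?_⟩
  obtain ⟨b, hb, hbm⟩ := exists_arg_lift (hK y0 hy0).1 (hK y0 hy0).2
  obtain ⟨U, hU, hUb⟩ := exists_nhds_abs_sub_lt hb
  obtain ⟨V, hV, hVb⟩ := exists_nhds_abs_sub_lt (b := fun y => p * b y + (H y).arg)
    ((continuousAt_const.mul hb).add
      ((Complex.continuousAt_arg (hH y0 hy0).2).comp (f := H) (hH y0 hy0).1))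
  refine ⟨_, Filter.inter_mem (Filter.inter_mem hU hV) (Filter.inter_mem hbm (hA.mem_nhds hy0)),
    fun y hy z hz => ?_⟩
  obtain ⟨⟨hyU, hyV⟩, ⟨m, hm⟩, hyA⟩ := hy
  obtain ⟨⟨hzU, hzV⟩, ⟨m', hm'⟩, hzA⟩ := hz
  simp only [pb]
  rw [ac_eq_zpow (x ^ p) hm hm' (hUb y hyU z hzU),
    ac_eq_zpow x (k := p * m + k y) (k' := p * m' + k z)
      (by rw [hk y hyA, hm]; push_cast; ring) (by rw [hk z hzA, hm']; push_cast; ring)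
      (hVb y hyV z hzV), ← zpow_natCast, ← zpow_mul, ← zpow_neg, ← zpow_add, ← zpow_add]
  congr 1; ring

/-- A nontrivial angular cocycle has no primitive on a circle. -/
theorem eq_one_of_prim_ac {x : G} {r : ℝ} (hr : 0 < r) {φ : ℂ → G}
    (h : Prim (ac x) φ (sphere (0 : ℂ) r)) : x = 1 := by
  let γ : ℝ → ℂ := fun t => r * (Real.Angle.cos t + Real.Angle.sin t * Complex.I)
  have hγ : Continuous γ := by
    simp only [γ, Real.Angle.cos_coe, Real.Angle.sin_coe]
    fun_prop
  have hγe : ∀ t, γ t = r * Complex.exp (t * Complex.I) := by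
    intro t
    simp only [γ, Real.Angle.cos_coe, Real.Angle.sin_coe, Complex.exp_mul_I]
    push_cast; ring
  have hk : ∀ t : ℝ, ∃ k : ℤ, (γ t).arg = t + 2 * Real.pi * k := by
    intro t
    have := Complex.arg_mul_cos_add_sin_mul_I_coe_angle hr (t : Real.Angle)
    rw [Real.Angle.angle_eq_iff_two_pi_dvd_sub] at this
    obtain ⟨k, hk⟩ := this
    exact ⟨k, by linarith⟩
  choose k hk using hk
  have p1 : Prim (pb (ac x) γ) (fun t => x ^ (-k t)) univ := by
    intro t _
    obtain ⟨U, hU, H⟩ := exists_nhds_abs_sub_lt (continuousAt_id (x := t))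
    refine ⟨U, mem_nhdsWithin_of_mem_nhds hU, fun y hy z hz => ?_⟩
    simp only [pb]
    rw [ac_eq_zpow x (hk y) (hk z) (H y hy z hz), ← zpow_neg, ← zpow_add]
    congr 1; ring
  have p2 := h.pb (g := γ) (B := univ) hγ.continuousOn (fun t _ => by
    rw [mem_sphere_zero_iff_norm, hγe, norm_mul, Complex.norm_exp_ofReal_mul_I]
    simp [abs_of_pos hr])
  have e := p1.unique' p2 isPreconnected_univ (mem_univ 0) (mem_univ (2 * Real.pi))
  have per : γ (2 * Real.pi) = γ 0 := by
    rw [hγe, hγe]; push_cast; simp [Complex.exp_two_pi_mul_I]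
  simp only [Function.comp, per, inv_mul_cancel] at e
  have k1 : (k 0 : ℝ) = k (2 * Real.pi) + 1 := by
    have h0 := hk 0
    have h1 := hk (2 * Real.pi)
    rw [per, h0] at h1
    have hp := Real.pi_pos
    have : 2 * Real.pi * ((k 0 : ℝ) - (k (2 * Real.pi) + 1)) = 0 := by linarith
    rcases mul_eq_zero.1 this with h | h
    · linarith
    · linarith
  have k2 : k 0 = k (2 * Real.pi) + 1 := by exact_mod_cast k1
  rw [k2, ← zpow_neg, ← zpow_add] at e
  simpa using e

end Angular

section Steps

set_option linter.unusedSectionVars false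

variable {T J G : Type*} [TopologicalSpace T] [Group G]

/-- The open collar `7/8 < ‖d‖ < 1` of the solid torus `‖d‖ ≤ 1` in `T × ℂ`. -/
def collar (T : Type*) : Set (T × ℂ) := {y | 7 / 8 < ‖y.2‖ ∧ ‖y.2‖ < 1}

/-- A family of disjoint embeddings of the solid torus `‖d‖ ≤ 1` into its interior. -/
structure GoodStep (f : J → T × ℂ → T × ℂ) : Prop where
  cont : ∀ j, Continuous (f j)
  isOpenMap : ∀ j, IsOpenMap (f j)
  inj : ∀ j j' y y', ‖y.2‖ ≤ 1 → ‖y'.2‖ ≤ 1 → f j y = f j' y' → j = j' ∧ y = y'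
  maps : ∀ j y, ‖y.2‖ ≤ 1 → ‖(f j y).2‖ < 7 / 8

/-- The angular cocycle with holonomy `z` on the collar extends off the cores of the inner tori,
being angular with holonomy `ζ j` on the `j`-th inner collar. -/
def Ext (f : J → T × ℂ → T × ℂ) (z : G) (ζ : J → G) : Prop :=
  ∃ Ψ : T × ℂ → T × ℂ → G, LC Ψ {y | ∀ j v, v.2 = 0 → f j v ≠ y} ∧
    Gauge Ψ (pb (ac z) Prod.snd) (collar T) ∧
    ∀ j, Gauge (pb Ψ (f j)) (pb (ac (ζ j)) Prod.snd) (collar T)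

/-- Angular cocycles with holonomy in `S` extend, with inner holonomies in `S` again. -/
def HasExt (S : Set G) (f : J → T × ℂ → T × ℂ) : Prop :=
  ∀ z ∈ S, ∃ ζ : J → G, (∀ j, ζ j ∈ S) ∧ Ext f z ζ

theorem GoodStep.reindex {J' : Type*} {f : J → T × ℂ → T × ℂ} (h : GoodStep f) (e : J' ≃ J) :
    GoodStep (fun j => f (e j)) where
  cont j := h.cont _
  isOpenMap j := h.isOpenMap _
  inj j j' y y' hy hy' hj := by
    obtain ⟨h1, h2⟩ := h.inj _ _ y y' hy hy' hj
    exact ⟨e.injective h1, h2⟩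
  maps j := h.maps _

theorem Ext.reindex {J' : Type*} {f : J → T × ℂ → T × ℂ} {z : G} {ζ : J → G} (h : Ext f z ζ)
    (e : J' ≃ J) : Ext (fun j => f (e j)) z (ζ ∘ e) := by
  obtain ⟨Ψ, h2, h3, h4⟩ := h
  refine ⟨Ψ, h2.mono fun y hy j v hv => ?_, h3, fun j => h4 _⟩
  simpa using hy (e.symm j) v hv

theorem HasExt.reindex {J' : Type*} {S : Set G} {f : J → T × ℂ → T × ℂ} (h : HasExt S f)
    (e : J' ≃ J) : HasExt S (fun j => f (e j)) := by
  intro z hz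
  obtain ⟨ζ, h1, h2⟩ := h z hz
  exact ⟨ζ ∘ e, fun j => h1 _, h2.reindex e⟩

variable {I : Type*} [DecidableEq I]

/-- Projection to the `i`-th circle coordinate and the disc coordinate. -/
def pr (i : I) (y : (I → T) × ℂ) : T × ℂ := (y.1 i, y.2)

/-- Act by `g` on the `i`-th circle coordinate and the disc coordinate. -/
def lift (i : I) (g : T × ℂ → T × ℂ) (y : (I → T) × ℂ) : (I → T) × ℂ :=
  (Function.update y.1 i (g (pr i y)).1, (g (pr i y)).2)

@[fun_prop]
theorem continuous_pr (i : I) : Continuous (pr i : (I → T) × ℂ → T × ℂ) := by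
  unfold pr; fun_prop

theorem pr_lift (i : I) (g : T × ℂ → T × ℂ) (y : (I → T) × ℂ) : pr i (lift i g y) = g (pr i y) := by
  simp [pr, lift]

theorem lift_fst_of_ne {i k : I} (h : k ≠ i) (g : T × ℂ → T × ℂ) (y : (I → T) × ℂ) :
    (lift i g y).1 k = y.1 k := by
  simp [lift, h]

/-- Splitting off the `i`-th circle coordinate. -/
def splitHomeo (i : I) : (I → T) × ℂ ≃ₜ (T × ℂ) × ({k // k ≠ i} → T) where
  toFun y := (pr i y, fun k => y.1 k)
  invFun q := (fun k => if h : k = i then q.1.1 else q.2 ⟨k, h⟩, q.1.2)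
  left_inv y := by
    refine Prod.ext (funext fun k => ?_) rfl
    by_cases h : k = i
    · subst h; simp [pr]
    · simp [h]
  right_inv q := by
    refine Prod.ext (Prod.ext ?_ rfl) (funext fun k => ?_)
    · simp [pr]
    · simp [k.2]
  continuous_toFun := by fun_prop
  continuous_invFun := by
    refine Continuous.prodMk (continuous_pi fun k => ?_) (by fun_prop)
    by_cases h : k = i
    · simp only [h, dite_true]; fun_prop
    · simp only [h, dite_false]; fun_prop

theorem lift_eq (i : I) (g : T × ℂ → T × ℂ) :
    lift i g = (splitHomeo i).symm ∘ Prod.map g id ∘ splitHomeo i := by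
  funext y
  apply (splitHomeo i).injective
  simp only [Function.comp_apply, Homeomorph.apply_symm_apply]
  refine Prod.ext (pr_lift i g y) (funext fun k => ?_)
  exact lift_fst_of_ne k.2 g y

theorem GoodStep.lift {f : J → T × ℂ → T × ℂ} (h : GoodStep f) (i : I) :
    GoodStep (fun j => lift i (f j)) where
  cont j := by
    simp only [lift_eq]
    exact (Homeomorph.continuous _).comp (((h.cont j).prodMap continuous_id).comp
      (Homeomorph.continuous _))
  isOpenMap j := by
    simp only [lift_eq]
    exact (Homeomorph.isOpenMap _).comp (((h.isOpenMap j).prodMap IsOpenMap.id).comp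
      (Homeomorph.isOpenMap _))
  inj j j' y y' hy hy' hj := by
    have h1 := congrArg (pr i) hj
    simp only [pr_lift] at h1
    obtain ⟨h2, h3⟩ := h.inj j j' _ _ hy hy' h1
    refine ⟨h2, Prod.ext (funext fun k => ?_) (congrArg Prod.snd h3 :)⟩
    by_cases hk : k = i
    · subst hk; exact congrArg Prod.fst h3
    · have := congrArg (fun q => q.1 k) hj
      simpa only [lift_fst_of_ne hk] using this
  maps j y hy := h.maps j (pr i y) hy

theorem Ext.lift {f : J → T × ℂ → T × ℂ} {z : G} {ζ : J → G} (h : Ext f z ζ) (i : I) :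
    Ext (fun j => lift i (f j)) z ζ := by
  obtain ⟨Ψ, h2, h3, h4⟩ := h
  refine ⟨pb Ψ (pr i), ?_, ?_, fun j => ?_⟩
  · refine h2.pb (fun y _ => (continuous_pr i).continuousAt) fun y hy j v hv hfv => ?_
    refine hy j (Function.update y.1 i v.1, v.2) hv ?_
    have e : pr i (Function.update y.1 i v.1, v.2) = v := by simp [pr]
    simp only [WildCantor.lift, e, hfv]
    simp [pr]
  · exact h3.pb (g := pr i) (fun y _ => (continuous_pr i).continuousAt) fun y hy => hy
  · have := (h4 j).pb (g := pr i) (B := collar (I → T))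
      (fun y _ => (continuous_pr i).continuousAt) fun y hy => hy
    have e : pb (pb Ψ (pr i)) (WildCantor.lift i (f j)) = pb (pb Ψ (f j)) (pr i) := by
      funext a b; simp only [pb, pr_lift]
    rw [e]
    exact this

theorem HasExt.lift {S : Set G} {f : J → T × ℂ → T × ℂ} (h : HasExt S f) (i : I) :
    HasExt S (fun j => lift i (f j)) := by
  intro z hz
  obtain ⟨ζ, h1, h2⟩ := h z hz
  exact ⟨ζ, h1, h2.lift i⟩

end Steps

section Cable

theorem exists_cable_radius (p : ℕ) : ∃ r : ℝ, 0 < r ∧ r ≤ 1 / 16 ∧ (1 ≤ p → ∀ w : ℂ, ‖w‖ ≤ 8 * r →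
    0 < (∑ i ∈ Finset.range p, (1 + w) ^ i).re ∧ 0 < ((1 + w) ^ p).re) := by
  by_cases hp : 1 ≤ p
  swap
  · exact ⟨1 / 16, by norm_num, le_rfl, fun h => absurd h hp⟩
  have h1 : ∀ᶠ w : ℂ in 𝓝 0, 0 < (∑ i ∈ Finset.range p, (1 + w) ^ i).re := by
    have : ContinuousAt (fun w : ℂ => (∑ i ∈ Finset.range p, (1 + w) ^ i).re) 0 :=
      Continuous.continuousAt (by fun_prop)
    refine this.eventually (lt_mem_nhds ?_)
    simp
    omega
  have h2 : ∀ᶠ w : ℂ in 𝓝 0, 0 < ((1 + w) ^ p).re := by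
    have : ContinuousAt (fun w : ℂ => ((1 + w) ^ p).re) 0 :=
      Continuous.continuousAt (by fun_prop)
    refine this.eventually (lt_mem_nhds ?_)
    simp
  obtain ⟨ε, hε, H⟩ := Metric.eventually_nhds_iff.1 (h1.and h2)
  refine ⟨min (1 / 16) (ε / 16), by positivity, min_le_left _ _, fun _ w hw => H ?_⟩
  rw [dist_zero_right]
  have := min_le_right (1 / 16) (ε / 16)
  linarith

/-- Thickness of the cable winding `p` times. -/
def cabR (p : ℕ) : ℝ := (exists_cable_radius p).choose

theorem cabR_pos (p : ℕ) : 0 < cabR p := (exists_cable_radius p).choose_spec.1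

theorem cabR_le (p : ℕ) : cabR p ≤ 1 / 16 := (exists_cable_radius p).choose_spec.2.1

theorem cabR_spec {p : ℕ} (hp : 1 ≤ p) {w : ℂ} (hw : ‖w‖ ≤ 8 * cabR p) :
    0 < (∑ i ∈ Finset.range p, (1 + w) ^ i).re ∧ 0 < ((1 + w) ^ p).re :=
  (exists_cable_radius p).choose_spec.2.2 hp w hw

/-- The cable winding `p` times at distance `ρ` from the core. -/
def cable (p : ℕ) (ρ : ℝ) (y : Circle × ℂ) : Circle × ℂ :=
  (y.1 ^ p, (y.1 : ℂ) * (ρ + cabR p * ((y.1 : ℂ) ^ p)⁻¹ * y.2))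

theorem circle_pow_ne_zero (θ : Circle) (p : ℕ) : (θ : ℂ) ^ p ≠ 0 :=
  pow_ne_zero _ (Circle.coe_ne_zero θ)

theorem continuous_cable (p : ℕ) (ρ : ℝ) : Continuous (cable p ρ) := by
  unfold cable
  have : Continuous fun y : Circle × ℂ => ((y.1 : ℂ) ^ p)⁻¹ :=
    Continuous.inv₀ (by fun_prop) fun y => circle_pow_ne_zero _ _
  fun_prop

theorem circle_pow_isOpenMap {p : ℕ} (hp : 1 ≤ p) : IsOpenMap fun θ : Circle => θ ^ p := by
  refine MonoidHom.isOpenMap_of_sigmaCompact (powMonoidHom p : Circle →* Circle) (fun z => ?_)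
    (continuous_pow p)
  refine ⟨Circle.exp ((z : ℂ).arg / p), ?_⟩
  have hp' : (p : ℝ) ≠ 0 := by positivity
  rw [powMonoidHom_apply, ← Circle.exp_nsmul, nsmul_eq_mul, mul_div_cancel₀ _ hp', Circle.exp_arg]

theorem isOpenMap_cable {p : ℕ} (hp : 1 ≤ p) (ρ : ℝ) : IsOpenMap (cable p ρ) := by
  have hr : (cabR p : ℂ) ≠ 0 := by exact_mod_cast (cabR_pos p).ne'
  have hinv : Continuous fun y : Circle × ℂ => ((y.1 : ℂ) ^ p)⁻¹ :=
    Continuous.inv₀ (by fun_prop) fun y => circle_pow_ne_zero _ _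
  have hinv' : Continuous fun y : Circle × ℂ => (y.1 : ℂ)⁻¹ :=
    Continuous.inv₀ (by fun_prop) fun y => Circle.coe_ne_zero _
  let e : Circle × ℂ ≃ₜ Circle × ℂ :=
    { toFun := fun y => (y.1, (y.1 : ℂ) * (ρ + cabR p * ((y.1 : ℂ) ^ p)⁻¹ * y.2))
      invFun := fun y => (y.1, ((y.1 : ℂ)⁻¹ * y.2 - ρ) * (y.1 : ℂ) ^ p / cabR p)
      left_inv := fun y => by
        have h1 := circle_pow_ne_zero y.1 p
        have h2 := Circle.coe_ne_zero y.1
        refine Prod.ext rfl ?_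
        simp only
        field_simp
        ring
      right_inv := fun y => by
        have h1 := circle_pow_ne_zero y.1 p
        have h2 := Circle.coe_ne_zero y.1
        refine Prod.ext rfl ?_
        simp only
        field_simp
        ring
      continuous_toFun := by fun_prop
      continuous_invFun := by fun_prop }
  exact ((circle_pow_isOpenMap hp).prodMap IsOpenMap.id).comp e.isOpenMap

/-- The relative displacement of a point of the cable from its core. -/
def cabW (p : ℕ) (ρ : ℝ) (y : Circle × ℂ) : ℂ := (cabR p / ρ : ℝ) * ((y.1 : ℂ) ^ p)⁻¹ * y.2

theorem cable_snd {p : ℕ} {ρ : ℝ} (hρ : 1 / 4 ≤ ρ) (y : Circle × ℂ) :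
    (cable p ρ y).2 = y.1 * ρ * (1 + cabW p ρ y) := by
  have : (ρ : ℂ) ≠ 0 := by exact_mod_cast (by linarith : ρ ≠ 0)
  simp only [cable, cabW]
  push_cast
  field_simp

theorem norm_cabW {p : ℕ} {ρ : ℝ} (hρ : 1 / 4 ≤ ρ) {y : Circle × ℂ} (hy : ‖y.2‖ ≤ 1) :
    ‖cabW p ρ y‖ ≤ 4 * cabR p := by
  have h0 := cabR_pos p
  have hρ0 : 0 < ρ := by linarith
  have h1 : cabR p / ρ ≤ 4 * cabR p := by
    rw [div_le_iff₀ hρ0]; nlinarith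
  have e : ‖cabW p ρ y‖ = cabR p / ρ * ‖y.2‖ := by
    simp [cabW, abs_of_pos h0, abs_of_pos hρ0, Circle.norm_coe]
  rw [e]
  have := norm_nonneg y.2
  have : 0 < cabR p / ρ := by positivity
  nlinarith

theorem cable_norm_bounds {p : ℕ} {ρ : ℝ} (hρ : 1 / 4 ≤ ρ) {y : Circle × ℂ} (hy : ‖y.2‖ ≤ 1) :
    ρ - 1 / 16 ≤ ‖(cable p ρ y).2‖ ∧ ‖(cable p ρ y).2‖ ≤ ρ + 1 / 16 := by
  have h0 := cabR_pos p
  have e : (cable p ρ y).2 = y.1 * ρ + y.1 * (cabR p * ((y.1 : ℂ) ^ p)⁻¹ * y.2) := by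
    simp only [cable]; ring
  have h1 : ‖(y.1 : ℂ) * ρ‖ = ρ := by
    rw [norm_mul, Circle.norm_coe, one_mul, Complex.norm_real, Real.norm_of_nonneg (by linarith)]
  have h2 : ‖(y.1 : ℂ) * (cabR p * ((y.1 : ℂ) ^ p)⁻¹ * y.2)‖ ≤ 1 / 16 := by
    simp only [norm_mul, Circle.norm_coe, norm_inv, norm_pow, one_pow, inv_one, mul_one, one_mul,
      Complex.norm_real, Real.norm_eq_abs, abs_of_pos h0]
    have := cabR_le p
    nlinarith [norm_nonneg y.2]
  rw [e]
  constructor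
  · have := norm_sub_norm_le ((y.1 : ℂ) * ρ) (-((y.1 : ℂ) * (cabR p * ((y.1 : ℂ) ^ p)⁻¹ * y.2)))
    rw [norm_neg, sub_neg_eq_add] at this
    linarith
  · exact (norm_add_le _ _).trans (by linarith)

theorem cable_injOn {p : ℕ} (hp : 1 ≤ p) {ρ : ℝ} (hρ : 1 / 4 ≤ ρ) {y y' : Circle × ℂ}
    (hy : ‖y.2‖ ≤ 1) (hy' : ‖y'.2‖ ≤ 1) (h : cable p ρ y = cable p ρ y') : y = y' := by
  have hr := cabR_pos p
  have hr' := cabR_le p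
  have h1 : y.1 ^ p = y'.1 ^ p := congrArg Prod.fst h
  have h1' : (y.1 : ℂ) ^ p = (y'.1 : ℂ) ^ p := by
    exact_mod_cast congrArg (fun z : Circle => (z : ℂ)) h1
  have h2 := congrArg Prod.snd h
  rw [cable_snd hρ, cable_snd hρ] at h2
  have hρ0 : (ρ : ℂ) ≠ 0 := by exact_mod_cast (by linarith : ρ ≠ 0)
  have hy0 := Circle.coe_ne_zero y.1
  have hy0' := Circle.coe_ne_zero y'.1
  set w := cabW p ρ y with hw
  set w' := cabW p ρ y' with hw'
  have hwn : ‖w‖ ≤ 4 * cabR p := norm_cabW hρ hy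
  have hwn' : ‖w'‖ ≤ 4 * cabR p := norm_cabW hρ hy'
  have h3 : (y.1 : ℂ) * (1 + w) = y'.1 * (1 + w') := by
    have : (ρ : ℂ) * ((y.1 : ℂ) * (1 + w)) = ρ * (y'.1 * (1 + w')) := by linear_combination h2
    exact mul_left_cancel₀ hρ0 this
  let u : ℂ := y'.1 / y.1 - 1
  have hu : ‖u‖ ≤ 8 * cabR p := by
    have : u = w - (y'.1 / y.1) * w' := by
      simp only [u]; field_simp; linear_combination -h3
    rw [this]
    refine (norm_sub_le _ _).trans ?_
    simp only [norm_mul, norm_div, Circle.norm_coe, div_one, one_mul]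
    linarith
  have hpow : (1 + u) ^ p = 1 := by
    simp only [u, add_sub_cancel, div_pow, h1']
    exact div_self (circle_pow_ne_zero _ _)
  have hu0 : u = 0 := by
    have hg := mul_geom_sum (1 + u) p
    rw [hpow, sub_self, add_sub_cancel_left] at hg
    rcases mul_eq_zero.1 hg with h | h
    · exact h
    · have := (cabR_spec hp hu).1
      rw [h] at this
      simp at this
  have hθ : y'.1 = y.1 := by
    have : (y'.1 : ℂ) = y.1 := by
      rw [sub_eq_zero, div_eq_one_iff_eq hy0] at hu0
      exact hu0
    exact Circle.ext this
  have hww : w = w' := by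
    rw [hθ] at h3
    have := mul_left_cancel₀ hy0 h3
    exact add_left_cancel this
  refine Prod.ext hθ.symm ?_
  simp only [hw, hw', cabW, hθ] at hww
  refine mul_left_cancel₀ (mul_ne_zero ?_ (inv_ne_zero (circle_pow_ne_zero y.1 p))) hww
  exact_mod_cast (div_pos hr (by linarith : 0 < ρ)).ne'

theorem goodStep_cable {p : ℕ} (hp : 1 ≤ p) {ρ : ℝ} (hρ : 1 / 4 ≤ ρ) (hρ' : ρ ≤ 3 / 4)
    {J : Type*} [Subsingleton J] : GoodStep (fun _ : J => cable p ρ) where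
  cont _ := continuous_cable p ρ
  isOpenMap _ := isOpenMap_cable hp ρ
  inj _ _ _ _ hy hy' h := ⟨Subsingleton.elim _ _, cable_injOn hp hρ hy hy' h⟩
  maps _ _ hy := (cable_norm_bounds hρ hy).2.trans_lt (by linarith)

theorem isOpen_collar {T : Type*} [TopologicalSpace T] : IsOpen (collar T) :=
  (isOpen_lt continuous_const continuous_snd.norm).inter
    (isOpen_lt continuous_snd.norm continuous_const)

theorem ext_cable {G : Type*} [Group G] {p : ℕ} (hp : 1 ≤ p) {ρ : ℝ} (hρ : 1 / 4 ≤ ρ)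
    (hρ' : ρ ≤ 3 / 4) {J : Type*} [Nonempty J] (x : G) :
    Ext (fun _ : J => cable p ρ) (x ^ p) fun _ => x := by
  have hρ0 : (ρ : ℂ) ≠ 0 := by exact_mod_cast (by linarith : ρ ≠ 0)
  have hρ1 : 0 < ρ := by linarith
  let F : Circle × ℂ → ℂ := fun y => y.2 ^ p - ρ ^ p * y.1
  have hF : Continuous F := by fun_prop
  have hO : IsOpen (collar Circle) := isOpen_collar
  refine ⟨pb (ac x) F, ?_, ?_, fun j => ?_⟩
  · refine (lc_ac x).pb (fun y _ => hF.continuousAt) fun y hy hFy => ?_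
    have h1 : y.2 ^ p = ρ ^ p * y.1 := sub_eq_zero.1 hFy
    have h2 : (y.2 / ρ) ^ p = y.1 := by
      rw [div_pow, h1, mul_div_cancel_left₀ _ (pow_ne_zero p hρ0)]
    have h3 : ‖y.2 / ρ‖ = 1 := by
      have := congrArg norm h2
      rw [norm_pow, Circle.norm_coe] at this
      exact (pow_eq_one_iff_of_nonneg (norm_nonneg _) (by omega)).1 this
    refine hy (Classical.arbitrary J) (⟨y.2 / ρ, mem_sphere_zero_iff_norm.2 h3⟩, 0) rfl ?_
    refine Prod.ext (Circle.ext ?_) ?_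
    · rw [← h2]; rfl
    · simp only [cable, mul_zero, add_zero]
      exact div_mul_cancel₀ _ hρ0
  · have hne : ∀ y ∈ collar Circle, y.2 ≠ 0 := fun y hy h => by
      have := hy.1
      rw [h, norm_zero] at this
      linarith
    refine gauge_ac hO x (H := fun y => 1 - ρ ^ p * y.1 / y.2 ^ p) (fun y hy => ?_)
      (fun y hy => ⟨continuousAt_snd, hne y hy⟩) (fun y hy => ⟨?_, Or.inl ?_⟩)
    · have := pow_ne_zero p (hne y hy)
      simp only [F]
      field_simp
    · refine continuousAt_const.sub (ContinuousAt.div (by fun_prop) (by fun_prop) ?_)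
      exact pow_ne_zero p (hne y hy)
    · have h1 : ‖(ρ : ℂ) ^ p * y.1 / y.2 ^ p‖ < 1 := by
        simp only [norm_div, norm_mul, norm_pow, Circle.norm_coe, mul_one, Complex.norm_real,
          Real.norm_of_nonneg hρ1.le, ← div_pow]
        have h78 := hy.1
        refine pow_lt_one₀ (by positivity) ?_ (by omega)
        rw [div_lt_one (by linarith)]
        linarith
      have h2 := (Complex.abs_re_le_norm _).trans_lt h1
      rw [abs_lt] at h2
      rw [Complex.sub_re, Complex.one_re]
      linarith [h2.2]
  · have e : pb (pb (ac x) F) (cable p ρ) = pb (ac x) (F ∘ cable p ρ) := rfl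
    rw [e]
    have := gauge_ac hO (F := F ∘ cable p ρ) (K := Prod.snd) (p := 1) x
      (H := fun y => ((ρ ^ (p - 1) * cabR p : ℝ) : ℂ) *
        ∑ i ∈ Finset.range p, (1 + cabW p ρ y) ^ i) (fun y hy => ?_)
      (fun y hy => ⟨continuousAt_snd, fun h => ?_⟩) (fun y hy => ⟨?_, Or.inl ?_⟩)
    · simpa using this
    · have h1 : F (cable p ρ y) = ρ ^ p * y.1 ^ p * ((1 + cabW p ρ y) ^ p - 1) := by
        simp only [F, cable_snd hρ]
        simp only [cable, Circle.coe_pow, mul_pow]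
        ring
      obtain ⟨q, rfl⟩ : ∃ q, p = q + 1 := ⟨p - 1, by omega⟩
      have h2 := mul_geom_sum (1 + cabW (q + 1) ρ y) (q + 1)
      rw [add_sub_cancel_left] at h2
      have h3 : (ρ : ℂ) * (y.1 : ℂ) ^ (q + 1) * cabW (q + 1) ρ y = cabR (q + 1) * y.2 := by
        have := circle_pow_ne_zero y.1 (q + 1)
        simp only [cabW]
        push_cast
        field_simp
      rw [Function.comp_apply, h1, ← h2, pow_one, Nat.add_sub_cancel]
      push_cast
      linear_combination (ρ : ℂ) ^ q * (∑ i ∈ Finset.range (q + 1),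
        (1 + cabW (q + 1) ρ y) ^ i) * h3
    · have := hy.1
      rw [h, norm_zero] at this
      linarith
    · have : Continuous fun y : Circle × ℂ => ((y.1 : ℂ) ^ p)⁻¹ :=
        Continuous.inv₀ (by fun_prop) fun y => circle_pow_ne_zero _ _
      have h2 : Continuous (cabW p ρ) := by unfold cabW; fun_prop
      exact Continuous.continuousAt (by fun_prop)
    · rw [Complex.re_ofReal_mul]
      have h1 := norm_cabW (p := p) hρ hy.2.le
      have h2 := (cabR_spec hp (h1.trans (by linarith [cabR_pos p]))).1
      have := cabR_pos p
      positivity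

theorem cable_lipschitz {p : ℕ} {ρ : ℝ} (hρ : 1 / 4 ≤ ρ) (hρ' : ρ ≤ 3 / 4)
    {y y' : Circle × ℂ} (hy' : ‖y'.2‖ ≤ 1) :
    dist (cable p ρ y) (cable p ρ y') ≤ (p + 3) * dist y y' := by
  have hr := cabR_pos p
  have hr' := cabR_le p
  set D := dist y y' with hD
  have hD0 : 0 ≤ D := dist_nonneg
  have d1 : ‖(y.1 : ℂ) - y'.1‖ ≤ D := by
    rw [← dist_eq_norm]
    exact le_max_left _ _
  have d2 : ‖y.2 - y'.2‖ ≤ D := by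
    rw [← dist_eq_norm]
    exact le_max_right _ _
  have hpow : ‖(y.1 : ℂ) ^ p - (y'.1 : ℂ) ^ p‖ ≤ p * D := by
    rw [← geom_sum₂_mul, norm_mul]
    refine mul_le_mul ?_ d1 (norm_nonneg _) (by positivity)
    refine (norm_sum_le _ _).trans ?_
    simp [Circle.norm_coe]
  have h0 := circle_pow_ne_zero y.1 p
  have h0' := circle_pow_ne_zero y'.1 p
  refine max_le ?_ ?_
  · have e : dist (cable p ρ y).1 (cable p ρ y').1 = ‖(y.1 : ℂ) ^ p - (y'.1 : ℂ) ^ p‖ :=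
      dist_eq_norm ((y.1 : ℂ) ^ p) ((y'.1 : ℂ) ^ p)
    rw [e]
    nlinarith
  · have e : (cable p ρ y).2 - (cable p ρ y').2 = ρ * ((y.1 : ℂ) - y'.1) +
        cabR p * (y.1 * ((y.1 : ℂ) ^ p)⁻¹ * (y.2 - y'.2) +
          ((y.1 : ℂ) - y'.1) * ((y.1 : ℂ) ^ p)⁻¹ * y'.2 -
          y'.1 * (((y.1 : ℂ) ^ p - (y'.1 : ℂ) ^ p) *
            (((y.1 : ℂ) ^ p)⁻¹ * ((y'.1 : ℂ) ^ p)⁻¹)) * y'.2) := by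
      simp only [cable]
      field_simp
      ring
    rw [dist_eq_norm, e]
    have n1 : ‖(y.1 : ℂ) * ((y.1 : ℂ) ^ p)⁻¹ * (y.2 - y'.2)‖ ≤ D := by
      simpa [Circle.norm_coe] using d2
    have n2 : ‖((y.1 : ℂ) - y'.1) * ((y.1 : ℂ) ^ p)⁻¹ * y'.2‖ ≤ D := by
      simp only [norm_mul, norm_inv, norm_pow, Circle.norm_coe, one_pow, inv_one, mul_one]
      nlinarith [norm_nonneg ((y.1 : ℂ) - y'.1)]
    have n3 : ‖(y'.1 : ℂ) * (((y.1 : ℂ) ^ p - (y'.1 : ℂ) ^ p) *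
            (((y.1 : ℂ) ^ p)⁻¹ * ((y'.1 : ℂ) ^ p)⁻¹)) * y'.2‖ ≤ p * D := by
      simp only [norm_mul, norm_inv, norm_pow, Circle.norm_coe, one_pow, inv_one, mul_one, one_mul]
      nlinarith [norm_nonneg ((y.1 : ℂ) ^ p - (y'.1 : ℂ) ^ p), norm_nonneg y'.2]
    have n4 := (norm_sub_le ((y.1 : ℂ) * ((y.1 : ℂ) ^ p)⁻¹ * (y.2 - y'.2) +
          ((y.1 : ℂ) - y'.1) * ((y.1 : ℂ) ^ p)⁻¹ * y'.2) (y'.1 * (((y.1 : ℂ) ^ p - (y'.1 : ℂ) ^ p) *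
            (((y.1 : ℂ) ^ p)⁻¹ * ((y'.1 : ℂ) ^ p)⁻¹)) * y'.2)).trans
        (add_le_add ((norm_add_le _ _).trans (add_le_add n1 n2)) n3)
    refine (norm_add_le _ _).trans ?_
    rw [norm_mul, norm_mul, Complex.norm_real, Complex.norm_real, Real.norm_of_nonneg hr.le,
      Real.norm_of_nonneg (by linarith : 0 ≤ ρ)]
    have n5 : ρ * ‖(y.1 : ℂ) - y'.1‖ ≤ 1 * D := by
      refine mul_le_mul (by linarith) d1 (norm_nonneg _) zero_le_one
    have n6 := mul_le_mul (hr'.trans (by norm_num : (1 : ℝ) / 16 ≤ 1)) n4 (norm_nonneg _) zero_le_one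
    linarith

end Cable

section Kill

variable {G : Type*} [Group G]

/-- A primitive of a translation invariant cocycle on a connected space is quasi-periodic. -/
theorem Prim.translate {V : Type*} [AddCommGroup V] [TopologicalSpace V] [ContinuousAdd V]
    [PreconnectedSpace V] {Φ : V → V → G} {M : V → G} (h : Prim Φ M univ) {v : V}
    (hv : ∀ x y, Φ (x + v) (y + v) = Φ x y) : ∃ c : G, ∀ x, M (x + v) = c * M x := by
  have h2 : Prim Φ (fun x => M (x + v)) univ := by
    have := h.pb (g := fun x => x + v) (B := univ) (by fun_prop) (fun _ _ => mem_univ _)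
    intro x hx
    obtain ⟨U, hU, H⟩ := this x hx
    exact ⟨U, hU, fun y hy z hz => by rw [← hv y z]; exact H y hy z hz⟩
  refine ⟨M (0 + v) * (M 0)⁻¹, fun x => ?_⟩
  rw [h2.unique h isPreconnected_univ (mem_univ 0) (mem_univ x)]
  group

theorem translate_nat {V : Type*} [AddCommGroup V] {M : V → G} {v : V} {c : G}
    (h : ∀ x, M (x + v) = c * M x) (n : ℕ) (x : V) : M (x + n • v) = c ^ n * M x := by
  induction n with
  | zero => simp
  | succ n ih => rw [succ_nsmul, ← add_assoc, h, ih, pow_succ', mul_assoc]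

theorem exists_prim_of_lc_univ {V : Type*} [AddCommGroup V] [Module ℝ V] [TopologicalSpace V]
    [ContinuousSMul ℝ V] {Φ : V → V → G} (h : LC Φ univ) : ∃ φ, Prim Φ φ univ :=
  exists_prim_of_contractible h (H := fun s x => s • x) (x0 := 0) (by fun_prop) (by simp) (by simp)

/-- In a group of exponent `p` the meridian of a solid torus has trivial holonomy off the cable
winding `p` times. -/
theorem meridian_trivial {p : ℕ} (hp : 1 ≤ p) (hG : ∀ g : G, g ^ p = 1) {ρ : ℝ} (hρ : 1 / 4 ≤ ρ)
    (hρ' : ρ ≤ 3 / 4) {Φ : Circle × ℂ → Circle × ℂ → G}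
    (h : LC Φ {y | ‖y.2‖ < 1 ∧ ∀ v, ‖v.2‖ ≤ 1 → cable p ρ v ≠ y}) (τ : Circle) {R : ℝ}
    (hR : 7 / 8 < R) (hR' : R < 1) {ψ : ℝ → G}
    (hψ : Prim (pb Φ fun b : ℝ => (τ, (R * Circle.exp b : ℂ))) ψ univ) (b : ℝ) :
    ψ (b + 2 * Real.pi) = ψ b := by
  obtain ⟨a0, rfl⟩ := Circle.exp_surjective τ
  have hp0 : (p : ℝ) ≠ 0 := by positivity
  let κ : ℝ := Real.pi / p + a0 / p
  have hcl : ∀ r : ℝ, 0 ≤ max 0 (min r R) ∧ max 0 (min r R) ≤ R := fun r =>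
    ⟨le_max_left _ _, max_le (by linarith) (min_le_right _ _)⟩
  -- the spanning strip
  have hS := h.pb (g := fun q : ℝ × ℝ => (Circle.exp (a0 + p * q.1),
      ((max 0 (min q.2 R) : ℝ) * Circle.exp (κ + q.1) : ℂ))) (B := univ)
    (fun _ _ => Continuous.continuousAt (by fun_prop)) (fun q _ => by
      refine ⟨?_, fun v hv hc => ?_⟩
      · simp only [norm_mul, Circle.norm_coe, mul_one, Complex.norm_real]
        rw [Real.norm_of_nonneg (hcl q.2).1]
        exact (hcl q.2).2.trans_lt hR'
      · set s := max 0 (min q.2 R)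
        have h1 : v.1 ^ p = Circle.exp (a0 + p * q.1) := congrArg Prod.fst hc
        have h2 : (cable p ρ v).2 = s * Circle.exp (κ + q.1) := congrArg Prod.snd hc
        rw [cable_snd hρ] at h2
        have h3 := congrArg (· ^ p) h2
        have h4 : (Circle.exp (κ + q.1) : ℂ) ^ p = - (Circle.exp (a0 + p * q.1) : ℂ) := by
          rw [← Circle.coe_pow, ← Circle.exp_nsmul]
          have : p • (κ + q.1) = Real.pi + (a0 + p * q.1) := by
            simp only [κ, nsmul_eq_mul]; field_simp; ring
          rw [this, Circle.exp_add, Circle.coe_mul, Circle.coe_exp Real.pi,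
            Complex.exp_pi_mul_I, neg_one_mul]
        simp only [mul_pow, h4] at h3
        rw [← h1, Circle.coe_pow] at h3
        have h5 := (cabR_spec hp ((norm_cabW (p := p) hρ hv).trans
          (by linarith [cabR_pos p]))).2
        have hρ0 : 0 < ρ := by linarith
        have h6 : (ρ : ℂ) ^ p * (1 + cabW p ρ v) ^ p = -(s : ℂ) ^ p := by
          refine mul_left_cancel₀ (circle_pow_ne_zero v.1 p) ?_
          linear_combination h3
        have h7 := congrArg Complex.re h6
        rw [← Complex.ofReal_pow, Complex.re_ofReal_mul, ← Complex.ofReal_pow, Complex.neg_re,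
          Complex.ofReal_re] at h7
        have : 0 < ρ ^ p * ((1 + cabW p ρ v) ^ p).re := by positivity
        have : 0 ≤ s ^ p := pow_nonneg (hcl q.2).1 p
        linarith)
  -- the outer torus
  have hO : ∀ y : Circle × ℂ, ‖y.2‖ = R → y ∈ {y : Circle × ℂ | ‖y.2‖ < 1 ∧
      ∀ v, ‖v.2‖ ≤ 1 → cable p ρ v ≠ y} := fun y hy => by
    refine ⟨hy.trans_lt hR', fun v hv hc => ?_⟩
    have := (cable_norm_bounds (p := p) hρ hv).2
    rw [hc, hy] at this
    linarith
  have hR0 : 0 < R := by linarith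
  have hT := h.pb (g := fun q : ℝ × ℝ => (Circle.exp (a0 + q.1), (R * Circle.exp q.2 : ℂ)))
    (B := univ) (fun _ _ => Continuous.continuousAt (by fun_prop)) (fun q _ => hO _ (by
      simp [abs_of_pos hR0]))
  -- the core
  have hC := h.pb (g := fun a : ℝ => (Circle.exp (a0 + a), (0 : ℂ)))
    (B := univ) (fun _ _ => Continuous.continuousAt (by fun_prop)) (fun a _ => by
      refine ⟨by simp, fun v hv hc => ?_⟩
      have := (cable_norm_bounds (p := p) hρ hv).1
      rw [hc, norm_zero] at this
      linarith)
  obtain ⟨P, hP⟩ := exists_prim_of_lc_univ hS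
  obtain ⟨M, hM⟩ := exists_prim_of_lc_univ hT
  obtain ⟨K, hK⟩ := exists_prim_of_lc_univ hC
  have per : ∀ a : ℝ, Circle.exp (a + 2 * Real.pi) = Circle.exp a := Circle.periodic_exp
  have perp : ∀ a : ℝ, Circle.exp (a + p * (2 * Real.pi)) = Circle.exp a := fun a => by
    rw [Circle.exp_add, ← Int.cast_natCast, Circle.exp_int_mul_two_pi, mul_one]
  obtain ⟨k, hk⟩ := hK.translate (v := 2 * Real.pi) (fun x y => by
    simp only [pb, ← add_assoc, per])
  obtain ⟨l, hl⟩ := hP.translate (v := ((2 * Real.pi, 0) : ℝ × ℝ)) (fun x y => by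
    simp only [pb, Prod.fst_add, Prod.snd_add, add_zero, mul_add, ← add_assoc, per, perp])
  obtain ⟨A, hA⟩ := hM.translate (v := ((2 * Real.pi, 0) : ℝ × ℝ)) (fun x y => by
    simp only [pb, Prod.fst_add, Prod.snd_add, add_zero, ← add_assoc, per])
  obtain ⟨B, hB⟩ := hM.translate (v := ((0, 2 * Real.pi) : ℝ × ℝ)) (fun x y => by
    simp only [pb, Prod.fst_add, Prod.snd_add, add_zero, per])
  have hl1 : l = 1 := by
    have e1 := (hP.pb (g := fun u : ℝ => (u, (0 : ℝ))) (B := univ) (by fun_prop)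
      (fun _ _ => mem_univ _)).unique' (ψ := fun u => K (p * u)) (fun x hx => by
        obtain ⟨U, hU, H⟩ := (hK.pb (g := fun u : ℝ => p * u) (B := univ) (by fun_prop)
          (fun _ _ => mem_univ _)) x hx
        refine ⟨U, hU, fun y hy z hz => ?_⟩
        refine Eq.trans ?_ (H y hy z hz)
        simp [pb]) isPreconnected_univ (mem_univ 0) (mem_univ (2 * Real.pi))
    have e2 := hl (0, 0)
    have e3 := translate_nat hk p 0
    rw [hG, one_mul, nsmul_eq_mul, zero_add] at e3
    simp only [Function.comp, e3, mul_zero, inv_mul_cancel] at e1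
    simp only [Prod.mk_add_mk, zero_add] at e2
    rw [e2, inv_mul_eq_one] at e1
    exact right_eq_mul.1 e1
  have hB1 : B = 1 := by
    have e1 := (hP.pb (g := fun u : ℝ => (u, R)) (B := univ) (by fun_prop)
      (fun _ _ => mem_univ _)).unique' (ψ := fun u => M (p * u, κ + u)) (fun x hx => by
        obtain ⟨U, hU, H⟩ := (hM.pb (g := fun u : ℝ => ((p * u, κ + u) : ℝ × ℝ)) (B := univ)
          (by fun_prop) (fun _ _ => mem_univ _)) x hx
        refine ⟨U, hU, fun y hy z hz => ?_⟩
        refine Eq.trans ?_ (H y hy z hz)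
        simp [pb, max_eq_right hR0.le]) isPreconnected_univ (mem_univ 0) (mem_univ (2 * Real.pi))
    have e2 := hl (0, R)
    have e3 := translate_nat hA p (0, κ)
    have e4 := hB (p * (2 * Real.pi), κ)
    rw [hG, one_mul] at e3
    simp only [Prod.smul_mk, Prod.mk_add_mk, zero_add, nsmul_eq_mul, mul_zero, add_zero]
      at e2 e3 e4
    simp only [Function.comp, mul_zero, add_zero, e2, hl1, e4, e3] at e1
    rw [one_mul, inv_mul_cancel, eq_comm, inv_mul_eq_one] at e1
    exact right_eq_mul.1 e1
  have hψ2 := (hM.pb (g := fun b : ℝ => ((0, b) : ℝ × ℝ)) (B := univ) (by fun_prop)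
      (fun _ _ => mem_univ _)).unique' (ψ := ψ) (fun x hx => by
        obtain ⟨U, hU, H⟩ := hψ x hx
        refine ⟨U, hU, fun y hy z hz => ?_⟩
        rw [← H y hy z hz]
        simp [pb]) isPreconnected_univ (mem_univ b) (mem_univ (b + 2 * Real.pi))
  have e5 := hB (0, b)
  simp only [Prod.mk_add_mk, add_zero, hB1, one_mul] at e5
  simp only [Function.comp, e5, inv_mul_cancel] at hψ2
  exact (inv_mul_eq_one.1 hψ2.symm).symm

end Kill

section Glue

set_option linter.unusedSectionVars false

variable {T Ω J G : Type*} [TopologicalSpace T] [TopologicalSpace Ω] [Group G]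

open Classical in
/-- The gauge change on the inner tori. -/
def glueT (f : J → T × ℂ → Ω) (η : J → T × ℂ → G) (y : Ω) : G :=
  if h : ∃ q : J × T × ℂ, ‖q.2.2‖ < 15 / 16 ∧ f q.1 q.2 = y then
    (η h.choose.1 h.choose.2)⁻¹ else 1

open Classical in
/-- Replace `Ψ` by `Θ j` on the `j`-th inner torus, using the gauges `η j` on the collars. -/
def glue (f : J → T × ℂ → Ω) (Ψ : Ω → Ω → G) (η : J → T × ℂ → G) (Θ : J → T × ℂ → T × ℂ → G)
    (y y' : Ω) : G :=
  if h : ∃ q : J × (T × ℂ) × (T × ℂ), (‖q.2.1.2‖ < 15 / 16 ∧ ‖q.2.2.2‖ < 15 / 16) ∧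
      f q.1 q.2.1 = y ∧ f q.1 q.2.2 = y' then
    Θ h.choose.1 h.choose.2.1 h.choose.2.2
  else (glueT f η y)⁻¹ * Ψ y y' * glueT f η y'

variable {f : J → T × ℂ → Ω} {Ψ : Ω → Ω → G} {η : J → T × ℂ → G} {Θ : J → T × ℂ → T × ℂ → G}

theorem glueT_in (inj : ∀ j j' y y', ‖y.2‖ ≤ 1 → ‖y'.2‖ ≤ 1 → f j y = f j' y' → j = j' ∧ y = y')
    {j : J} {v : T × ℂ} (hv : ‖v.2‖ < 15 / 16) : glueT f η (f j v) = (η j v)⁻¹ := by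
  have h : ∃ q : J × T × ℂ, ‖q.2.2‖ < 15 / 16 ∧ f q.1 q.2 = f j v := ⟨(j, v), hv, rfl⟩
  rw [glueT, dif_pos h]
  obtain ⟨h1, h2⟩ := inj _ _ _ _ (h.choose_spec.1.le.trans (by norm_num))
    (hv.le.trans (by norm_num)) h.choose_spec.2
  rw [h2, h1]

theorem glueT_out {y : Ω} (hy : ∀ j v, ‖v.2‖ < 15 / 16 → f j v ≠ y) : glueT f η y = 1 :=
  dif_neg fun ⟨q, h1, h2⟩ => hy q.1 q.2 h1 h2

theorem glue_in (inj : ∀ j j' y y', ‖y.2‖ ≤ 1 → ‖y'.2‖ ≤ 1 → f j y = f j' y' → j = j' ∧ y = y')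
    {j : J} {v v' : T × ℂ} (hv : ‖v.2‖ < 15 / 16) (hv' : ‖v'.2‖ < 15 / 16) :
    glue f Ψ η Θ (f j v) (f j v') = Θ j v v' := by
  have h : ∃ q : J × (T × ℂ) × (T × ℂ), (‖q.2.1.2‖ < 15 / 16 ∧ ‖q.2.2.2‖ < 15 / 16) ∧
      f q.1 q.2.1 = f j v ∧ f q.1 q.2.2 = f j v' := ⟨(j, v, v'), ⟨hv, hv'⟩, rfl, rfl⟩
  rw [glue, dif_pos h]
  obtain ⟨h1, h2⟩ := inj _ _ _ _ (h.choose_spec.1.1.le.trans (by norm_num))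
    (hv.le.trans (by norm_num)) h.choose_spec.2.1
  obtain ⟨-, h3⟩ := inj _ _ _ _ (h.choose_spec.1.2.le.trans (by norm_num))
    (hv'.le.trans (by norm_num)) h.choose_spec.2.2
  rw [h2, h3, h1]

theorem glue_of_not {y y' : Ω}
    (h : ∀ j v v', ‖v.2‖ < 15 / 16 → ‖v'.2‖ < 15 / 16 → f j v = y → f j v' ≠ y') :
    glue f Ψ η Θ y y' = (glueT f η y)⁻¹ * Ψ y y' * glueT f η y' :=
  dif_neg fun ⟨q, ⟨h1, h2⟩, h3, h4⟩ => h q.1 q.2.1 q.2.2 h1 h2 h3 h4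

theorem glue_out {y y' : Ω} (hy : ∀ j v, ‖v.2‖ < 15 / 16 → f j v ≠ y)
    (hy' : ∀ j v, ‖v.2‖ < 15 / 16 → f j v ≠ y') : glue f Ψ η Θ y y' = Ψ y y' := by
  rw [glue_of_not fun j v v' h1 _ h3 => absurd h3 (hy j v h1), glueT_out hy, glueT_out hy']
  simp

variable [CompactSpace T] [T2Space Ω] [Finite J]

theorem isClosed_iUnion_image (cont : ∀ j, Continuous (f j)) (c : ℝ) :
    IsClosed (⋃ j, f j '' {v | ‖v.2‖ ≤ c}) := by
  refine isClosed_iUnion_of_finite fun j => (IsCompact.image ?_ (cont j)).isClosed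
  have : {v : T × ℂ | ‖v.2‖ ≤ c} = univ ×ˢ closedBall 0 c := by ext; simp
  rw [this]
  exact isCompact_univ.prod (isCompact_closedBall _ _)

theorem gauge_glue (cont : ∀ j, Continuous (f j)) (isOpenMap : ∀ j, IsOpenMap (f j))
    (inj : ∀ j j' y y', ‖y.2‖ ≤ 1 → ‖y'.2‖ ≤ 1 → f j y = f j' y' → j = j' ∧ y = y')
    (hη : ∀ j, ∀ v ∈ collar T, ∃ U ∈ 𝓝 v, ∀ u ∈ U, ∀ u' ∈ U,
      Ψ (f j u) (f j u') = (η j u)⁻¹ * Θ j u u' * η j u') :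
    Gauge (glue f Ψ η Θ) Ψ {x | ∀ j v, ‖v.2‖ ≤ 7 / 8 → f j v ≠ x} := by
  refine ⟨glueT f η, fun x hx => ?_⟩
  by_cases h : x ∈ ⋃ j, f j '' {v | ‖v.2‖ ≤ 15 / 16}
  · obtain ⟨_, ⟨j, rfl⟩, v, hv, rfl⟩ := h
    have hvc : v ∈ collar T := ⟨not_le.1 fun h => hx j v h rfl,
      lt_of_le_of_lt hv (by norm_num)⟩
    obtain ⟨U, hU, H⟩ := hη j v hvc
    have hc : {v : T × ℂ | ‖v.2‖ < 1} ∈ 𝓝 v :=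
      (isOpen_lt (by fun_prop) (by fun_prop)).mem_nhds hvc.2
    refine ⟨f j '' (U ∩ {v : T × ℂ | ‖v.2‖ < 1}), (isOpenMap j).image_mem_nhds
      (Filter.inter_mem hU hc), ?_⟩
    rintro _ ⟨u, ⟨hu, hu1⟩, rfl⟩ _ ⟨u', ⟨hu', hu1'⟩, rfl⟩
    by_cases hin : ‖u.2‖ < 15 / 16 ∧ ‖u'.2‖ < 15 / 16
    · rw [glue_in inj hin.1 hin.2, glueT_in inj hin.1, glueT_in inj hin.2, H u hu u' hu']
      group
    · refine glue_of_not fun j' w w' hw hw' h1 h2 => hin ?_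
      obtain ⟨-, h3⟩ := inj _ _ _ _ (hw.le.trans (by norm_num)) (le_of_lt hu1) h1
      obtain ⟨-, h4⟩ := inj _ _ _ _ (hw'.le.trans (by norm_num)) (le_of_lt hu1') h2
      exact ⟨h3 ▸ hw, h4 ▸ hw'⟩
  · refine ⟨_, (isClosed_iUnion_image cont (15 / 16)).isOpen_compl.mem_nhds h,
      fun y hy y' hy' => ?_⟩
    refine glue_of_not fun j w w' hw hw' h1 h2 => hy ?_
    exact mem_iUnion.2 ⟨j, w, hw.le, h1⟩

theorem lc_of_gauge {Φ Ψ : Ω → Ω → G} {A : Set Ω} (h : Gauge Φ Ψ A) (h' : LC Ψ A) : LC Φ A := by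
  obtain ⟨η, h⟩ := h
  intro x hx
  obtain ⟨U, hU, H⟩ := h x hx
  obtain ⟨V, hV, H'⟩ := h' x hx
  refine ⟨U ∩ V, Filter.inter_mem hU hV, fun a ha b hb c hc => ?_⟩
  rw [H a ha.1 b hb.1, H b hb.1 c hc.1, H a ha.1 c hc.1, ← H' a ha.2 b hb.2 c hc.2]
  group

theorem lc_glue (cont : ∀ j, Continuous (f j)) (isOpenMap : ∀ j, IsOpenMap (f j))
    (inj : ∀ j j' y y', ‖y.2‖ ≤ 1 → ‖y'.2‖ ≤ 1 → f j y = f j' y' → j = j' ∧ y = y')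
    (hη : ∀ j, ∀ v ∈ collar T, ∃ U ∈ 𝓝 v, ∀ u ∈ U, ∀ u' ∈ U,
      Ψ (f j u) (f j u') = (η j u)⁻¹ * Θ j u u' * η j u')
    {A : Set Ω} (hΨ : LC Ψ A) {B : J → Set (T × ℂ)} (hΘ : ∀ j, LC (Θ j) (B j)) :
    LC (glue f Ψ η Θ) {x | (x ∈ A ∧ ∀ j v, ‖v.2‖ ≤ 7 / 8 → f j v ≠ x) ∨
      ∃ j v, ‖v.2‖ < 15 / 16 ∧ v ∈ B j ∧ f j v = x} := by
  rintro x (hx | ⟨j, v, hv, hvB, rfl⟩)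
  · exact lc_of_gauge ((gauge_glue cont isOpenMap inj hη).mono
      (B := A ∩ {x | ∀ j (v : T × ℂ), ‖v.2‖ ≤ 7 / 8 → f j v ≠ x}) fun x hx => hx.2)
      (hΨ.mono inter_subset_left) x hx
  · obtain ⟨U, hU, H⟩ := hΘ j v hvB
    have hc : {v : T × ℂ | ‖v.2‖ < 15 / 16} ∈ 𝓝 v :=
      (isOpen_lt (by fun_prop) (by fun_prop)).mem_nhds hv
    refine ⟨f j '' (U ∩ {v : T × ℂ | ‖v.2‖ < 15 / 16}), (isOpenMap j).image_mem_nhds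
      (Filter.inter_mem hU hc), ?_⟩
    rintro _ ⟨a, ha, rfl⟩ _ ⟨b, hb, rfl⟩ _ ⟨c, hc, rfl⟩
    rw [glue_in inj ha.2 hb.2, glue_in inj hb.2 hc.2, glue_in inj ha.2 hc.2]
    exact H a ha.1 b hb.1 c hc.1

end Glue

section KillExt

variable {T G : Type*} [TopologicalSpace T] [Group G]

/-- If the meridians have trivial holonomy, a cocycle on the collar is pulled back from the
longitude directions. -/
theorem gauge_of_meridian {Φ : T × ℂ → T × ℂ → G} (h : LC Φ (collar T))
    (hm : ∀ (τ : T) (R : ℝ) (ψ : ℝ → G), 7 / 8 < R → R < 1 →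
      Prim (pb Φ fun b : ℝ => (τ, (R * Circle.exp b : ℂ))) ψ univ →
      ∀ b, ψ (b + 2 * Real.pi) = ψ b) :
    Gauge Φ (pb Φ fun y => (y.1, (15 / 16 : ℂ))) (collar T) := by
  let H : ℝ → T × ℝ × ℝ → T × ℂ := fun t y =>
    (y.1, (((1 - t) * y.2.2 + t * (15 / 16) : ℝ) * Circle.exp ((1 - t) * y.2.1) : ℂ))
  let B : Set (T × ℝ × ℝ) := {y | 7 / 8 < y.2.2 ∧ y.2.2 < 1}
  have hBo : IsOpen B := (isOpen_lt (g := fun y : T × ℝ × ℝ => y.2.2) continuous_const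
    (by fun_prop)).inter (isOpen_lt (f := fun y : T × ℝ × ℝ => y.2.2) (by fun_prop)
    continuous_const)
  have hHc : Continuous (fun p : ℝ × T × ℝ × ℝ => H p.1 p.2) := by
    simp only [H]; fun_prop
  have hHA : ∀ t ∈ Icc (0 : ℝ) 1, ∀ y ∈ B, H t y ∈ collar T := by
    intro t ht y hy
    have e : ‖(H t y).2‖ = (1 - t) * y.2.2 + t * (15 / 16) := by
      simp only [H, norm_mul, Circle.norm_coe, mul_one, Complex.norm_real]
      rw [Real.norm_of_nonneg]
      have := hy.1
      nlinarith [ht.1, ht.2]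
    have h1 := hy.1
    have h2 := hy.2
    constructor <;> rw [e] <;> nlinarith [ht.1, ht.2]
  obtain ⟨η, hη⟩ := (gauge_of_homotopy h (fun t _ y _ => hHc.continuousAt) hHA hBo).symm
  have h1 : ∀ y, H 1 y = (y.1, (15 / 16 : ℂ)) := fun y => by
    simp [H]
  have h0 : ∀ y, H 0 y = (y.1, (y.2.2 * Circle.exp y.2.1 : ℂ)) := fun y => by
    simp [H]
  have hper : ∀ y ∈ B, ∀ b : ℝ, η (y.1, b + 2 * Real.pi, y.2.2) = η (y.1, b, y.2.2) := by
    intro y hy b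
    refine hm y.1 y.2.2 (fun b => η (y.1, b, y.2.2)) hy.1 hy.2 (fun b _ => ?_) b
    obtain ⟨U, hU, HU⟩ := hη (y.1, b, y.2.2) hy
    obtain ⟨V, hV, HV⟩ := h (H 1 y) (hHA 1 (by simp) y hy)
    refine ⟨(fun b => (y.1, b, y.2.2)) ⁻¹' U, mem_nhdsWithin_of_mem_nhds
      (ContinuousAt.preimage_mem_nhds (by fun_prop) hU), fun c hc d hd => ?_⟩
    have := HU _ hc _ hd
    simp only [pb, h0, h1] at this ⊢
    have hs := cocycle_self HV (mem_of_mem_nhds hV)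
    rw [h1] at hs
    rw [this, hs, mul_one]
  have hperk : ∀ y ∈ B, ∀ k : ℤ, η (y.1, y.2.1 + 2 * Real.pi * k, y.2.2) = η y := by
    intro y hy k
    have : Function.Periodic (fun b => η (y.1, b, y.2.2)) (2 * Real.pi) := hper y hy
    have := this.int_mul k y.2.1
    rwa [mul_comm] at this
  refine ⟨fun y => η (y.1, y.2.arg, ‖y.2‖), fun x hx => ?_⟩
  have hx0 : x.2 ≠ 0 := by
    rw [← norm_pos_iff]; linarith [hx.1]
  obtain ⟨b, hb, hbk⟩ := exists_arg_lift (F := Prod.snd) (x := x) continuousAt_snd hx0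
  obtain ⟨U, hU, HU⟩ := hη (x.1, b x, ‖x.2‖) ⟨hx.1, hx.2⟩
  have hg : ContinuousAt (fun y : T × ℂ => (y.1, b y, ‖y.2‖)) x := by fun_prop
  have hcol : collar T ∈ 𝓝 x := (isOpen_collar).mem_nhds hx
  refine ⟨_, Filter.inter_mem (Filter.inter_mem hcol hbk) (hg hU), ?_⟩
  have key : ∀ y ∈ collar T ∩ {y | ∃ k : ℤ, y.2.arg = b y + 2 * Real.pi * k},
      η (y.1, y.2.arg, ‖y.2‖) = η (y.1, b y, ‖y.2‖) ∧ H 0 (y.1, b y, ‖y.2‖) = y := by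
    rintro y ⟨hy, k, hk⟩
    have hk' : (y.2.arg : ℂ) = b y + 2 * Real.pi * k := by exact_mod_cast hk
    refine ⟨by rw [hk]; exact hperk (y.1, b y, ‖y.2‖) ⟨hy.1, hy.2⟩ k, ?_⟩
    rw [h0]
    refine Prod.ext rfl ?_
    have e := Complex.norm_mul_exp_arg_mul_I y.2
    rw [hk', add_mul, Complex.exp_add,
      show (2 * Real.pi * k * Complex.I : ℂ) = k * (2 * Real.pi * Complex.I) by ring,
      Complex.exp_int_mul_two_pi_mul_I, mul_one] at e
    simpa [Circle.coe_exp] using e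
  intro y hy y' hy'
  obtain ⟨e1, e2⟩ := key y hy.1
  obtain ⟨e3, e4⟩ := key y' hy'.1
  have := HU _ hy.2 _ hy'.2
  simp only [pb, h1, e2, e4] at this
  simp only [pb, e1, e3]
  exact this

variable {Ω : Type*} [TopologicalSpace Ω] [T2Space Ω] {I : Type*} [DecidableEq I]

/-- A cocycle with values in a group of exponent `p` can be modified inside the image of a solid
torus so that it extends over that torus, if it is defined off a cable winding `p` times. -/
theorem exists_kill_ext {p : ℕ} (hp : 1 ≤ p) (hG : ∀ g : G, g ^ p = 1) {ρ : ℝ} (hρ : 1 / 4 ≤ ρ)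
    (hρ' : ρ ≤ 3 / 4) (i : I) {E : (I → Circle) × ℂ → Ω} (cont : Continuous E)
    (isOpenMap : IsOpenMap E) (inj : InjOn E {y | ‖y.2‖ ≤ 1}) {Φ : Ω → Ω → G} {K : Set Ω}
    (h : LC Φ Kᶜ)
    (hK : ∀ y, ‖y.2‖ ≤ 1 → E y ∈ K → ∃ v, ‖v.2‖ ≤ 1 ∧ lift i (cable p ρ) v = y) :
    ∃ Φ', LC Φ' (K \ E '' {y | ‖y.2‖ ≤ 1})ᶜ ∧ ∀ y y', y ∉ E '' {y | ‖y.2‖ ≤ 1} →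
      y' ∉ E '' {y | ‖y.2‖ ≤ 1} → Φ' y y' = Φ y y' := by
  have hmaps : ∀ v : (I → Circle) × ℂ, ‖v.2‖ ≤ 1 → ‖(lift i (cable p ρ) v).2‖ < 7 / 8 :=
    ((goodStep_cable hp hρ hρ' (J := Unit)).lift i).maps ()
  have hcolK : ∀ y : (I → Circle) × ℂ, 7 / 8 ≤ ‖y.2‖ → ‖y.2‖ ≤ 1 → E y ∈ Kᶜ := fun y h1 h2 h3 => by
    obtain ⟨v, hv, rfl⟩ := hK y h2 h3
    linarith [hmaps v hv]
  have h1 : LC (pb Φ E) (collar (I → Circle)) :=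
    h.pb (fun y _ => cont.continuousAt) fun y hy => hcolK y hy.1.le hy.2.le
  have hg := gauge_of_meridian h1 fun τ R ψ hR hR' hψ b => by
    refine meridian_trivial hp hG hρ hρ' (Φ := pb (pb Φ E) fun w : Circle × ℂ =>
      (Function.update τ i w.1, w.2)) ?_ (τ i) hR hR' (ψ := ψ) ?_ b
    · refine h.pb (g := fun w : Circle × ℂ => E (Function.update τ i w.1, w.2))
        (fun y _ => Continuous.continuousAt (by fun_prop)) fun y hy hyK => ?_
      obtain ⟨v, hv, hvy⟩ := hK _ hy.1.le hyK
      refine hy.2 (pr i v) hv ?_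
      rw [← pr_lift i (cable p ρ), hvy]
      simp [pr]
    · intro x hx
      obtain ⟨U, hU, H⟩ := hψ x hx
      refine ⟨U, hU, fun y hy z hz => ?_⟩
      rw [← H y hy z hz]
      simp only [pb, Function.update_eq_self]
  obtain ⟨η, hη⟩ := hg
  have hr : LC (pb (pb Φ E) fun y : (I → Circle) × ℂ => (y.1, (15 / 16 : ℂ))) univ :=
    h1.pb (fun y _ => Continuous.continuousAt (by fun_prop)) fun y _ => by
      constructor <;> norm_num
  have hinj : ∀ j j' y y', ‖y.2‖ ≤ 1 → ‖y'.2‖ ≤ 1 →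
      (fun _ : Unit => E) j y = (fun _ : Unit => E) j' y' → j = j' ∧ y = y' :=
    fun _ _ y y' hy hy' he => ⟨rfl, inj hy hy' he⟩
  refine ⟨glue (fun _ : Unit => E) Φ (fun _ => η)
    (fun _ => pb (pb Φ E) fun y => (y.1, (15 / 16 : ℂ))), ?_, fun y y' hy hy' => ?_⟩
  · refine (lc_glue (fun _ => cont) (fun _ => isOpenMap) hinj (fun _ => hη) h
      (fun _ => hr)).mono fun x hx => ?_
    by_cases hxE : x ∈ E '' {y | ‖y.2‖ ≤ 1}
    · obtain ⟨v, hv, rfl⟩ := hxE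
      by_cases hv' : ‖v.2‖ < 15 / 16
      · exact Or.inr ⟨(), v, hv', mem_univ _, rfl⟩
      · refine Or.inl ⟨hcolK v (by linarith) hv, fun _ w hw hwv => ?_⟩
        have := inj (hw.trans (by norm_num) : ‖w.2‖ ≤ 1) hv hwv
        rw [this] at hw
        linarith
    · refine Or.inl ⟨fun h => hx ⟨h, hxE⟩, fun _ w hw hwx => hxE ⟨w, hw.trans (by norm_num), hwx⟩⟩
  · exact glue_out (fun _ v hv h => hy ⟨v, hv.le.trans (by norm_num), h⟩)
      (fun _ v hv h => hy' ⟨v, hv.le.trans (by norm_num), h⟩)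

end KillExt

section Ring

/-- The map `(θ, s) ↦ exp s • θ`. -/
def polar (q : Circle × ℝ) : ℂ := Real.exp q.2 * q.1

theorem isOpenMap_polar : IsOpenMap polar := by
  have hc : Continuous (Prod.map Circle.exp (id : ℝ → ℝ)) :=
    Circle.exp.continuous.prodMap continuous_id
  suffices H : IsOpenMap (polar ∘ Prod.map Circle.exp (id : ℝ → ℝ)) from
    IsOpenMap.of_comp hc (Circle.exp_surjective.prodMap Function.surjective_id) H
  have e : polar ∘ Prod.map Circle.exp (id : ℝ → ℝ) =
      Complex.exp ∘ Complex.equivRealProdCLM.symm ∘ Prod.swap := by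
    funext q
    simp only [polar, Function.comp, Prod.map, id, Circle.coe_exp, Complex.ofReal_exp,
      ← Complex.exp_add, Prod.swap, Complex.equivRealProdCLM_symm_apply]
  rw [e]
  exact Complex.isOpenMap_exp.comp (Complex.equivRealProdCLM.symm.toHomeomorph.isOpenMap.comp
    (Homeomorph.prodComm _ _).isOpenMap)

theorem polar_injective : Function.Injective polar := by
  rintro ⟨θ, s⟩ ⟨θ', s'⟩ h
  have h1 := congrArg norm h
  simp only [polar, norm_mul, Circle.norm_coe, mul_one, Complex.norm_real,
    Real.norm_of_nonneg (Real.exp_pos _).le] at h1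
  have h2 := Real.exp_injective h1
  subst h2
  have h3 : (Real.exp s : ℂ) ≠ 0 := by exact_mod_cast (Real.exp_pos s).ne'
  exact Prod.ext (Circle.ext (mul_left_cancel₀ h3 h)) rfl

/-- Interchange real and imaginary part if `e` is true. -/
def swp (e : Bool) (w : ℂ) : ℂ := if e then w.im + w.re * Complex.I else w

@[simp] theorem swp_true (w : ℂ) : swp true w = w.im + w.re * Complex.I := rfl
@[simp] theorem swp_false (w : ℂ) : swp false w = w := rfl

@[fun_prop]
theorem continuous_swp (e : Bool) : Continuous (swp e) := by
  cases e
  · exact continuous_id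
  · show Continuous fun w : ℂ => (w.im + w.re * Complex.I : ℂ)
    fun_prop

theorem swp_swp (e : Bool) (w : ℂ) : swp e (swp e w) = w := by
  cases e <;> simp

theorem swp_re_mul (e : Bool) (B : ℝ) (w : ℂ) : (swp e (B * w)).re = B * (swp e w).re := by
  cases e <;> simp

theorem swp_im_mul (e : Bool) (B : ℝ) (w : ℂ) : (swp e (B * w)).im = B * (swp e w).im := by
  cases e <;> simp

theorem swp_not_re (e : Bool) (w : ℂ) : (swp (!e) w).re = (swp e w).im := by
  cases e <;> simp

theorem norm_swp (e : Bool) (w : ℂ) : ‖swp e w‖ = ‖w‖ := by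
  cases e
  · rfl
  · rw [Complex.norm_eq_sqrt_sq_add_sq, Complex.norm_eq_sqrt_sq_add_sq]
    simp [add_comm]

theorem swp_sub (e : Bool) (w w' : ℂ) : swp e w - swp e w' = swp e (w - w') := by
  cases e <;> simp [Complex.ext_iff]

/-- The point of the plane of the core of a ring. -/
def ringU (y : Circle × ℂ) : ℂ := polar (y.1, y.2.re / 10)

/-- The coordinate transverse to the plane of the core of a ring. -/
def ringV (y : Circle × ℂ) : ℝ := y.2.im / 10

/-- The angular centre of a ring. -/
def ringC (m : ℕ) (q : Bool × Fin m) : ℝ := Real.pi * (2 * (q.2 : ℕ) + if q.1 then 1 else 0)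

/-- The rings of an Antoine necklace with `2 m` links. -/
def ring (m : ℕ) (B : ℝ) (q : Bool × Fin m) (y : Circle × ℂ) : Circle × ℂ :=
  (Circle.exp ((ringC m q + 2 * (ringU y).re) / m),
    B * swp q.1 ((ringU y).im + ringV y * Complex.I))

theorem continuous_polar : Continuous polar := by unfold polar; fun_prop

@[fun_prop]
theorem continuous_ringU : Continuous ringU := by
  unfold ringU; exact continuous_polar.comp (by fun_prop)

@[fun_prop]
theorem continuous_ringV : Continuous ringV := by unfold ringV; fun_prop

theorem continuous_ring (m : ℕ) (B : ℝ) (q : Bool × Fin m) : Continuous (ring m B q) := by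
  unfold ring; fun_prop

theorem isOpenMap_ring {m : ℕ} {B : ℝ} (hB : 0 < B) (q : Bool × Fin m) :
    IsOpenMap (ring m B q) := by
  have hm : (m : ℝ) ≠ 0 := by
    have := q.2.pos; positivity
  let e1 : Circle × ℂ ≃ₜ (Circle × ℝ) × ℝ :=
    { toFun := fun y => ((y.1, y.2.re / 10), y.2.im / 10)
      invFun := fun y => (y.1.1, ((10 * y.1.2 : ℝ) + (10 * y.2 : ℝ) * Complex.I : ℂ))
      left_inv := fun y => by
        refine Prod.ext rfl (Complex.ext ?_ ?_) <;> simp <;> ring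
      right_inv := fun y => by
        refine Prod.ext (Prod.ext rfl ?_) ?_ <;> simp
      continuous_toFun := by fun_prop
      continuous_invFun := by fun_prop }
  let e2 : ℂ × ℝ ≃ₜ ℝ × ℂ :=
    { toFun := fun y => ((ringC m q + 2 * y.1.re) / m, B * swp q.1 (y.1.im + y.2 * Complex.I))
      invFun := fun y => ((((m * y.1 - ringC m q) / 2 : ℝ) +
          (swp q.1 ((B⁻¹ : ℝ) * y.2)).re * Complex.I : ℂ), (swp q.1 ((B⁻¹ : ℝ) * y.2)).im)
      left_inv := fun y => by
        have hB' : (B : ℂ) ≠ 0 := by exact_mod_cast hB.ne'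
        have : ((B⁻¹ : ℝ) : ℂ) * (B * swp q.1 (y.1.im + y.2 * Complex.I)) =
            swp q.1 (y.1.im + y.2 * Complex.I) := by
          push_cast; field_simp
        simp only [this, swp_swp]
        refine Prod.ext (Complex.ext ?_ ?_) ?_
        · simp; field_simp; ring
        · simp
        · simp
      right_inv := fun y => by
        have hB' : (B : ℂ) ≠ 0 := by exact_mod_cast hB.ne'
        refine Prod.ext ?_ ?_
        · simp; field_simp; ring
        · have : (((((m * y.1 - ringC m q) / 2 : ℝ) +
            (swp q.1 ((B⁻¹ : ℝ) * y.2)).re * Complex.I : ℂ).im : ℝ) +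
            ((swp q.1 ((B⁻¹ : ℝ) * y.2)).im : ℝ) * Complex.I : ℂ) = swp q.1 ((B⁻¹ : ℝ) * y.2) := by
            refine Complex.ext ?_ ?_ <;> simp
          simp only [this, swp_swp]
          push_cast; field_simp
      continuous_toFun := by fun_prop
      continuous_invFun := by fun_prop }
  have e : ring m B q = Prod.map Circle.exp id ∘ e2 ∘ Prod.map polar id ∘ e1 := rfl
  rw [e]
  exact (isLocalHomeomorph_circleExp.isOpenMap.prodMap IsOpenMap.id).comp
    (e2.isOpenMap.comp ((isOpenMap_polar.prodMap IsOpenMap.id).comp e1.isOpenMap))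

theorem exp_bounds {x : ℝ} (h : |x| ≤ 1) : 9 / 10 < Real.exp (x / 10) ∧ Real.exp (x / 10) < 1.12 := by
  obtain ⟨h1, h2⟩ := abs_le.1 h
  constructor
  · have := Real.add_one_lt_exp (x := -1 / 10) (by norm_num)
    have : Real.exp (-1 / 10) ≤ Real.exp (x / 10) := Real.exp_le_exp.2 (by linarith)
    linarith
  · have h3 : Real.exp (x / 10) ≤ Real.exp (1 / 10) := Real.exp_le_exp.2 (by linarith)
    have h4 := Real.add_one_lt_exp (x := -1 / 10) (by norm_num)
    have h5 : Real.exp (1 / 10) * Real.exp (-1 / 10) = 1 := by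
      rw [← Real.exp_add]; norm_num
    have := Real.exp_pos (1 / 10)
    nlinarith

theorem norm_ringU (y : Circle × ℂ) : ‖ringU y‖ = Real.exp (y.2.re / 10) := by
  rw [ringU, polar, norm_mul, Circle.norm_coe, mul_one, Complex.norm_real,
    Real.norm_of_nonneg (Real.exp_pos _).le]

theorem ringU_sq (y : Circle × ℂ) :
    (ringU y).re ^ 2 + (ringU y).im ^ 2 = Real.exp (y.2.re / 10) ^ 2 := by
  rw [← norm_ringU, ← Complex.normSq_eq_norm_sq, Complex.normSq_apply]; ring

theorem abs_ringV_le {y : Circle × ℂ} (hy : ‖y.2‖ ≤ 1) : |ringV y| ≤ 1 / 10 := by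
  have := Complex.abs_im_le_norm y.2
  rw [ringV, abs_div]; norm_num; linarith

theorem norm_ringU_bounds {y : Circle × ℂ} (hy : ‖y.2‖ ≤ 1) :
    9 / 10 < ‖ringU y‖ ∧ ‖ringU y‖ < 1.12 := by
  rw [norm_ringU]; exact exp_bounds ((Complex.abs_re_le_norm y.2).trans hy)

theorem abs_ringU_re_lt {y : Circle × ℂ} (hy : ‖y.2‖ ≤ 1) : |(ringU y).re| < 1.12 :=
  (Complex.abs_re_le_norm _).trans_lt (norm_ringU_bounds hy).2

/-- The folded angular distance to the centres of the rings of one parity. -/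
def ringT (m : ℕ) (e : Bool) (θ : Circle) : ℝ :=
  Real.arccos ((if e then -1 else 1) * ((θ : ℂ) ^ m).re)

theorem ringT_not (m : ℕ) (e : Bool) (θ : Circle) : ringT m (!e) θ = Real.pi - ringT m e θ := by
  cases e <;> simp [ringT, Real.arccos_neg]

theorem ringT_exp {m : ℕ} (e : Bool) {x X : ℝ} {k : ℤ} (hX : |X| ≤ Real.pi / 2)
    (h : m * x = Real.pi * (2 * k + if e then 1 else 0) + 2 * X) :
    ringT m e (Circle.exp x) = 2 * |X| := by
  have h1 : ((Circle.exp x : ℂ) ^ m).re = Real.cos (m * x) := by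
    rw [← Circle.coe_pow, ← Circle.exp_nsmul, Circle.coe_exp, nsmul_eq_mul,
      Complex.exp_ofReal_mul_I_re]
  have h2 : (if e then -1 else 1) * Real.cos (m * x) = Real.cos (2 * |X|) := by
    have : (2 : ℝ) * |X| = |2 * X| := by rw [abs_mul]; norm_num
    rw [this, Real.cos_abs, h]
    cases e
    · rw [show Real.pi * (2 * (k : ℝ) + if (false = true) then 1 else 0) + 2 * X =
        2 * X + k * (2 * Real.pi) by simp; ring, Real.cos_add_int_mul_two_pi]
      simp
    · rw [show Real.pi * (2 * (k : ℝ) + if (true = true) then 1 else 0) + 2 * X =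
        2 * X + Real.pi + k * (2 * Real.pi) by simp; ring, Real.cos_add_int_mul_two_pi,
        Real.cos_add_pi]
      simp
  rw [ringT, h1, h2, Real.arccos_cos (by positivity) (by linarith)]

theorem ring_fst {m : ℕ} {B : ℝ} {q : Bool × Fin m} {y : Circle × ℂ}  (hy : ‖y.2‖ ≤ 1) :
    ringT m q.1 (ring m B q y).1 = 2 * |(ringU y).re| := by
  have hm : (m : ℝ) ≠ 0 := by
    have := q.2.pos; positivity
  refine ringT_exp (k := (q.2 : ℕ)) q.1 ((abs_ringU_re_lt hy).le.trans
    (by linarith [Real.pi_gt_d2])) ?_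
  rw [mul_div_cancel₀ _ hm, ringC]
  simp

/-- The distance function of the cores of one parity inside their planes. -/
def ringP (m : ℕ) (B : ℝ) (e : Bool) (y : Circle × ℂ) : ℝ :=
  (ringT m e y.1 / 2) ^ 2 + ((swp e y.2).re / B) ^ 2

theorem ring_snd (m : ℕ) (B : ℝ) (q : Bool × Fin m) (y : Circle × ℂ) :
    swp q.1 (ring m B q y).2 = B * ((ringU y).im + ringV y * Complex.I) := by
  have h1 := swp_re_mul q.1 B (swp q.1 ((ringU y).im + ringV y * Complex.I))
  have h2 := swp_im_mul q.1 B (swp q.1 ((ringU y).im + ringV y * Complex.I))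
  rw [swp_swp] at h1 h2
  exact Complex.ext (by rw [ring, h1]; simp) (by rw [ring, h2]; simp)

theorem ringP_ring {m : ℕ} {B : ℝ} (hB : 0 < B) {q : Bool × Fin m} {y : Circle × ℂ}
    (hy : ‖y.2‖ ≤ 1) : ringP m B q.1 (ring m B q y) = Real.exp (y.2.re / 10) ^ 2 := by
  rw [ringP, ring_fst hy, ring_snd, ← ringU_sq]
  simp [mul_div_cancel_left₀ _ hB.ne']

theorem ringP_not_ring {m : ℕ} {B : ℝ} (hB : 0 < B) {q : Bool × Fin m} {y : Circle × ℂ}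
    (hy : ‖y.2‖ ≤ 1) : ringP m B (!q.1) (ring m B q y) =
      ((Real.pi - 2 * |(ringU y).re|) / 2) ^ 2 + ringV y ^ 2 := by
  rw [ringP, ringT_not, ring_fst hy, swp_not_re, ring_snd]
  simp [mul_div_cancel_left₀ _ hB.ne']

theorem continuous_ringP (m : ℕ) (B : ℝ) (e : Bool) : Continuous (ringP m B e) := by
  unfold ringP ringT
  have : Continuous fun y : Circle × ℂ =>
      Real.arccos ((if e then -1 else 1) * ((y.1 : ℂ) ^ m).re) :=
    Real.continuous_arccos.comp (by fun_prop)
  fun_prop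

theorem ringP_not_lt_one {m : ℕ} {B : ℝ} (hB : 0 < B) {q : Bool × Fin m} {y : Circle × ℂ}
    (hy : ‖y.2‖ ≤ 1) (h0 : (ringU y).im = 0) : ringP m B (!q.1) (ring m B q y) < 1 := by
  rw [ringP_not_ring hB hy]
  have h1 := (norm_ringU_bounds hy).1
  have h2 := ringU_sq y
  rw [h0, ← norm_ringU, ← sq_abs (ringU y).re] at h2
  have h3 : |(ringU y).re| = ‖ringU y‖ := by
    refine (pow_left_inj₀ (abs_nonneg _) (norm_nonneg _) two_ne_zero).1 ?_
    linarith
  have h4 := (norm_ringU_bounds hy).2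
  have h5 := sq_le_sq' (abs_le.1 (abs_ringV_le hy)).1 (abs_le.1 (abs_ringV_le hy)).2
  rw [h3]
  nlinarith [Real.pi_gt_d2, Real.pi_lt_d2]

theorem ring_inj {m : ℕ} {B : ℝ} (hB : 0 < B) {q q' : Bool × Fin m} {y y' : Circle × ℂ}
    (hy : ‖y.2‖ ≤ 1) (hy' : ‖y'.2‖ ≤ 1) (h : ring m B q y = ring m B q' y') : q = q' ∧ y = y' := by
  have hm : (m : ℝ) ≠ 0 := by
    have := q.2.pos; positivity
  have hB' : (B : ℂ) ≠ 0 := by exact_mod_cast hB.ne'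
  have hu := ringU_sq y
  have hu' := ringU_sq y'
  have hb := (norm_ringU_bounds hy).1
  have hb' := (norm_ringU_bounds hy').1
  rw [norm_ringU] at hb hb'
  have hv := abs_le.1 (abs_ringV_le hy)
  have hv' := abs_le.1 (abs_ringV_le hy')
  have hs := ring_snd m B q y
  by_cases hq : q.1 = q'.1
  · have hs' := ring_snd m B q' y'
    rw [h, hq, hs'] at hs
    have hs2 := mul_left_cancel₀ hB' hs
    have i1 : (ringU y').im = (ringU y).im := by simpa using congrArg Complex.re hs2
    have i2 : ringV y' = ringV y := by simpa using congrArg Complex.im hs2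
    have h1 := congrArg Prod.fst h
    obtain ⟨n, hn⟩ := Circle.exp_eq_exp.1 h1
    have hn' : ringC m q + 2 * (ringU y).re = ringC m q' + 2 * (ringU y').re +
        n * (2 * Real.pi) * m := by
      field_simp at hn; linarith
    have hr := abs_lt.1 (abs_ringU_re_lt hy)
    have hr' := abs_lt.1 (abs_ringU_re_lt hy')
    have hk : ((q.2 : ℕ) : ℤ) - (q'.2 : ℕ) - n * m = 0 := by
      have e : (ringU y').re - (ringU y).re =
          Real.pi * (((q.2 : ℕ) : ℤ) - (q'.2 : ℕ) - n * m : ℤ) := by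
        simp only [ringC, hq] at hn'
        push_cast; linarith
      rw [← Int.abs_lt_one_iff, abs_lt]
      have hp := Real.pi_gt_d2
      constructor <;> by_contra! hc
      · have : ((((q.2 : ℕ) : ℤ) - (q'.2 : ℕ) - n * m : ℤ) : ℝ) ≤ -1 := by exact_mod_cast hc
        nlinarith
      · have : 1 ≤ ((((q.2 : ℕ) : ℤ) - (q'.2 : ℕ) - n * m : ℤ) : ℝ) := by exact_mod_cast hc
        nlinarith
    have hq2 : (q.2 : ℕ) = q'.2 := by
      have : ((q.2 : ℕ) : ℤ) % m = ((q'.2 : ℕ) : ℤ) % m := by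
        rw [show ((q.2 : ℕ) : ℤ) = (q'.2 : ℕ) + n * m by linarith]
        simp
      rw [Int.emod_eq_of_lt (by positivity) (by exact_mod_cast q.2.2),
        Int.emod_eq_of_lt (by positivity) (by exact_mod_cast q'.2.2)] at this
      exact_mod_cast this
    have hqq : q = q' := Prod.ext hq (Fin.ext hq2)
    subst hqq
    have hn0 : (n : ℝ) * m = 0 := by
      have : n * (m : ℤ) = 0 := by linarith
      exact_mod_cast this
    have i3 : (ringU y').re = (ringU y).re := by
      have : (n : ℝ) * (2 * Real.pi) * m = 2 * Real.pi * (n * m) := by ring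
      rw [this, hn0] at hn'
      linarith
    have hU : ringU y = ringU y' := Complex.ext i3.symm i1.symm
    have hP : (y.1, y.2.re / 10) = (y'.1, y'.2.re / 10) := polar_injective hU
    refine ⟨rfl, Prod.ext (Prod.ext_iff.1 hP).1 (Complex.ext ?_ ?_)⟩
    · have := (Prod.ext_iff.1 hP).2
      simp only at this
      linarith
    · simp only [ringV] at i2
      linarith
  · exfalso
    have hq' : q'.1 = !q.1 := by
      cases h1 : q.1 <;> cases h2 : q'.1 <;> simp_all
    have a1 := ring_fst (B := B) (q := q) hy
    have a2 := ring_fst (B := B) (q := q') hy'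
    rw [← h, hq', ringT_not, a1] at a2
    have b2 := congrArg Complex.re (ring_snd m B q' y')
    rw [← h, hq', swp_not_re, hs] at b2
    have b3 := congrArg Complex.im (ring_snd m B q' y')
    rw [← h, hq', ← swp_not_re, Bool.not_not, hs] at b3
    simp [hB.ne'] at b2 b3
    rw [b3] at hu
    rw [← b2] at hu'
    have c1 : 17 / 20 < |(ringU y).re| := by
      refine lt_of_pow_lt_pow_left₀ 2 (abs_nonneg _) ?_
      rw [sq_abs]
      nlinarith
    have c2 : 17 / 20 < |(ringU y').re| := by
      refine lt_of_pow_lt_pow_left₀ 2 (abs_nonneg _) ?_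
      rw [sq_abs]
      nlinarith
    linarith [Real.pi_lt_d2]

theorem goodStep_ring {m : ℕ} {B : ℝ} (hB : 0 < B) (hB' : B ≤ 1 / 4) : GoodStep (ring m B) where
  cont := continuous_ring m B
  isOpenMap := isOpenMap_ring hB
  inj _ _ _ _ hy hy' h := ring_inj hB hy hy' h
  maps q y hy := by
    rw [ring, norm_mul, norm_swp, Complex.norm_real, Real.norm_of_nonneg hB.le]
    have h1 : ‖((ringU y).im + ringV y * Complex.I : ℂ)‖ ≤ 1.12 + 1 / 10 := by
      refine (norm_add_le _ _).trans (add_le_add ?_ ?_)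
      · rw [Complex.norm_real]
        exact (Complex.abs_im_le_norm _).trans (norm_ringU_bounds hy).2.le
      · simpa using abs_ringV_le hy
    nlinarith

/-- The cores of the rings of one parity are cut out by two equations. -/
theorem exists_ring_core {m : ℕ} (hm : 0 < m) {B : ℝ} (hB : 0 < B) (e : Bool) {y : Circle × ℂ}
    (h1 : ringP m B e y = 1) (h2 : (swp e y.2).im = 0) :
    ∃ k v, v.2 = 0 ∧ ring m B (e, k) v = y := by
  obtain ⟨x, hx⟩ := Circle.exp_surjective y.1
  have hm' : (m : ℝ) ≠ 0 := by positivity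
  have hp := Real.pi_pos
  let n : ℤ := round ((m * x - if e then Real.pi else 0) / (2 * Real.pi))
  let X : ℝ := (m * x - (if e then Real.pi else 0) - 2 * Real.pi * n) / 2
  have hX : |X| ≤ Real.pi / 2 := by
    have := abs_sub_round ((m * x - if e then Real.pi else 0) / (2 * Real.pi))
    have e1 : X = Real.pi * ((m * x - if e then Real.pi else 0) / (2 * Real.pi) - n) := by
      simp only [X]; field_simp
    rw [e1, abs_mul, abs_of_pos hp]
    nlinarith
  have hx' : m * x = Real.pi * (2 * n + if e then 1 else 0) + 2 * X := by
    simp only [X]; cases e <;> simp <;> ring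
  have hT := ringT_exp e hX hx'
  have hs : X ^ 2 + ((swp e y.2).re / B) ^ 2 = 1 := by
    rw [ringP, ← hx, hT, mul_div_cancel_left₀ _ two_ne_zero, sq_abs] at h1
    exact h1
  let u : Circle := ⟨⟨X, (swp e y.2).re / B⟩, by
    show _ ∈ sphere (0 : ℂ) 1
    rw [mem_sphere_zero_iff_norm, ← sq_eq_sq₀ (norm_nonneg _) zero_le_one,
      ← Complex.normSq_eq_norm_sq, Complex.normSq_apply, ← sq, ← sq, one_pow]
    exact hs⟩
  have hU : ringU (u, 0) = ⟨X, (swp e y.2).re / B⟩ := by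
    simp [ringU, polar, u]
  have hmz : (0 : ℤ) < m := by exact_mod_cast hm
  have hn := Int.emod_add_mul_ediv n m
  refine ⟨⟨(n % m).toNat, ?_⟩, (u, 0), rfl, ?_⟩
  · have := Int.emod_lt_of_pos n hmz
    have := Int.emod_nonneg n hmz.ne'
    omega
  · have hc : (((n % m).toNat : ℕ) : ℝ) = n - m * (n / m : ℤ) := by
      have h3 : (((n % m).toNat : ℕ) : ℤ) = n - m * (n / m) := by
        rw [Int.toNat_of_nonneg (Int.emod_nonneg n hmz.ne')]; linarith
      exact_mod_cast congrArg (Int.cast : ℤ → ℝ) h3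
    rw [ring, hU]
    refine Prod.ext ?_ ?_
    · simp only [ringC, hc]
      rw [← hx, Circle.exp_eq_exp]
      refine ⟨-(n / m), ?_⟩
      field_simp
      push_cast
      linear_combination -hx'
    · have hB' : (B : ℂ) ≠ 0 := by exact_mod_cast hB.ne'
      have : ((((swp e y.2).re / B : ℝ) : ℂ) + ringV (u, 0) * Complex.I) = (B⁻¹ : ℝ) * swp e y.2 := by
        refine Complex.ext ?_ ?_
        · simp [ringV]; ring
        · simp [ringV, h2]
      simp only [this]
      refine Complex.ext ?_ ?_
      · have := swp_re_mul e B⁻¹ (swp e y.2)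
        rw [swp_swp] at this
        simp only [Complex.re_ofReal_mul, this]
        field_simp
      · have := swp_im_mul e B⁻¹ (swp e y.2)
        rw [swp_swp] at this
        simp only [Complex.im_ofReal_mul, this]
        field_simp

theorem dist_circle_exp_le (x y : ℝ) : dist (Circle.exp x) (Circle.exp y) ≤ |x - y| := by
  have h : dist (Circle.exp x) (Circle.exp y) = ‖(Circle.exp x : ℂ) - Circle.exp y‖ :=
    dist_eq_norm (Circle.exp x : ℂ) _
  rw [h, Circle.coe_exp, Circle.coe_exp]
  have : Complex.exp (x * Complex.I) - Complex.exp (y * Complex.I) =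
      Complex.exp (y * Complex.I) * (Complex.exp (Complex.I * (x - y : ℝ)) - 1) := by
    rw [mul_sub, ← Complex.exp_add, mul_one]; push_cast; ring_nf
  rw [this, norm_mul, Complex.norm_exp_ofReal_mul_I, one_mul]
  simpa using Real.norm_exp_I_mul_ofReal_sub_one_le (x := x - y)

theorem ring_lipschitz {m : ℕ} {B : ℝ} (hB : 0 < B) {q : Bool × Fin m} {y y' : Circle × ℂ}
    (hy : ‖y.2‖ ≤ 1) (hy' : ‖y'.2‖ ≤ 1) :
    dist (ring m B q y) (ring m B q y') ≤ (4 / m + 3 * B) * dist y y' := by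
  have hm : 0 < (m : ℝ) := by
    have := q.2.pos; positivity
  set D := dist y y' with hD
  have hD0 : 0 ≤ D := dist_nonneg
  have d1 : ‖(y.1 : ℂ) - y'.1‖ ≤ D := by
    rw [← dist_eq_norm]; exact le_max_left _ _
  have d2 : ‖y.2 - y'.2‖ ≤ D := by rw [← dist_eq_norm]; exact le_max_right _ _
  have hU : ‖ringU y - ringU y'‖ ≤ 2 * D := by
    have e1 : ringU y - ringU y' = Real.exp (y.2.re / 10) * ((y.1 : ℂ) - y'.1) +
        (Real.exp (y'.2.re / 10) * (Real.exp ((y.2.re - y'.2.re) / 10) - 1) : ℝ) * y'.1 := by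
      have : Real.exp (y.2.re / 10) =
          Real.exp (y'.2.re / 10) * Real.exp ((y.2.re - y'.2.re) / 10) := by
        rw [← Real.exp_add]; congr 1; ring
      simp only [ringU, polar]
      rw [this]; push_cast; ring
    have e2 : |y.2.re - y'.2.re| ≤ D := by
      rw [← Complex.sub_re]; exact (Complex.abs_re_le_norm _).trans d2
    have e3 : |(y.2.re - y'.2.re) / 10| ≤ 1 := by
      have a1 := abs_le.1 ((Complex.abs_re_le_norm y.2).trans hy)
      have a2 := abs_le.1 ((Complex.abs_re_le_norm y'.2).trans hy')
      rw [abs_le]; constructor <;> linarith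
    have e4 := Real.abs_exp_sub_one_le e3
    rw [abs_div, abs_of_pos (by norm_num : (0 : ℝ) < 10)] at e4
    have b1 := exp_bounds ((Complex.abs_re_le_norm y.2).trans hy)
    have b2 := exp_bounds ((Complex.abs_re_le_norm y'.2).trans hy')
    rw [e1]
    refine (norm_add_le _ _).trans ?_
    rw [norm_mul, norm_mul, Circle.norm_coe, mul_one, Complex.norm_real, Complex.norm_real,
      Real.norm_of_nonneg (Real.exp_pos _).le, Real.norm_eq_abs, abs_mul,
      abs_of_pos (Real.exp_pos _)]
    have c1 : Real.exp (y.2.re / 10) * ‖(y.1 : ℂ) - y'.1‖ ≤ 1.12 * D :=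
      mul_le_mul b1.2.le d1 (norm_nonneg _) (by norm_num)
    have c2 : Real.exp (y'.2.re / 10) * |Real.exp ((y.2.re - y'.2.re) / 10) - 1| ≤
        1.12 * (2 * (D / 10)) :=
      mul_le_mul b2.2.le (e4.trans (by linarith)) (abs_nonneg _) (by norm_num)
    linarith
  refine max_le ?_ ?_
  · refine (dist_circle_exp_le _ _).trans ?_
    have : (ringC m q + 2 * (ringU y).re) / m - (ringC m q + 2 * (ringU y').re) / m =
        2 / m * (ringU y - ringU y').re := by
      rw [Complex.sub_re]; ring
    rw [this, abs_mul, abs_of_pos (by positivity)]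
    calc 2 / m * |(ringU y - ringU y').re| ≤ 2 / m * (2 * D) := by
          gcongr; exact (Complex.abs_re_le_norm _).trans hU
      _ = 4 / m * D := by ring
      _ ≤ _ := by gcongr; linarith
  · rw [dist_eq_norm]
    simp only [ring]
    rw [← mul_sub, swp_sub, norm_mul, norm_swp, Complex.norm_real, Real.norm_of_nonneg hB.le]
    have : ((ringU y).im + ringV y * Complex.I : ℂ) - ((ringU y').im + ringV y' * Complex.I) =
        ((ringU y - ringU y').im : ℝ) + (((y.2 - y'.2).im / 10 : ℝ) : ℂ) * Complex.I := by
      simp [ringV]; ring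
    have h2 : ‖((ringU y).im + ringV y * Complex.I : ℂ) -
        ((ringU y').im + ringV y' * Complex.I)‖ ≤ 3 * D := by
      rw [this]
      refine (norm_add_le _ _).trans ?_
      rw [norm_mul, Complex.norm_I, mul_one, Complex.norm_real, Complex.norm_real,
        Real.norm_eq_abs, Real.norm_eq_abs, abs_div, abs_of_pos (by norm_num : (0 : ℝ) < 10)]
      have := (Complex.abs_im_le_norm (y.2 - y'.2)).trans d2
      have := (Complex.abs_im_le_norm (ringU y - ringU y')).trans hU
      linarith
    have h4 : 0 ≤ 4 / m * D := by positivity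
    nlinarith

end Ring

section RingExt

variable {G : Type*} [Group G]

/-- Frames on the four quadrants, used where one of the two discs bounded by the cores is met. -/
def frame (a b : G) (i σ τ : Bool) : G :=
  if σ then (if τ && i then a else 1)
  else if τ then (if i then a else 1) * b
  else a * b * a⁻¹

/-- Frames when only the disc of the even core is met. -/
def frame' (a : G) (τ : Bool) : G := if τ then a else 1

/-- The transition from one quadrant to another near the walls. -/
def lab (a b : G) (i j σ τ σ' τ' : Bool) : G :=
  if j then (frame a b i σ τ)⁻¹ * frame a b i σ' τ'
  else if i then (frame' a τ)⁻¹ * frame' a τ'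
  else if σ || σ' then 1
  else if τ then (if τ' then 1 else b⁻¹ * a * b * a⁻¹)
  else if τ' then (b⁻¹ * a * b * a⁻¹)⁻¹ else 1

theorem lab_self (a b : G) (i j σ τ : Bool) : lab a b i j σ τ σ τ = 1 := by
  cases i <;> cases j <;> cases σ <;> cases τ <;> simp [lab, frame, frame', mul_assoc]

theorem lab_mul_left (a b : G) (i i' j τ σ σ' σ'' : Bool) :
    lab a b i j σ τ σ' τ * lab a b i' j σ' τ σ'' τ = lab a b i j σ τ σ'' τ := by
  cases i <;> cases i' <;> cases j <;> cases τ <;> cases σ <;> cases σ' <;> cases σ'' <;>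
    simp [lab, frame, frame', mul_assoc]

theorem lab_mul_right (a b : G) (i j j' σ τ τ' τ'' : Bool) :
    lab a b i j σ τ σ τ' * lab a b i j' σ τ' σ τ'' = lab a b i j σ τ σ τ'' := by
  cases i <;> cases j <;> cases j' <;> cases σ <;> cases τ <;> cases τ' <;> cases τ'' <;>
    simp [lab, frame, frame', mul_assoc]

theorem lab_mul (a b : G) {i j : Bool} (h : (i || j) = true) (σ τ σ' τ' σ'' τ'' : Bool) :
    lab a b i j σ τ σ' τ' * lab a b i j σ' τ' σ'' τ'' = lab a b i j σ τ σ'' τ'' := by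
  cases j
  · cases i
    · simp at h
    · simp [lab, mul_assoc]
  · simp [lab, mul_assoc]

/-- The local cocycle of a ring step. -/
def ringPsi (m : ℕ) (B : ℝ) (a b : G) (y y' : Circle × ℂ) : G :=
  lab a b (decide (ringP m B false y < 1)) (decide (ringP m B true y < 1))
    (decide (0 ≤ y.2.re)) (decide (0 ≤ y.2.im)) (decide (0 ≤ y'.2.re)) (decide (0 ≤ y'.2.im))

/-- The truth value of a strict inequality is locally constant off the equality set. -/
theorem eventually_decide_lt {X : Type*} [TopologicalSpace X] {f : X → ℝ} (hf : Continuous f)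
    {c : ℝ} {x : X} (h : f x ≠ c) : ∀ᶠ y in 𝓝 x, decide (f y < c) = decide (f x < c) := by
  rcases h.lt_or_gt with h | h
  · filter_upwards [hf.continuousAt.eventually (gt_mem_nhds h)] with y hy
    simp [hy, h]
  · filter_upwards [hf.continuousAt.eventually (lt_mem_nhds h)] with y hy
    simp [not_lt.2 hy.le, not_lt.2 h.le]

theorem eventually_decide_le {X : Type*} [TopologicalSpace X] {f : X → ℝ} (hf : Continuous f)
    {c : ℝ} {x : X} (h : f x ≠ c) : ∀ᶠ y in 𝓝 x, decide (c ≤ f y) = decide (c ≤ f x) := by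
  filter_upwards [eventually_decide_lt hf h] with y hy
  rw [← Bool.not_inj_iff]; simpa [← decide_not] using hy

theorem ringP_lt_one_of_snd {m : ℕ} {B : ℝ} {y : Circle × ℂ} (h : y.2 = 0) :
    (decide (ringP m B false y < 1) || decide (ringP m B true y < 1)) = true := by
  have h1 : ringT m true y.1 = Real.pi - ringT m false y.1 := ringT_not m false y.1
  have h0 : 0 ≤ ringT m false y.1 := Real.arccos_nonneg _
  have h2 : ringT m false y.1 ≤ Real.pi := Real.arccos_le_pi _
  simp only [ringP, h1, h, Bool.or_eq_true, decide_eq_true_eq]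
  simp only [swp_true, swp_false, Complex.zero_re, Complex.zero_im]
  by_contra! hc
  obtain ⟨c1, c2⟩ := hc
  simp only [Complex.ofReal_zero, zero_mul, add_zero, zero_div, Complex.zero_re] at c1 c2
  have d1 : 2 ≤ ringT m false y.1 := by nlinarith
  have d2 : 2 ≤ Real.pi - ringT m false y.1 := by nlinarith
  linarith [Real.pi_lt_d2]

variable {m : ℕ} {B : ℝ}

theorem lc_ringPsi (hm : 0 < m) (hB : 0 < B) (a b : G) :
    LC (ringPsi m B a b) {y | ∀ q v, v.2 = 0 → ring m B q v ≠ y} := by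
  intro y hy
  have hre : Continuous fun y : Circle × ℂ => y.2.re := by fun_prop
  have him : Continuous fun y : Circle × ℂ => y.2.im := by fun_prop
  have hc0 : y.2.im = 0 → ringP m B false y ≠ 1 := fun h h1 => by
    obtain ⟨k, v, hv, hk⟩ := exists_ring_core hm hB false h1 (by simpa using h)
    exact hy _ v hv hk
  have hc1 : y.2.re = 0 → ringP m B true y ≠ 1 := fun h h1 => by
    obtain ⟨k, v, hv, hk⟩ := exists_ring_core hm hB true h1 (by simpa using h)
    exact hy _ v hv hk
  by_cases h2 : y.2.im = 0
  · have e0 := eventually_decide_lt (continuous_ringP m B false) (hc0 h2)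
    by_cases h1 : y.2.re = 0
    · have e1 := eventually_decide_lt (continuous_ringP m B true) (hc1 h1)
      refine ⟨_, e0.and e1, fun u hu v hv w hw => ?_⟩
      obtain ⟨hu0, hu1⟩ := hu
      obtain ⟨hv0, hv1⟩ := hv
      simp only [ringPsi, hu0, hu1, hv0, hv1]
      exact lab_mul a b (ringP_lt_one_of_snd (Complex.ext h1 h2)) _ _ _ _ _ _
    · refine ⟨_, e0.and (eventually_decide_le hre h1), fun u hu v hv w hw => ?_⟩
      obtain ⟨hu0, hu1⟩ := hu
      obtain ⟨hv0, hv1⟩ := hv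
      obtain ⟨hw0, hw1⟩ := hw
      simp only [ringPsi, hu0, hu1, hv0, hv1, hw1]
      exact lab_mul_right a b _ _ _ _ _ _ _
  · have e2 := eventually_decide_le him h2
    by_cases h1 : y.2.re = 0
    · have e1 := eventually_decide_lt (continuous_ringP m B true) (hc1 h1)
      refine ⟨_, e1.and e2, fun u hu v hv w hw => ?_⟩
      obtain ⟨hu0, hu1⟩ := hu
      obtain ⟨hv0, hv1⟩ := hv
      obtain ⟨hw0, hw1⟩ := hw
      simp only [ringPsi, hu0, hu1, hv0, hv1, hw1]
      exact lab_mul_left a b _ _ _ _ _ _ _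
    · refine ⟨_, (eventually_decide_le hre h1).and e2, fun u hu v hv w hw => ?_⟩
      obtain ⟨hu0, hu1⟩ := hu
      obtain ⟨hv0, hv1⟩ := hv
      obtain ⟨hw0, hw1⟩ := hw
      simp only [ringPsi, hu0, hu1, hv0, hv1, hw0, hw1, lab_self, mul_one]

theorem one_le_ringP {e : Bool} {y : Circle × ℂ} (hB : 0 < B) (h : B < |(swp e y.2).re|) :
    1 < ringP m B e y := by
  have h1 : 1 < |(swp e y.2).re / B| := by
    rw [abs_div, abs_of_pos hB, lt_div_iff₀ hB]; simpa
  have h2 : 1 < ((swp e y.2).re / B) ^ 2 := by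
    rw [← sq_abs]; nlinarith
  have := sq_nonneg (ringT m e y.1 / 2)
  rw [ringP]
  linarith

theorem gauge_ringPsi_collar (hB : 0 < B) (hB' : B ≤ 1 / 4) (a b : G) :
    Gauge (ringPsi m B a b) (pb (ac (b⁻¹ * a * b * a⁻¹)) Prod.snd) (collar Circle) := by
  refine ⟨fun _ => 1, fun y hy => ?_⟩
  simp only [inv_one, one_mul, mul_one, pb]
  have hre : Continuous fun y : Circle × ℂ => y.2.re := by fun_prop
  have him : Continuous fun y : Circle × ℂ => y.2.im := by fun_prop
  by_cases h2 : y.2.im = 0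
  · have h3 : 7 / 8 < |y.2.re| := by
      have := Complex.norm_le_abs_re_add_abs_im y.2
      rw [h2, abs_zero] at this
      linarith [hy.1]
    have hne : y.2.re ≠ 0 := fun h => by rw [h] at h3; norm_num at h3
    have e0 : ∀ᶠ u : Circle × ℂ in 𝓝 y, B < |u.2.re| :=
      hre.abs.continuousAt.eventually (lt_mem_nhds (by linarith))
    rcases hne.lt_or_gt with hs | hs
    · refine ⟨_, e0.and (hre.continuousAt.eventually (gt_mem_nhds hs)), fun u hu v hv => ?_⟩
      have hi : decide (ringP m B false u < 1) = false := by
        simpa using (one_le_ringP (m := m) (e := false) hB (by simpa using hu.1)).le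
      rw [ac_of_re_neg _ hu.2 hv.2]
      have a1 : decide (0 ≤ u.2.re) = false := by simpa using hu.2
      have a2 : decide (0 ≤ v.2.re) = false := by simpa using hv.2
      simp only [ringPsi, hi, a1, a2]
      by_cases c1 : 0 ≤ u.2.im <;> by_cases c2 : 0 ≤ v.2.im <;>
        cases decide (ringP m B true u < 1) <;> simp [lab, frame, c1, c2, mul_assoc]
    · refine ⟨_, e0.and (hre.continuousAt.eventually (lt_mem_nhds hs)), fun u hu v hv => ?_⟩
      have hi : decide (ringP m B false u < 1) = false := by
        simpa using (one_le_ringP (m := m) (e := false) hB (by simpa using hu.1)).le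
      rw [ac_eq_one_of_re_pos _ hu.2 hv.2]
      have a1 : decide (0 ≤ u.2.re) = true := by simpa using hu.2.le
      have a2 : decide (0 ≤ v.2.re) = true := by simpa using hv.2.le
      simp only [ringPsi, hi, a1, a2]
      cases decide (ringP m B true u < 1) <;> simp [lab, frame]
  · obtain ⟨U, hU, H⟩ : ∃ U ∈ 𝓝 y, ∀ u ∈ U, ∀ v ∈ U,
        ac (b⁻¹ * a * b * a⁻¹) u.2 v.2 = 1 := by
      rcases (Ne.lt_or_gt h2) with hs | hs
      · exact ⟨_, him.continuousAt.eventually (gt_mem_nhds hs), fun u hu v hv =>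
          ac_eq_one_of_im_neg _ hu hv⟩
      · exact ⟨_, him.continuousAt.eventually (lt_mem_nhds hs), fun u hu v hv =>
          ac_eq_one_of_im_pos _ hu hv⟩
    have e2 := eventually_decide_le him h2
    by_cases h1 : y.2.re = 0
    · have h3 : 7 / 8 < |y.2.im| := by
        have := Complex.norm_le_abs_re_add_abs_im y.2
        rw [h1, abs_zero] at this
        linarith [hy.1]
      have e0 : ∀ᶠ u : Circle × ℂ in 𝓝 y, B < |u.2.im| :=
        him.abs.continuousAt.eventually (lt_mem_nhds (by linarith))
      refine ⟨_, Filter.inter_mem hU (e0.and e2), fun u hu v hv => ?_⟩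
      have hj : decide (ringP m B true u < 1) = false := by
        simpa using (one_le_ringP (m := m) (e := true) hB (by simpa using hu.2.1)).le
      rw [H u hu.1 v hv.1]
      have c1 := hu.2.2
      have c2 := hv.2.2
      simp only [ringPsi, hj, c1, c2]
      generalize decide (0 ≤ y.2.im) = t
      generalize decide (0 ≤ u.2.re) = t1
      generalize decide (0 ≤ v.2.re) = t2
      cases decide (ringP m B false u < 1) <;> cases t <;> cases t1 <;> cases t2 <;>
        simp [lab]
    · refine ⟨_, Filter.inter_mem hU (e2.and (eventually_decide_le hre h1)), fun u hu v hv => ?_⟩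
      rw [H u hu.1 v hv.1]
      obtain ⟨c1, c2⟩ := hu.2
      obtain ⟨c3, c4⟩ := hv.2
      simp only [ringPsi, c1, c2, c3, c4, lab_self]

theorem ring_im (q : Bool × Fin m) (y : Circle × ℂ) :
    (swp q.1 (ring m B q y).2).im = B * (y.2.im / 10) := by
  rw [ring_snd, Complex.im_ofReal_mul]; simp [ringV]

theorem ring_re (q : Bool × Fin m) (y : Circle × ℂ) :
    (swp q.1 (ring m B q y).2).re = B * (ringU y).im := by
  rw [ring_snd, Complex.re_ofReal_mul]; simp

theorem ringP_lt_one_iff (hB : 0 < B) {q : Bool × Fin m} {y : Circle × ℂ} (hy : ‖y.2‖ ≤ 1) :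
    ringP m B q.1 (ring m B q y) < 1 ↔ y.2.re < 0 := by
  rw [ringP_ring hB hy, sq_lt_one_iff₀ (Real.exp_pos _).le, Real.exp_lt_one_iff]
  constructor <;> intro h <;> linarith

/-- The angular cocycle seen through the half planes. -/
theorem exists_nhds_ac_eq (x : G) {y : Circle × ℂ} (hy : y.2 ≠ 0) :
    ∃ U ∈ 𝓝 y, ∀ u ∈ U, ∀ v ∈ U, ac x u.2 v.2 =
      if u.2.re < 0 then (if 0 ≤ u.2.im then (if 0 ≤ v.2.im then 1 else x) else
        (if 0 ≤ v.2.im then x⁻¹ else 1)) else 1 := by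
  have hre : Continuous fun y : Circle × ℂ => y.2.re := by fun_prop
  have him : Continuous fun y : Circle × ℂ => y.2.im := by fun_prop
  rcases lt_trichotomy y.2.re 0 with h | h | h
  · refine ⟨_, hre.continuousAt.eventually (gt_mem_nhds h), fun u hu v hv => ?_⟩
    rw [if_pos (show u.2.re < 0 from hu), ac_of_re_neg _ hu hv]
  · have h2 : y.2.im ≠ 0 := fun h2 => hy (Complex.ext h h2)
    rcases (Ne.lt_or_gt h2) with hs | hs
    · refine ⟨_, him.continuousAt.eventually (gt_mem_nhds hs), fun u hu v hv => ?_⟩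
      rw [ac_eq_one_of_im_neg _ hu hv, if_neg (not_le.2 hu), if_neg (not_le.2 hv), ite_self]
    · refine ⟨_, him.continuousAt.eventually (lt_mem_nhds hs), fun u hu v hv => ?_⟩
      rw [ac_eq_one_of_im_pos _ hu hv, if_pos (le_of_lt hu), if_pos (le_of_lt hv), ite_self]
  · refine ⟨_, hre.continuousAt.eventually (lt_mem_nhds h), fun u hu v hv => ?_⟩
    rw [ac_eq_one_of_re_pos _ hu hv, if_neg (not_lt.2 (le_of_lt hu))]

theorem ne_zero_of_mem_collar {T : Type*} {y : T × ℂ} (hy : y ∈ collar T) : y.2 ≠ 0 := fun h => by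
  have := hy.1
  rw [h, norm_zero] at this
  linarith

/-- The gauge transformation on the even rings. -/
def gaugeEven (a b : G) (σ τ : Bool) : G :=
  if σ then 1 else if τ then b⁻¹ else (b⁻¹ * a * b * a⁻¹)⁻¹ * b⁻¹

theorem lab_gaugeEven (a b : G) {i j σ τ σ' τ' : Bool} (h : j = true ∨ σ = σ') :
    (gaugeEven a b σ τ)⁻¹ * lab a b i j σ τ σ' τ' * gaugeEven a b σ' τ' =
      if i then (if τ then (if τ' then 1 else a⁻¹) else (if τ' then a else 1)) else 1 := by
  cases i <;> cases j <;> cases σ <;> cases τ <;> cases σ' <;> cases τ' <;>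
    first
    | (exfalso; revert h; decide)
    | simp [lab, frame, frame', gaugeEven, mul_assoc]

/-- The gauge transformation on the odd rings. -/
def gaugeOdd (a : G) (τ : Bool) : G := if τ then 1 else a

theorem lab_gaugeOdd (a b : G) {i j σ τ σ' τ' : Bool} (h : i = true ∨ τ = τ') :
    (gaugeOdd a τ)⁻¹ * lab a b i j σ τ σ' τ' * gaugeOdd a τ' =
      if j then (if σ then (if σ' then 1 else b) else (if σ' then b⁻¹ else 1)) else 1 := by
  cases i <;> cases j <;> cases σ <;> cases τ <;> cases σ' <;> cases τ' <;>
    first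
    | (exfalso; revert h; decide)
    | simp [lab, frame, frame', gaugeOdd, mul_assoc]

theorem gauge_ringPsi_ring (hB : 0 < B) (a b : G) (q : Bool × Fin m) :
    Gauge (pb (ringPsi m B a b) (ring m B q)) (pb (ac (if q.1 then b else a⁻¹)) Prod.snd)
      (collar Circle) := by
  obtain ⟨e, k⟩ := q
  have hmul : ∀ x : ℝ, 0 ≤ B * x ↔ 0 ≤ x := fun x => mul_nonneg_iff_of_pos_left hB
  have hdiv : ∀ x : ℝ, 0 ≤ x / 10 ↔ 0 ≤ x := fun x => by
    constructor <;> intro h <;> linarith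
  have hU : Continuous fun y : Circle × ℂ => (ringU y).im :=
    Complex.continuous_im.comp continuous_ringU
  have hO : IsOpen {y : Circle × ℂ | ‖y.2‖ < 1} := isOpen_lt (by fun_prop) continuous_const
  apply Gauge.symm
  cases e
  · refine ⟨fun y => gaugeEven a b (decide (0 ≤ (ringU y).im)) (decide (0 ≤ y.2.im)), fun y hy => ?_⟩
    obtain ⟨W, hW, hV⟩ : ∃ W ∈ 𝓝 y, ∀ u ∈ W, ∀ v ∈ W,
        decide (ringP m B true (ring m B (false, k) u) < 1) = true ∨
        decide (0 ≤ (ringU u).im) = decide (0 ≤ (ringU v).im) := by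
      by_cases h0 : (ringU y).im = 0
      · have := ((continuous_ringP m B true).comp (continuous_ring m B (false, k))).continuousAt
          |>.eventually (gt_mem_nhds (ringP_not_lt_one (q := (false, k)) hB hy.2.le h0))
        exact ⟨_, this, fun u hu _ _ => Or.inl (decide_eq_true hu)⟩
      · exact ⟨_, eventually_decide_le hU h0, fun u hu v hv => Or.inr (hu.trans hv.symm)⟩
    obtain ⟨U, hN, H⟩ := exists_nhds_ac_eq a⁻¹ (ne_zero_of_mem_collar hy)
    refine ⟨_, Filter.inter_mem (Filter.inter_mem hN hW) (hO.mem_nhds hy.2), fun u hu v hv => ?_⟩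
    have h := hV u hu.1.2 v hv.1.2
    have r1 := ring_re (B := B) (false, k) u
    have r2 := ring_im (B := B) (false, k) u
    have r3 := ring_re (B := B) (false, k) v
    have r4 := ring_im (B := B) (false, k) v
    have r5 := ringP_lt_one_iff hB (q := (false, k)) (y := u) (le_of_lt hu.2)
    simp only [swp_false] at r1 r2 r3 r4
    simp only [pb, ringPsi, r1, r2, r3, r4, hmul, hdiv, r5]
    rw [lab_gaugeEven a b h, if_neg Bool.false_ne_true, H u hu.1.1 v hv.1.1]
    simp only [decide_eq_true_eq, inv_inv]
  · refine ⟨fun y => gaugeOdd a (decide (0 ≤ (ringU y).im)), fun y hy => ?_⟩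
    obtain ⟨W, hW, hV⟩ : ∃ W ∈ 𝓝 y, ∀ u ∈ W, ∀ v ∈ W,
        decide (ringP m B false (ring m B (true, k) u) < 1) = true ∨
        decide (0 ≤ (ringU u).im) = decide (0 ≤ (ringU v).im) := by
      by_cases h0 : (ringU y).im = 0
      · have := ((continuous_ringP m B false).comp (continuous_ring m B (true, k))).continuousAt
          |>.eventually (gt_mem_nhds (ringP_not_lt_one (q := (true, k)) hB hy.2.le h0))
        exact ⟨_, this, fun u hu _ _ => Or.inl (decide_eq_true hu)⟩
      · exact ⟨_, eventually_decide_le hU h0, fun u hu v hv => Or.inr (hu.trans hv.symm)⟩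
    obtain ⟨U, hN, H⟩ := exists_nhds_ac_eq b (ne_zero_of_mem_collar hy)
    refine ⟨_, Filter.inter_mem (Filter.inter_mem hN hW) (hO.mem_nhds hy.2), fun u hu v hv => ?_⟩
    have h := hV u hu.1.2 v hv.1.2
    have r1 := ring_re (B := B) (true, k) u
    have r2 := ring_im (B := B) (true, k) u
    have r3 := ring_re (B := B) (true, k) v
    have r4 := ring_im (B := B) (true, k) v
    have r5 := ringP_lt_one_iff hB (q := (true, k)) (y := u) (le_of_lt hu.2)
    have c : ∀ w : ℂ, (swp true w).re = w.im ∧ (swp true w).im = w.re := fun w => by simp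
    simp only [c] at r1 r2 r3 r4
    simp only [pb, ringPsi, r1, r2, r3, r4, hmul, hdiv, r5]
    rw [lab_gaugeOdd a b h, if_pos trivial, H u hu.1.1 v hv.1.1]
    simp only [decide_eq_true_eq]

theorem ext_ring (hm : 0 < m) (hB : 0 < B) (hB' : B ≤ 1 / 4) (x y : G) :
    Ext (ring m B) (y⁻¹ * x⁻¹ * y * x) (fun q => if q.1 then y else x) := by
  refine ⟨ringPsi m B x⁻¹ y, lc_ringPsi hm hB _ _, ?_, fun q => ?_⟩
  · simpa using gauge_ringPsi_collar (m := m) hB hB' x⁻¹ y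
  · simpa using gauge_ringPsi_ring hB x⁻¹ y q

theorem hasExt_ring (hm : 0 < m) (hB : 0 < B) (hB' : B ≤ 1 / 4) {S : Set G}
    (hS : ∀ z ∈ S, ∃ x ∈ S, ∃ y ∈ S, z = y⁻¹ * x⁻¹ * y * x) : HasExt S (ring m B) := by
  intro z hz
  obtain ⟨x, hx, y, hy, rfl⟩ := hS z hz
  refine ⟨fun q => if q.1 then y else x, fun q => ?_, ext_ring hm hB hB' x y⟩
  dsimp only; split_ifs <;> assumption

end RingExt

section Tower

set_option linter.unusedSectionVars false

variable {T G : Type*} [TopologicalSpace T] [Group G] {J : ℕ → Type*}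

/-- The solid torus. -/
def solid (T : Type*) : Set (T × ℂ) := {y | ‖y.2‖ ≤ 1}

/-- The union of the tori reached after `n` steps, starting with step `k`. -/
def tower (f : ∀ k, J k → T × ℂ → T × ℂ) : ℕ → ℕ → Set (T × ℂ)
  | 0, _ => solid T
  | n + 1, k => ⋃ j, f k j '' tower f n (k + 1)

/-- The set of points staying in the tori forever, starting with step `k`. -/
def attractor (f : ∀ k, J k → T × ℂ → T × ℂ) (k : ℕ) : Set (T × ℂ) := ⋂ n, tower f n k

/-- The finite stages of the construction of a cocycle off the attractor. -/
def approx {σ : Type*} (f : ∀ k, J k → T × ℂ → T × ℂ) (Ψ : ℕ → σ → T × ℂ → T × ℂ → G)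
    (η : ∀ k, σ → J k → T × ℂ → G) (ζ : ∀ k, σ → J k → σ) : ℕ → ℕ → σ → T × ℂ → T × ℂ → G
  | 0, k, z => Ψ k z
  | n + 1, k, z => glue (f k) (Ψ k z) (η k z) fun j => approx f Ψ η ζ n (k + 1) (ζ k z j)

theorem isCompact_solid [CompactSpace T] : IsCompact (solid T) := by
  have : solid T = univ ×ˢ closedBall 0 1 := by ext; simp [solid]
  rw [this]
  exact isCompact_univ.prod (isCompact_closedBall _ _)

variable {f : ∀ k, J k → T × ℂ → T × ℂ}

theorem tower_succ_subset (hf : ∀ k, GoodStep (f k)) (n k : ℕ) :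
    tower f (n + 1) k ⊆ tower f n k := by
  induction n generalizing k with
  | zero =>
    rintro _ ⟨_, ⟨j, rfl⟩, v, hv, rfl⟩
    exact ((hf k).maps j v hv).le.trans (by norm_num)
  | succ n ih => exact iUnion_mono fun j => image_mono (ih (k + 1))

theorem tower_antitone (hf : ∀ k, GoodStep (f k)) (k : ℕ) : Antitone fun n => tower f n k :=
  antitone_nat_of_succ_le fun n => tower_succ_subset hf n k

theorem tower_subset_solid (hf : ∀ k, GoodStep (f k)) (n k : ℕ) :
    tower f n k ⊆ solid T :=
  tower_antitone hf k (Nat.zero_le n)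

variable [CompactSpace T] [T2Space T] [∀ k, Finite (J k)]

theorem isCompact_tower (hf : ∀ k, GoodStep (f k)) (n k : ℕ) : IsCompact (tower f n k) := by
  induction n generalizing k with
  | zero => exact isCompact_solid
  | succ n ih => exact isCompact_iUnion fun j => (ih _).image ((hf k).cont j)

theorem isCompact_attractor (hf : ∀ k, GoodStep (f k)) (k : ℕ) : IsCompact (attractor f k) :=
  (isCompact_tower hf 0 k).of_isClosed_subset
    (isClosed_iInter fun n => (isCompact_tower hf n k).isClosed) (iInter_subset _ 0)

section Limit

variable {σ : Type*} {Ψ : ℕ → σ → T × ℂ → T × ℂ → G} {η : ∀ k, σ → J k → T × ℂ → G}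
  {ζ : ∀ k, σ → J k → σ}

theorem approx_eq_of_collar (hf : ∀ k, GoodStep (f k)) {n k : ℕ} {z : σ} {y y' : T × ℂ}
    (hy : y ∈ collar T) (hy' : y' ∈ collar T) : approx f Ψ η ζ n k z y y' = Ψ k z y y' := by
  cases n with
  | zero => rfl
  | succ n =>
    have H : ∀ y ∈ collar T, ∀ j v, ‖v.2‖ < 15 / 16 → f k j v ≠ y := fun y hy j v hv h => by
      have := (hf k).maps j v (by linarith)
      rw [h] at this
      linarith [hy.1]
    exact glue_out (H y hy) (H y' hy')

theorem approx_succ (hf : ∀ k, GoodStep (f k)) {n k : ℕ} {z : σ} {y y' : T × ℂ}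
    (hy : y ∉ tower f (n + 1) k) (hy' : y' ∉ tower f (n + 1) k) :
    approx f Ψ η ζ (n + 1) k z y y' = approx f Ψ η ζ n k z y y' := by
  induction n generalizing k z y y' with
  | zero =>
    have H : ∀ y ∉ tower f 1 k, ∀ j v, ‖v.2‖ < 15 / 16 → f k j v ≠ y := fun y hy j v hv h =>
      hy (mem_iUnion.2 ⟨j, v, show ‖v.2‖ ≤ 1 by linarith, h⟩)
    exact glue_out (H y hy) (H y' hy')
  | succ n ih =>
    rw [approx, approx]
    by_cases h : ∃ j v v', ‖v.2‖ < 15 / 16 ∧ ‖v'.2‖ < 15 / 16 ∧ f k j v = y ∧ f k j v' = y'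
    · obtain ⟨j, v, v', h1, h2, rfl, rfl⟩ := h
      rw [glue_in (hf k).inj h1 h2, glue_in (hf k).inj h1 h2]
      exact ih (fun h => hy (mem_iUnion.2 ⟨j, v, h, rfl⟩)) fun h =>
        hy' (mem_iUnion.2 ⟨j, v', h, rfl⟩)
    · have h' : ∀ j v v', ‖v.2‖ < 15 / 16 → ‖v'.2‖ < 15 / 16 → f k j v = y → f k j v' ≠ y' :=
        fun j v v' h1 h2 h3 h4 => h ⟨j, v, v', h1, h2, h3, h4⟩
      rw [glue_of_not h', glue_of_not h']

theorem approx_of_le (hf : ∀ k, GoodStep (f k)) {n m k : ℕ} (hnm : n ≤ m) {z : σ} {y y' : T × ℂ}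
    (hy : y ∉ tower f (n + 1) k) (hy' : y' ∉ tower f (n + 1) k) :
    approx f Ψ η ζ m k z y y' = approx f Ψ η ζ n k z y y' := by
  induction m, hnm using Nat.le_induction with
  | base => rfl
  | succ m hm ih =>
    rw [approx_succ hf, ih]
    · exact fun h => hy (tower_antitone hf k (by omega) h)
    · exact fun h => hy' (tower_antitone hf k (by omega) h)

theorem lc_approx (hf : ∀ k, GoodStep (f k))
    (hΨ : ∀ k z, LC (Ψ k z) {y | ∀ j v, v.2 = 0 → f k j v ≠ y})
    (hη : ∀ k z j, ∀ v ∈ collar T, ∃ U ∈ 𝓝 v, ∀ u ∈ U, ∀ u' ∈ U,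
      Ψ k z (f k j u) (f k j u') = (η k z j u)⁻¹ * Ψ (k + 1) (ζ k z j) u u' * η k z j u')
    (n k : ℕ) (z : σ) : LC (approx f Ψ η ζ n k z) (tower f (n + 1) k)ᶜ := by
  induction n generalizing k z with
  | zero =>
    refine (hΨ k z).mono fun y hy j v hv h => hy (mem_iUnion.2 ⟨j, v, ?_, h⟩)
    show ‖v.2‖ ≤ 1
    simp [hv]
  | succ n ih =>
    have H := lc_glue (hf k).cont (hf k).isOpenMap (hf k).inj (Ψ := Ψ k z) (η := η k z)
      (Θ := fun j => approx f Ψ η ζ n (k + 1) (ζ k z j)) (fun j v hv => ?_) (hΨ k z)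
      (fun j => ih (k + 1) (ζ k z j))
    · refine H.mono fun y hy => ?_
      by_cases h : ∃ j v, ‖v.2‖ < 15 / 16 ∧ f k j v = y
      · obtain ⟨j, v, hv, rfl⟩ := h
        exact Or.inr ⟨j, v, hv, fun h => hy (mem_iUnion.2 ⟨j, v, h, rfl⟩), rfl⟩
      · push Not at h
        exact Or.inl ⟨fun j v hv => h j v (by rw [hv]; norm_num),
          fun j v hv => h j v (by linarith)⟩
    · obtain ⟨U, hU, hUη⟩ := hη k z j v hv
      have hc : collar T ∈ 𝓝 v := isOpen_collar.mem_nhds hv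
      refine ⟨_, Filter.inter_mem hU hc, fun u hu u' hu' => ?_⟩
      rw [hUη u hu.1 u' hu'.1, approx_eq_of_collar hf hu.2 hu'.2]

end Limit

theorem exists_lc_attractor (hf : ∀ k, GoodStep (f k)) {S : Set G} (hE : ∀ k, HasExt S (f k))
    {z : G} (hz : z ∈ S) (k : ℕ) :
    ∃ Φ : T × ℂ → T × ℂ → G, LC Φ (attractor f k)ᶜ ∧
      Gauge Φ (pb (ac z) Prod.snd) (collar T) := by
  classical
  choose ζ hζ Ψ hΨ hcol hin using fun k (z : S) => hE k z z.2
  have hη : ∀ k (z : S) j, Gauge (pb (Ψ k z) (f k j)) (Ψ (k + 1) ⟨ζ k z j, hζ k z j⟩) (collar T) :=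
    fun k z j => (hin k z j).trans (hcol (k + 1) ⟨ζ k z j, hζ k z j⟩).symm
  choose η hη using hη
  let A := approx f Ψ η (fun k (z : S) j => ⟨ζ k z j, hζ k z j⟩)
  let Φ : T × ℂ → T × ℂ → G := fun y y' =>
    if h : ∃ n, y ∉ tower f (n + 1) k ∧ y' ∉ tower f (n + 1) k then
      A (Nat.find h) k ⟨z, hz⟩ y y' else 1
  have hΦ : ∀ n y y', y ∉ tower f (n + 1) k → y' ∉ tower f (n + 1) k →
      Φ y y' = A n k ⟨z, hz⟩ y y' := fun n y y' hy hy' => by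
    have h : ∃ n, y ∉ tower f (n + 1) k ∧ y' ∉ tower f (n + 1) k := ⟨n, hy, hy'⟩
    have hs := Nat.find_spec h
    simp only [Φ, dif_pos h]
    exact (approx_of_le hf (Nat.find_min' h ⟨hy, hy'⟩) hs.1 hs.2).symm
  refine ⟨Φ, fun x hx => ?_, (Gauge.of_eq (Ψ := Ψ k ⟨z, hz⟩) fun x hx => ?_).trans
    (hcol k ⟨z, hz⟩)⟩
  · obtain ⟨n, hn⟩ : ∃ n, x ∉ tower f (n + 1) k := by
      by_contra! hc
      exact hx (mem_iInter.2 fun n => tower_succ_subset hf n k (hc n))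
    obtain ⟨U, hU, H⟩ := lc_approx hf hΨ hη n k ⟨z, hz⟩ x hn
    refine ⟨_, Filter.inter_mem hU ((isCompact_tower hf (n + 1) k).isClosed.isOpen_compl.mem_nhds
      hn), fun a ha b hb c hc => ?_⟩
    rw [hΦ n a b ha.2 hb.2, hΦ n b c hb.2 hc.2, hΦ n a c ha.2 hc.2]
    exact H a ha.1 b hb.1 c hc.1
  · refine ⟨collar T, isOpen_collar.mem_nhds hx, fun y hy y' hy' => ?_⟩
    have H : ∀ y ∈ collar T, y ∉ tower f 1 k := by
      rintro _ hy ⟨_, ⟨j, rfl⟩, v, hv, rfl⟩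
      have := (hf k).maps j v hv
      linarith [hy.1]
    exact hΦ 0 y y' (H y hy) (H y' hy')

end Tower

section Nontrivial

set_option linter.unusedSectionVars false

theorem Prim.congr {X G : Type*} [TopologicalSpace X] [Group G] {Φ Ψ : X → X → G} {φ : X → G}
    {A : Set X} (h : Prim Φ φ A) (he : ∀ y ∈ A, ∀ y' ∈ A, Φ y y' = Ψ y y') : Prim Ψ φ A := by
  intro x hx
  obtain ⟨U, hU, H⟩ := h x hx
  exact ⟨U ∩ A, Filter.inter_mem hU self_mem_nhdsWithin, fun a ha b hb => by
    rw [← he a ha.2 b hb.2, H a ha.1 b hb.1]⟩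

theorem ac_one {G : Type*} [Group G] : ac (1 : G) = fun _ _ => 1 := by
  funext w w'; simp [ac]

variable {T G : Type*} [TopologicalSpace T] [Group G] {J : ℕ → Type*}
  {f : ∀ k, J k → T × ℂ → T × ℂ} [CompactSpace T] [T2Space T] [∀ k, Finite (J k)]
  {Ω : Type*} [TopologicalSpace Ω] [T2Space Ω]

/-- Past a step which produces a nontrivial inner holonomy out of the trivial cocycle, the
complement of an image of the attractor carries a cocycle which is nontrivial on a compact set. -/
theorem exists_nontrivial [Nonempty T] (hf : ∀ k, GoodStep (f k)) {S : Set G}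
    (hE : ∀ k, HasExt S (f k)) {k : ℕ} {ζ : J k → G} (hζ : ∀ j, ζ j ∈ S) (h1 : Ext (f k) 1 ζ)
    {j₀ : J k} (hj₀ : ζ j₀ ≠ 1) {E : T × ℂ → Ω} (cont : Continuous E) (isOpenMap : IsOpenMap E)
    (inj : InjOn E (solid T)) :
    ∃ Φ : Ω → Ω → G, LC Φ (E '' attractor f k)ᶜ ∧ ∃ Z, IsCompact Z ∧
      Disjoint Z (E '' attractor f k) ∧ ∀ φ, ¬ Prim Φ φ Z := by
  obtain ⟨τ₀⟩ := ‹Nonempty T›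
  obtain ⟨Ψ, hΨ, hcol, hin⟩ := h1
  choose Θ hΘ hΘc using fun j => exists_lc_attractor hf hE (hζ j) (k + 1)
  choose η hη using fun j => (hin j).trans (hΘc j).symm
  have hgl := gauge_glue (hf k).cont (hf k).isOpenMap (hf k).inj hη
  have hlc : LC (glue (f k) Ψ η Θ) (attractor f k)ᶜ := by
    refine (lc_glue (hf k).cont (hf k).isOpenMap (hf k).inj hη hΨ hΘ).mono fun x hx => ?_
    by_cases h : ∃ j v, ‖v.2‖ < 15 / 16 ∧ f k j v = x
    · obtain ⟨j, v, hv, rfl⟩ := h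
      refine Or.inr ⟨j, v, hv, fun hva => hx (mem_iInter.2 fun n => ?_), rfl⟩
      exact tower_succ_subset hf n k (mem_iUnion.2 ⟨j, v, mem_iInter.1 hva n, rfl⟩)
    · push Not at h
      exact Or.inl ⟨fun j v hv => h j v (by rw [hv]; norm_num), fun j v hv => h j v (by linarith)⟩
  have hc1 : Gauge (fun _ _ : T × ℂ => (1 : G)) (glue (f k) Ψ η Θ) (collar T) := by
    have e : pb (ac (1 : G)) Prod.snd = fun _ _ : T × ℂ => (1 : G) := by rw [ac_one]; rfl
    rw [e] at hcol
    refine ((hgl.mono fun y hy j v hv hfv => ?_).trans hcol).symm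
    have := (hf k).maps j v (by linarith)
    rw [hfv] at this
    linarith [hy.1]
  obtain ⟨η', hη'⟩ := hc1
  have inj' : ∀ (j j' : Unit) y y', ‖y.2‖ ≤ 1 → ‖y'.2‖ ≤ 1 → E y = E y' → j = j' ∧ y = y' :=
    fun _ _ y y' hy hy' h => ⟨rfl, inj hy hy' h⟩
  let Φ := glue (fun _ : Unit => E) (fun _ _ => (1 : G)) (fun _ => η') fun _ => glue (f k) Ψ η Θ
  let C : Set (T × ℂ) := (fun w => (τ₀, w)) '' sphere (0 : ℂ) (15 / 16)
  have hC : ∀ y ∈ C, ‖y.2‖ = 15 / 16 := by rintro _ ⟨w, hw, rfl⟩; simpa using hw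
  refine ⟨Φ, ?_, (fun y => E (f k j₀ y)) '' C, ?_, ?_, fun φ hφ => hj₀ ?_⟩
  · refine (lc_glue (fun _ => cont) (fun _ => isOpenMap) inj' (fun _ => hη') (A := univ)
      (fun x _ => ⟨univ, Filter.univ_mem, by simp⟩) fun _ => hlc).mono fun x hx => ?_
    by_cases h : ∃ v, ‖v.2‖ < 15 / 16 ∧ E v = x
    · obtain ⟨v, hv, rfl⟩ := h
      exact Or.inr ⟨(), v, hv, fun hva => hx ⟨v, hva, rfl⟩, rfl⟩
    · push Not at h
      exact Or.inl ⟨trivial, fun j v hv => h v (by linarith)⟩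
  · exact ((isCompact_sphere _ _).image (by fun_prop)).image (cont.comp ((hf k).cont j₀))
  · rw [disjoint_left]
    rintro _ ⟨c, hc, rfl⟩ ⟨y, hy, hyc⟩
    have hc1 : ‖c.2‖ ≤ 1 := by rw [hC c hc]; norm_num
    have e := inj (tower_subset_solid hf 0 k (mem_iInter.1 hy 0))
      (((hf k).maps j₀ c hc1).le.trans (by norm_num)) hyc
    obtain ⟨_, ⟨j, rfl⟩, v, ⟨_, ⟨j', rfl⟩, v', hv', rfl⟩, hve⟩ := mem_iInter.1 hy 2
    have hlt := (hf (k + 1)).maps j' v' hv'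
    have := ((hf k).inj j j₀ _ c (hlt.le.trans (by norm_num)) hc1 (hve.trans e)).2
    rw [this, hC c hc] at hlt
    norm_num at hlt
  · have h2 : Prim (glue (f k) Ψ η Θ) (φ ∘ E) (f k j₀ '' C) := by
      refine (hφ.pb (g := E) cont.continuousOn ?_).congr ?_
      · rintro _ ⟨c, hc, rfl⟩; exact ⟨c, hc, rfl⟩
      · have hlt : ∀ y ∈ f k j₀ '' C, ‖y.2‖ < 15 / 16 := by
          rintro _ ⟨c, hc, rfl⟩
          exact ((hf k).maps j₀ c (by rw [hC c hc]; norm_num)).trans (by norm_num)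
        intro y hy y' hy'
        exact glue_in (G := G) (f := fun _ : Unit => E) (Ψ := fun _ _ => 1) (η := fun _ => η')
          (Θ := fun _ => glue (f k) Ψ η Θ) inj' (j := ()) (hlt y hy) (hlt y' hy')
    have h3 := h2.pb (g := fun w : ℂ => f k j₀ (τ₀, w)) (B := sphere 0 (15 / 16))
      (((hf k).cont j₀).comp (by fun_prop)).continuousOn fun w hw => ⟨_, ⟨w, hw, rfl⟩, rfl⟩
    have h4 : Gauge (pb (glue (f k) Ψ η Θ) (f k j₀)) (pb (ac (ζ j₀)) Prod.snd) (collar T) := by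
      refine (hgl.pb (g := f k j₀) (fun y _ => ((hf k).cont j₀).continuousAt)
        fun y hy j v hv hfv => ?_).trans (hin j₀)
      have := ((hf k).inj j j₀ v y (by linarith) hy.2.le hfv).2
      rw [this] at hv
      linarith [hy.1]
    have h5 : Gauge (ac (ζ j₀)) (pb (glue (f k) Ψ η Θ) fun w : ℂ => f k j₀ (τ₀, w))
        (sphere 0 (15 / 16)) := by
      refine h4.symm.pb (g := fun w : ℂ => (τ₀, w)) (fun _ _ => by fun_prop) fun w hw => ?_
      have : ‖w‖ = 15 / 16 := by simpa using hw
      exact ⟨by simp only [this]; norm_num, by simp only [this]; norm_num⟩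
    obtain ⟨ψ, hψ⟩ := h5.exists_prim h3
    exact eq_one_of_prim_ac (by norm_num) hψ

end Nontrivial

section Kill

variable {I G Ω : Type*} [DecidableEq I] [Group G] [TopologicalSpace Ω] [T2Space Ω]

/-- A cocycle with values in a group of exponent dividing `p` loses its nontriviality outside of
a finite union of tori containing `p`-cables. -/
theorem exists_kill {p : ℕ} (hp : 1 ≤ p) (hG : ∀ g : G, g ^ p = 1) {ρ : ℝ} (hρ : 1 / 4 ≤ ρ)
    (hρ' : ρ ≤ 3 / 4) (i : I) {W : Type*} [DecidableEq W] {E : W → (I → Circle) × ℂ → Ω}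
    (cont : ∀ w, Continuous (E w)) (isOpenMap : ∀ w, IsOpenMap (E w))
    (inj : ∀ w, InjOn (E w) (solid _)) {Φ : Ω → Ω → G} {K Z : Set Ω} (h : LC Φ Kᶜ)
    (hK : ∀ w y, ‖y.2‖ ≤ 1 → E w y ∈ K → ∃ v, ‖v.2‖ ≤ 1 ∧ lift i (cable p ρ) v = y)
    (hKZ : ∀ w, Disjoint (E w '' solid _) K ∨ Disjoint (E w '' solid _) Z) (F : Finset W) :
    ∃ Φ', LC Φ' (K \ ⋃ w ∈ F, E w '' solid _)ᶜ ∧ ∀ y ∈ Z, ∀ y' ∈ Z, Φ' y y' = Φ y y' := by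
  induction F using Finset.induction_on with
  | empty => exact ⟨Φ, by simpa using h, fun _ _ _ _ => rfl⟩
  | insert w F _ ih =>
    obtain ⟨Φ', h1, h2⟩ := ih
    have e : K \ ⋃ w' ∈ insert w F, E w' '' solid _ =
        (K \ ⋃ w ∈ F, E w '' solid _) \ E w '' solid _ := by
      ext x; simp only [Finset.mem_insert, iUnion_iUnion_eq_or_left, mem_sdiff, mem_union]; tauto
    rw [e]
    obtain hd | hd := hKZ w
    · refine ⟨Φ', h1.mono fun x hx hx' => hx ⟨hx', fun h => hd.ne_of_mem h hx'.1 rfl⟩, h2⟩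
    · obtain ⟨Φ'', h3, h4⟩ := exists_kill_ext hp hG hρ hρ' i (cont w) (isOpenMap w) (inj w) h1
        fun y hy hyK => hK w y hy hyK.1
      refine ⟨Φ'', h3, fun y hy y' hy' => ?_⟩
      rw [h4 y y' (fun h => hd.ne_of_mem h hy rfl) fun h => hd.ne_of_mem h hy' rfl, h2 y hy y' hy']

end Kill

section Comp

set_option linter.unusedSectionVars false

variable {T J G : Type*} [TopologicalSpace T] [Group G]

theorem GoodStep.comp {f : J → T × ℂ → T × ℂ} (hf : GoodStep f) {g : T × ℂ → T × ℂ}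
    (hg : GoodStep fun _ : Unit => g) : GoodStep fun j => f j ∘ g where
  cont j := (hf.cont j).comp (hg.cont ())
  isOpenMap j := (hf.isOpenMap j).comp (hg.isOpenMap ())
  inj j j' y y' hy hy' h := by
    obtain ⟨h1, h2⟩ := hf.inj j j' _ _ ((hg.maps () y hy).le.trans (by norm_num))
      ((hg.maps () y' hy').le.trans (by norm_num)) h
    exact ⟨h1, (hg.inj () () y y' hy hy' h2).2⟩
  maps j y hy := hf.maps j _ ((hg.maps () y hy).le.trans (by norm_num))

variable [CompactSpace T] [T2Space T] [Finite J]

theorem Ext.comp {f : J → T × ℂ → T × ℂ} (hf : GoodStep f) {g : T × ℂ → T × ℂ}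
    (hg : GoodStep fun _ : Unit => g) {z : G} {ζ ξ : J → G} (h : Ext f z ζ)
    (h' : ∀ j, Ext (fun _ : Unit => g) (ζ j) fun _ => ξ j) : Ext (fun j => f j ∘ g) z ξ := by
  obtain ⟨Ψ, hΨ, hcol, hin⟩ := h
  choose Θ hΘ hΘc hΘi using h'
  choose η hη using fun j => (hin j).trans (hΘc j).symm
  refine ⟨glue f Ψ η Θ, (lc_glue hf.cont hf.isOpenMap hf.inj hη hΨ hΘ).mono fun x hx => ?_,
    ((gauge_glue hf.cont hf.isOpenMap hf.inj hη).mono fun y hy j v hv hfv => ?_).trans hcol,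
    fun j => (Gauge.of_eq (Ψ := pb (Θ j) g) fun y hy => ?_).trans (hΘi j ())⟩
  · by_cases h : ∃ j v, ‖v.2‖ < 15 / 16 ∧ f j v = x
    · obtain ⟨j, v, hv, rfl⟩ := h
      refine Or.inr ⟨j, v, hv, fun _ u hu huv => hx j u hu ?_, rfl⟩
      rw [← huv]; rfl
    · push Not at h
      exact Or.inl ⟨fun j v hv => h j v (by rw [hv]; norm_num), fun j v hv => h j v (by linarith)⟩
  · have := hf.maps j v (by linarith)
    rw [hfv] at this
    linarith [hy.1]
  · refine ⟨collar T, isOpen_collar.mem_nhds hy, fun u hu u' hu' => ?_⟩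
    exact glue_in hf.inj ((hg.maps () u hu.2.le).trans (by norm_num))
      ((hg.maps () u' hu'.2.le).trans (by norm_num))

end Comp

section Block

/-- Labelling the rings of a necklace by binary words. -/
def wordEquiv (r : ℕ) : (Fin (r + 1) → Bool) ≃ Bool × Fin (2 ^ r) :=
  Fintype.equivOfCardEq (by simp [pow_succ, mul_comm])

/-- One step of the construction: cables inside the rings of a necklace. -/
def block (r : ℕ) (B : ℝ) (p : ℕ) (ρ : ℝ) (j : Fin (r + 1) → Bool) : Circle × ℂ → Circle × ℂ :=
  ring (2 ^ r) B (wordEquiv r j) ∘ cable p ρ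

variable {r : ℕ} {B : ℝ} {p : ℕ} {ρ : ℝ}

theorem goodStep_block (hB : 0 < B) (hB' : B ≤ 1 / 4) (hp : 1 ≤ p) (hρ : 1 / 4 ≤ ρ)
    (hρ' : ρ ≤ 3 / 4) : GoodStep (block r B p ρ) :=
  ((goodStep_ring hB hB').reindex (wordEquiv r)).comp (goodStep_cable hp hρ hρ')

variable {G : Type*} [Group G] {S : Set G}

theorem hasExt_block (hB : 0 < B) (hB' : B ≤ 1 / 4) (hp : 1 ≤ p) (hρ : 1 / 4 ≤ ρ)
    (hρ' : ρ ≤ 3 / 4) (hS : ∀ z ∈ S, ∃ x ∈ S, ∃ y ∈ S, z = y⁻¹ * x⁻¹ * y * x)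
    (hSp : ∀ z ∈ S, ∃ x ∈ S, x ^ p = z) : HasExt S (block r B p ρ) := by
  intro z hz
  obtain ⟨ζ, hζ, h⟩ := (hasExt_ring (m := 2 ^ r) (by positivity) hB hB' hS).reindex
    (wordEquiv r) z hz
  choose ξ hξ h' using fun j => hSp _ (hζ j)
  refine ⟨ξ, hξ, h.comp ((goodStep_ring hB hB').reindex _) (goodStep_cable hp hρ hρ') fun j => ?_⟩
  rw [← h' j]
  exact ext_cable hp hρ hρ' _

theorem exists_ext_block_one (hB : 0 < B) (hB' : B ≤ 1 / 4) (hp : 1 ≤ p) (hρ : 1 / 4 ≤ ρ)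
    (hρ' : ρ ≤ 3 / 4) (hSp : ∀ z ∈ S, ∃ x ∈ S, x ^ p = z) (h1 : 1 ∈ S)
    {x : G} (hx : x ∈ S) (hx1 : x ≠ 1) :
    ∃ ξ, (∀ j, ξ j ∈ S) ∧ Ext (block r B p ρ) 1 ξ ∧ ∃ j, ξ j ≠ 1 := by
  have h := (ext_ring (m := 2 ^ r) (by positivity) hB hB' x 1).reindex (wordEquiv r)
  simp only [inv_one, one_mul, mul_one, inv_mul_cancel] at h
  have hζ : ∀ j, ((fun q : Bool × Fin (2 ^ r) => if q.1 then 1 else x) ∘ wordEquiv r) j ∈ S :=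
    fun j => by dsimp only [Function.comp]; split_ifs <;> assumption
  choose ξ hξ h' using fun j => hSp _ (hζ j)
  refine ⟨ξ, hξ, h.comp ((goodStep_ring hB hB').reindex _) (goodStep_cable hp hρ hρ') fun j => ?_,
    (wordEquiv r).symm (false, 0), fun h1 => hx1 ?_⟩
  · rw [← h' j]
    exact ext_cable hp hρ hρ' _
  · have := h' ((wordEquiv r).symm (false, 0))
    rw [h1, one_pow] at this
    simpa using this.symm

theorem block_lipschitz (hB : 0 < B) (hρ : 1 / 4 ≤ ρ) (hρ' : ρ ≤ 3 / 4) (hp : 1 ≤ p)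
    {y y' : Circle × ℂ} (hy : ‖y.2‖ ≤ 1) (hy' : ‖y'.2‖ ≤ 1) (j : Fin (r + 1) → Bool) :
    dist (block r B p ρ j y) (block r B p ρ j y') ≤
      (4 / 2 ^ r + 3 * B) * (p + 3) * dist y y' := by
  have h := goodStep_cable (J := Unit) hp hρ hρ'
  have h1 := ring_lipschitz (m := 2 ^ r) hB (q := wordEquiv r j)
    ((h.maps () y hy).le.trans (by norm_num)) ((h.maps () y' hy').le.trans (by norm_num))
  have h2 := cable_lipschitz (p := p) hρ hρ' (y := y) hy'
  push_cast at h1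
  rw [mul_assoc]
  exact h1.trans (mul_le_mul_of_nonneg_left h2 (by positivity))

theorem block_ne (hB : 0 < B) {p' : ℕ} {y y' : Circle × ℂ} (hy : ‖y.2‖ ≤ 1) (hy' : ‖y'.2‖ ≤ 1)
    (hB' : B ≤ 1 / 4) (j j' : Fin (r + 1) → Bool) :
    block r B p (1 / 4) j y ≠ block r B p' (3 / 4) j' y' := by
  intro h
  have a1 := cable_norm_bounds (p := p) (ρ := 1 / 4) le_rfl hy
  have a2 := cable_norm_bounds (p := p') (ρ := 3 / 4) (by norm_num) hy'
  have := ((goodStep_ring (m := 2 ^ r) hB hB').inj _ _ _ _ (by linarith) (by linarith) h).2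
  rw [this] at a1
  linarith

end Block

section Address

set_option linter.unusedSectionVars false

variable {T : Type*} [MetricSpace T] {J : ℕ → Type*}

/-- The composition of the first `n` maps along an address. -/
def comp (f : ∀ k, J k → T × ℂ → T × ℂ) (a : ∀ k, J k) : ℕ → T × ℂ → T × ℂ
  | 0 => id
  | n + 1 => comp f a n ∘ f n (a n)

/-- The torus of depth `n` along an address. -/
def cell (f : ∀ k, J k → T × ℂ → T × ℂ) (a : ∀ k, J k) (n : ℕ) : Set (T × ℂ) :=
  comp f a n '' solid T

/-- The point with a given address. -/
def pt [Nonempty T] (f : ∀ k, J k → T × ℂ → T × ℂ) (a : ∀ k, J k) : T × ℂ :=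
  Classical.epsilon fun y => ∀ n, y ∈ cell f a n

theorem comp_congr {f f' : ∀ k, J k → T × ℂ → T × ℂ} {a a' : ∀ k, J k} {n : ℕ}
    (h : ∀ k < n, f k (a k) = f' k (a' k)) : comp f a n = comp f' a' n := by
  induction n with
  | zero => rfl
  | succ n ih => rw [comp, comp, ih fun k hk => h k (by omega), h n (by omega)]

/-- The tori of depth `n` become uniformly small. -/
def Shrinks (f : ∀ k, J k → T × ℂ → T × ℂ) : Prop :=
  ∀ ε > 0, ∃ n, ∀ a, ∀ y ∈ cell f a n, ∀ y' ∈ cell f a n, dist y y' ≤ ε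

variable {f : ∀ k, J k → T × ℂ → T × ℂ}

theorem step_mem_solid (hf : ∀ k, GoodStep (f k)) {k : ℕ} {j : J k} {y : T × ℂ}
    (hy : y ∈ solid T) : f k j y ∈ solid T := ((hf k).maps j y hy).le.trans (by norm_num)

theorem comp_mem_solid (hf : ∀ k, GoodStep (f k)) (a : ∀ k, J k) {n : ℕ} {y : T × ℂ}
    (hy : y ∈ solid T) : comp f a n y ∈ solid T := by
  induction n generalizing y with
  | zero => exact hy
  | succ n ih => exact ih (step_mem_solid hf hy)

theorem continuous_comp (hf : ∀ k, GoodStep (f k)) (a : ∀ k, J k) (n : ℕ) :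
    Continuous (comp f a n) := by
  induction n with
  | zero => exact continuous_id
  | succ n ih => exact ih.comp ((hf n).cont _)

theorem isOpenMap_comp (hf : ∀ k, GoodStep (f k)) (a : ∀ k, J k) (n : ℕ) :
    IsOpenMap (comp f a n) := by
  induction n with
  | zero => exact IsOpenMap.id
  | succ n ih => exact ih.comp ((hf n).isOpenMap _)

theorem comp_inj (hf : ∀ k, GoodStep (f k)) {a a' : ∀ k, J k} {n : ℕ} {y y' : T × ℂ}
    (hy : y ∈ solid T) (hy' : y' ∈ solid T) (h : comp f a n y = comp f a' n y') :
    (∀ k < n, a k = a' k) ∧ y = y' := by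
  induction n generalizing y y' with
  | zero => exact ⟨fun k hk => absurd hk (by omega), h⟩
  | succ n ih =>
    obtain ⟨h1, h2⟩ := ih (step_mem_solid hf hy) (step_mem_solid hf hy') h
    obtain ⟨h3, h4⟩ := (hf n).inj _ _ y y' hy hy' h2
    refine ⟨fun k hk => ?_, h4⟩
    obtain rfl | hk := Nat.eq_or_lt_of_le (Nat.lt_succ_iff.1 hk)
    · exact h3
    · exact h1 k hk

theorem cell_antitone (hf : ∀ k, GoodStep (f k)) (a : ∀ k, J k) : Antitone (cell f a) := by
  refine antitone_nat_of_succ_le fun n => ?_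
  rintro _ ⟨y, hy, rfl⟩
  exact ⟨_, step_mem_solid hf hy, rfl⟩

theorem comp_mem_tower (a : ∀ k, J k) {n m : ℕ} {y : T × ℂ} (hy : y ∈ tower f m n) :
    comp f a n y ∈ tower f (n + m) 0 := by
  induction n generalizing m y with
  | zero => rw [Nat.zero_add]; exact hy
  | succ n ih =>
    rw [show n + 1 + m = n + (m + 1) by omega]
    exact ih (mem_iUnion.2 ⟨_, y, hy, rfl⟩)

theorem comp_mem_attractor (hf : ∀ k, GoodStep (f k)) (a : ∀ k, J k) {n : ℕ} {y : T × ℂ}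
    (hy : y ∈ attractor f n) : comp f a n y ∈ attractor f 0 :=
  mem_iInter.2 fun m => tower_antitone hf 0 (Nat.le_add_left m n)
    (comp_mem_tower a (mem_iInter.1 hy m))

theorem exists_step_of_mem_attractor (hf : ∀ k, GoodStep (f k)) {k : ℕ} {y : T × ℂ}
    (hy : y ∈ attractor f k) : ∃ j, ∃ y' ∈ attractor f (k + 1), f k j y' = y := by
  obtain ⟨_, ⟨j, rfl⟩, v, hv, rfl⟩ := mem_iInter.1 hy 1
  refine ⟨j, v, mem_iInter.2 fun n => ?_, rfl⟩
  obtain ⟨_, ⟨j', rfl⟩, v', hv', h⟩ := mem_iInter.1 hy (n + 1)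
  rw [← ((hf k).inj _ _ v' v (tower_subset_solid hf n _ hv') hv h).2]
  exact hv'

theorem exists_address (hf : ∀ k, GoodStep (f k)) {y : T × ℂ} (hy : y ∈ attractor f 0) :
    ∃ a, ∀ n, ∃ y' ∈ attractor f n, comp f a n y' = y := by
  choose j g hg hjg using fun k (y : attractor f k) => exists_step_of_mem_attractor hf y.2
  let seq : ∀ n, attractor f n := fun n => Nat.rec ⟨y, hy⟩ (fun n u => ⟨g n u, hg n u⟩) n
  refine ⟨fun n => j n (seq n), fun n => ⟨(seq n).1, (seq n).2, ?_⟩⟩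
  induction n with
  | zero => rfl
  | succ n ih => exact (congrArg _ (hjg n (seq n))).trans ih

theorem attractor_subset_solid (hf : ∀ k, GoodStep (f k)) (k : ℕ) : attractor f k ⊆ solid T :=
  fun _ hy => tower_subset_solid hf 0 k (mem_iInter.1 hy 0)

variable [CompactSpace T] [Nonempty T]

theorem pt_mem_cell (hf : ∀ k, GoodStep (f k)) (a : ∀ k, J k) (n : ℕ) : pt f a ∈ cell f a n := by
  have hc : ∀ n, IsCompact (cell f a n) := fun n => isCompact_solid.image (continuous_comp hf a n)
  obtain ⟨y, hy⟩ := IsCompact.nonempty_iInter_of_sequence_nonempty_isCompact_isClosed (cell f a)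
    (fun n => cell_antitone hf a (Nat.le_succ n))
    (fun n => ⟨_, (Classical.arbitrary T, 0), by simp [solid], rfl⟩) (hc 0)
    fun n => (hc n).isClosed
  exact Classical.epsilon_spec (p := fun y => ∀ n, y ∈ cell f a n) ⟨y, mem_iInter.1 hy⟩ n

theorem eq_pt (hf : ∀ k, GoodStep (f k)) (hs : Shrinks f) {a : ∀ k, J k} {y : T × ℂ}
    (hy : ∀ n, y ∈ cell f a n) : y = pt f a := by
  refine eq_of_forall_dist_le fun ε hε => ?_
  obtain ⟨n, hn⟩ := hs ε hε
  exact hn a y (hy n) _ (pt_mem_cell hf a n)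

theorem range_pt (hf : ∀ k, GoodStep (f k)) (hs : Shrinks f) :
    range (pt f) = attractor f 0 := by
  ext y
  constructor
  · rintro ⟨a, rfl⟩
    refine mem_iInter.2 fun n => ?_
    obtain ⟨v, hv, h⟩ := pt_mem_cell hf a n
    rw [← h]
    exact comp_mem_tower a (m := 0) hv
  · intro hy
    obtain ⟨a, ha⟩ := exists_address hf hy
    refine ⟨a, (eq_pt hf hs fun n => ?_).symm⟩
    obtain ⟨y', hy', h⟩ := ha n
    exact ⟨y', attractor_subset_solid hf n hy', h⟩

section Family

variable {F : (ℕ → Bool) → ∀ k, J k → T × ℂ → T × ℂ}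

theorem pt_injective (hf : ∀ s k, GoodStep (F s k))
    (hF : ∀ s s' n, (∀ k ≤ n, s k = s' k) → F s n = F s' n)
    (hsep : ∀ s s' n, (∀ k < n, s k = s' k) → s n ≠ s' n → ∀ j j', ∀ y ∈ solid T, ∀ y' ∈ solid T,
      F s n j y ≠ F s' n j' y') :
    Function.Injective fun q : (∀ k, J k) × (ℕ → Bool) => pt (F q.2) q.1 := by
  classical
  rintro ⟨a, s⟩ ⟨a', s'⟩ h
  have key : ∀ n, a n = a' n ∧ s n = s' n := by
    intro n
    induction n using Nat.strong_induction_on with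
    | _ n ih =>
    have hle : ∀ k < n, F s k = F s' k := fun k hk => hF s s' k fun l hl => (ih l (by omega)).2
    have hco : comp (F s) a n = comp (F s') a' n :=
      comp_congr fun k hk => by rw [hle k hk, (ih k hk).1]
    obtain ⟨y, hy, e⟩ := pt_mem_cell (hf s) a (n + 1)
    obtain ⟨y', hy', e'⟩ := pt_mem_cell (hf s') a' (n + 1)
    have e2 : comp (F s') a' n (F s n (a n) y) = comp (F s') a' n (F s' n (a' n) y') := by
      rw [← hco]
      exact e.trans (h.trans (e'.symm.trans (congrFun hco.symm _)))
    have e3 := (comp_inj (hf s') (step_mem_solid (hf s) hy) (step_mem_solid (hf s') hy') e2).2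
    by_cases hn : s n = s' n
    · have e4 : F s n = F s' n := hF s s' n fun k hk => by
        obtain rfl | hk := Nat.eq_or_lt_of_le hk
        exacts [hn, (ih k hk).2]
      rw [e4] at e3
      exact ⟨((hf s' n).inj _ _ y y' hy hy' e3).1, hn⟩
    · exact absurd e3 (hsep s s' n (fun k hk => (ih k hk).2) hn _ _ y hy y' hy')
  exact Prod.ext (funext fun n => (key n).1) (funext fun n => (key n).2)

theorem continuous_pt [∀ k, TopologicalSpace (J k)] [∀ k, DiscreteTopology (J k)]
    (hf : ∀ s k, GoodStep (F s k)) (hF : ∀ s s' n, (∀ k ≤ n, s k = s' k) → F s n = F s' n)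
    (hs : ∀ s, Shrinks (F s)) :
    Continuous fun q : (∀ k, J k) × (ℕ → Bool) => pt (F q.2) q.1 := by
  rw [continuous_iff_continuousAt]
  rintro ⟨a, s⟩
  refine Metric.continuousAt_iff'.2 fun ε hε => ?_
  obtain ⟨n, hn⟩ := hs s (ε / 2) (half_pos hε)
  have hev : ∀ᶠ q : (∀ k, J k) × (ℕ → Bool) in 𝓝 (a, s), ∀ k < n, q.1 k = a k ∧ q.2 k = s k := by
    have h1 : ∀ k, ∀ᶠ q : (∀ k, J k) × (ℕ → Bool) in 𝓝 (a, s), q.1 k = a k ∧ q.2 k = s k := by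
      intro k
      have c1 : Continuous fun q : (∀ k, J k) × (ℕ → Bool) => q.1 k := by fun_prop
      have c2 : Continuous fun q : (∀ k, J k) × (ℕ → Bool) => q.2 k := by fun_prop
      exact (c1.continuousAt.eventually (p := fun b => b = a k) (by simp [nhds_discrete])).and
        (c2.continuousAt.eventually (p := fun b => b = s k) (by simp [nhds_discrete]))
    exact (Filter.eventually_all_finite (finite_lt_nat n)).2 fun k _ => h1 k
  filter_upwards [hev] with q hq
  have hco : comp (F q.2) q.1 n = comp (F s) a n := comp_congr fun k hk => by
    rw [hF q.2 s k fun l hl => (hq l (by omega)).2, (hq k hk).1]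
  have h1 := pt_mem_cell (hf q.2) q.1 n
  rw [cell, hco] at h1
  exact (hn a _ h1 _ (pt_mem_cell (hf s) a n)).trans_lt (half_lt_self hε)

end Family

end Address

section Contraction

set_option linter.unusedSectionVars false

variable {T : Type*} [MetricSpace T] {J : ℕ → Type*}

/-- The composition of the maps number `k`, …, `k + n - 1` along an address. -/
def segment (f : ∀ k, J k → T × ℂ → T × ℂ) (a : ∀ k, J k) : ℕ → ℕ → T × ℂ → T × ℂ
  | _, 0 => id
  | k, n + 1 => f k (a k) ∘ segment f a (k + 1) n

theorem segment_succ (f : ∀ k, J k → T × ℂ → T × ℂ) (a : ∀ k, J k) (k n : ℕ) :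
    segment f a k (n + 1) = segment f a k n ∘ f (k + n) (a (k + n)) := by
  induction n generalizing k with
  | zero => rfl
  | succ n ih =>
    rw [segment, ih (k + 1), segment, show k + 1 + n = k + (n + 1) by omega]
    rfl

theorem comp_eq_segment (f : ∀ k, J k → T × ℂ → T × ℂ) (a : ∀ k, J k) (n : ℕ) :
    comp f a n = segment f a 0 n := by
  induction n with
  | zero => rfl
  | succ n ih => rw [comp, ih, segment_succ, Nat.zero_add]

theorem segment_add (f : ∀ k, J k → T × ℂ → T × ℂ) (a : ∀ k, J k) (k n m : ℕ) :
    segment f a k (n + m) = segment f a k n ∘ segment f a (k + n) m := by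
  induction n generalizing k with
  | zero => simp [segment]
  | succ n ih =>
    rw [show n + 1 + m = n + m + 1 by omega, segment, ih, segment,
      show k + 1 + n = k + (n + 1) by omega]
    rfl

theorem segment_mem_solid {f : ∀ k, J k → T × ℂ → T × ℂ} (hf : ∀ k, GoodStep (f k))
    (a : ∀ k, J k) {k n : ℕ} {y : T × ℂ} (hy : y ∈ solid T) : segment f a k n y ∈ solid T := by
  induction n generalizing k with
  | zero => exact hy
  | succ n ih => exact step_mem_solid hf ih

variable {I : Type*} [Fintype I] [DecidableEq I] [Nonempty I] {dir : ℕ → I}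
  {g : ∀ k, J k → Circle × ℂ → Circle × ℂ}

theorem segment_lift_bound (hg : ∀ k, GoodStep (g k))
    (hc : ∀ k j y y', ‖y.2‖ ≤ 1 → ‖y'.2‖ ≤ 1 → dist (g k j y) (g k j y') ≤ 1 / 2 * dist y y')
    (a : ∀ k, J k) {y y' : (I → Circle) × ℂ} (hy : y ∈ solid _) (hy' : y' ∈ solid _) {D : ℝ}
    (hD : dist y y' ≤ D) (n k : ℕ) :
    let u := segment (fun k j => lift (dir k) (g k j)) a k n y
    let u' := segment (fun k j => lift (dir k) (g k j)) a k n y'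
    dist u.2 u'.2 ≤ D ∧ (0 < n → dist u.2 u'.2 ≤ D / 2) ∧
      ∀ i, dist (u.1 i) (u'.1 i) ≤ D ∧
        ∀ m < n, dir (k + m) = i → dist (u.1 i) (u'.1 i) ≤ D / 2 := by
  have hD0 : 0 ≤ D := dist_nonneg.trans hD
  have hG : ∀ k, GoodStep fun j : J k => lift (dir k) (g k j) := fun k => (hg k).lift (dir k)
  induction n generalizing k with
  | zero =>
    refine ⟨?_, fun h => absurd h (by omega), fun i => ⟨?_, fun m hm => absurd hm (by omega)⟩⟩
    · exact (le_max_right _ _).trans hD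
    · exact (dist_le_pi_dist y.1 y'.1 i).trans ((le_max_left _ _).trans hD)
  | succ n ih =>
    obtain ⟨h1, -, h3⟩ := ih (k + 1)
    have m1 := segment_mem_solid hG a (k := k + 1) (n := n) hy
    have m2 := segment_mem_solid hG a (k := k + 1) (n := n) hy'
    set v := segment (fun k j => lift (dir k) (g k j)) a (k + 1) n y
    set v' := segment (fun k j => lift (dir k) (g k j)) a (k + 1) n y'
    have e : ∀ y, segment (fun k j => lift (dir k) (g k j)) a k (n + 1) y =
      lift (dir k) (g k (a k)) (segment (fun k j => lift (dir k) (g k j)) a (k + 1) n y) :=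
      fun _ => rfl
    simp only [e]
    have hb : dist (g k (a k) (pr (dir k) v)) (g k (a k) (pr (dir k) v')) ≤ D / 2 := by
      refine (hc k (a k) (pr (dir k) v) (pr (dir k) v') m1 m2).trans ?_
      have : dist (pr (dir k) v) (pr (dir k) v') ≤ D := max_le (h3 _).1 h1
      linarith
    have hb1 := (le_max_left _ _).trans hb
    have hb2 := (le_max_right _ _).trans hb
    refine ⟨?_, fun _ => hb2, fun i => ?_⟩
    · exact hb2.trans (by linarith)
    · by_cases hi : i = dir k
      · subst hi
        simp only [lift, Function.update_self]
        exact ⟨hb1.trans (by linarith), fun _ _ _ => hb1⟩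
      · rw [lift_fst_of_ne hi, lift_fst_of_ne hi]
        refine ⟨(h3 i).1, fun m hm hmi => ?_⟩
        obtain ⟨m, rfl⟩ : ∃ m', m = m' + 1 := Nat.exists_eq_succ_of_ne_zero fun h0 => by
          subst h0; exact hi hmi.symm
        exact (h3 i).2 m (by omega) (by rw [← hmi]; congr 1; omega)

theorem shrinks_lift (hg : ∀ k, GoodStep (g k))
    (hc : ∀ k j y y', ‖y.2‖ ≤ 1 → ‖y'.2‖ ≤ 1 → dist (g k j y) (g k j y') ≤ 1 / 2 * dist y y')
    {N : ℕ} (hdir : ∀ k i, ∃ m < N, dir (k + m) = i) :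
    Shrinks fun k j => lift (dir k) (g k j) := by
  have hG : ∀ k, GoodStep fun j : J k => lift (dir k) (g k j) := fun k => (hg k).lift (dir k)
  have hN : 0 < N := by
    obtain ⟨m, hm, -⟩ := hdir 0 (Classical.arbitrary I)
    omega
  have key : ∀ q k a (y y' : (I → Circle) × ℂ) D, y ∈ solid _ → y' ∈ solid _ → dist y y' ≤ D →
      dist (segment (fun k j => lift (dir k) (g k j)) a k (q * N) y)
        (segment (fun k j => lift (dir k) (g k j)) a k (q * N) y') ≤ D * (1 / 2) ^ q := by
    intro q
    induction q with
    | zero => intro k a y y' D _ _ h; simpa [segment] using h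
    | succ q ih =>
      intro k a y y' D hy hy' h
      have hD0 : 0 ≤ D := dist_nonneg.trans h
      rw [show (q + 1) * N = N + q * N by ring, segment_add]
      obtain ⟨-, h2, h3⟩ := segment_lift_bound (dir := dir) hg hc a (segment_mem_solid hG a hy)
        (segment_mem_solid hG a hy') (ih (k + N) a y y' D hy hy' h) N k
      have e : D * (1 / 2) ^ (q + 1) = D * (1 / 2) ^ q / 2 := by ring
      rw [e]
      refine max_le ((dist_pi_le_iff (by positivity)).2 fun i => ?_) (h2 hN)
      obtain ⟨m, hm, hmi⟩ := hdir k i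
      exact (h3 i).2 m hm hmi
  intro ε hε
  obtain ⟨D, hD⟩ := Metric.isBounded_iff.1 (isCompact_solid (T := I → Circle)).isBounded
  obtain ⟨q, hq⟩ : ∃ q : ℕ, |D| * (1 / 2) ^ q ≤ ε := by
    obtain ⟨q, hq⟩ := exists_pow_lt_of_lt_one (show 0 < ε / (|D| + 1) by positivity)
      (show (1 / 2 : ℝ) < 1 by norm_num)
    refine ⟨q, ?_⟩
    rw [lt_div_iff₀ (by positivity)] at hq
    have : (0 : ℝ) < (1 / 2) ^ q := by positivity
    nlinarith
  refine ⟨q * N, ?_⟩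
  rintro a _ ⟨y, hy, rfl⟩ _ ⟨y', hy', rfl⟩
  rw [comp_eq_segment]
  exact (key q 0 a y y' |D| hy hy' ((hD hy hy').trans (le_abs_self D))).trans hq

end Contraction

section System

set_option linter.unusedSectionVars false

variable {I : Type*} [DecidableEq I]

theorem lift_comp (i : I) (g h : Circle × ℂ → Circle × ℂ) : lift i (g ∘ h) = lift i g ∘ lift i h := by
  funext y
  simp only [Function.comp_apply]
  rw [lift, lift, pr_lift]
  simp [lift]

/-- The system of blocks, the `k`-th one acting in the direction `dir k`. -/
def system (dir : ℕ → I) (r : ℕ → ℕ) (B : ℕ → ℝ) (p : ℕ → ℕ) (ρ : ℕ → ℝ) (k : ℕ)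
    (j : Fin (r k + 1) → Bool) : (I → Circle) × ℂ → (I → Circle) × ℂ :=
  lift (dir k) (block (r k) (B k) (p k) (ρ k) j)

variable [Fintype I] {dir : ℕ → I} {r : ℕ → ℕ} {B : ℕ → ℝ} {p : ℕ → ℕ} {ρ : ℕ → ℝ}

theorem goodStep_system (hB : ∀ k, 0 < B k) (hB' : ∀ k, B k ≤ 1 / 4) (hp : ∀ k, 1 ≤ p k)
    (hρ : ∀ k, 1 / 4 ≤ ρ k) (hρ' : ∀ k, ρ k ≤ 3 / 4) (k : ℕ) :
    GoodStep (system dir r B p ρ k) :=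
  (goodStep_block (hB k) (hB' k) (hp k) (hρ k) (hρ' k)).lift (dir k)

variable {Ω : Type*} [TopologicalSpace Ω] [T2Space Ω]

theorem Shrinks.exists_ge {T : Type*} [MetricSpace T] {J : ℕ → Type*}
    {f : ∀ k, J k → T × ℂ → T × ℂ} (hf : ∀ k, GoodStep (f k)) (hs : Shrinks f) {ε : ℝ} (hε : 0 < ε)
    (n₀ : ℕ) : ∃ n ≥ n₀, ∀ a, ∀ y ∈ cell f a n, ∀ y' ∈ cell f a n, dist y y' ≤ ε := by
  obtain ⟨n, hn⟩ := hs ε hε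
  exact ⟨max n n₀, le_max_right _ _, fun a y hy y' hy' =>
    hn a y (cell_antitone hf a (le_max_left _ _) hy) y' (cell_antitone hf a (le_max_left _ _) hy')⟩

theorem exists_prim_of_exponent [AddCommGroup Ω] [Module ℝ Ω] [ContinuousAdd Ω]
    [ContinuousSMul ℝ Ω] (hB : ∀ k, 0 < B k) (hB' : ∀ k, B k ≤ 1 / 4)
    (hp : ∀ k, 1 ≤ p k) (hρ : ∀ k, 1 / 4 ≤ ρ k) (hρ' : ∀ k, ρ k ≤ 3 / 4)
    (hs : Shrinks (system dir r B p ρ)) {G : Type*} [Group G] {n₀ : ℕ}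
    (hG : ∀ n ≥ n₀, ∀ g : G, g ^ p n = 1) {E : (I → Circle) × ℂ → Ω} (cont : Continuous E)
    (isOpenMap : IsOpenMap E) (inj : Function.Injective E) {K Z : Set Ω}
    (hK : K ⊆ E '' attractor (system dir r B p ρ) 0) (hKc : IsClosed K) (hZ : IsClosed Z)
    (hKZ : Disjoint K Z) {Φ : Ω → Ω → G} (h : LC Φ Kᶜ) : ∃ φ, Prim Φ φ Z := by
  classical
  have hf := goodStep_system (dir := dir) (r := r) hB hB' hp hρ hρ'
  have hr : ∀ k, GoodStep fun j : Fin (r k + 1) → Bool =>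
      lift (dir k) (ring (2 ^ r k) (B k) (wordEquiv (r k) j)) := fun k =>
    ((goodStep_ring (hB k) (hB' k)).reindex _).lift _
  have hcab : ∀ k, GoodStep fun _ : Unit => lift (dir k) (cable (p k) (ρ k)) := fun k =>
    (goodStep_cable (hp k) (hρ k) (hρ' k)).lift _
  have hsys : ∀ k j, system dir r B p ρ k j =
      lift (dir k) (ring (2 ^ r k) (B k) (wordEquiv (r k) j)) ∘ lift (dir k) (cable (p k) (ρ k)) :=
    fun k j => lift_comp _ _ _
  have hKc' : IsCompact (solid _ ∩ E ⁻¹' K) := isCompact_solid.inter_right (hKc.preimage cont)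
  obtain ⟨δ, hδ, hdis⟩ := Disjoint.exists_thickenings (t := E ⁻¹' Z)
    (disjoint_left.2 fun y hy hy' => hKZ.ne_of_mem hy.2 hy' rfl) hKc' (hZ.preimage cont)
  obtain ⟨n, hn, hcell⟩ := hs.exists_ge hf (half_pos hδ) n₀
  let W : (∀ k, Fin (r k + 1) → Bool) → (I → Circle) × ℂ → Ω := fun a => E ∘
    comp (system dir r B p ρ) a n ∘ lift (dir n) (ring (2 ^ r n) (B n) (wordEquiv (r n) (a n)))
  have hrs : ∀ j y, y ∈ solid _ →
      lift (dir n) (ring (2 ^ r n) (B n) (wordEquiv (r n) j)) y ∈ solid _ := fun j y hy =>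
    ((hr n).maps j y hy).le.trans (by norm_num)
  have hWo : ∀ a, IsOpenMap (W a) := fun a =>
    isOpenMap.comp ((isOpenMap_comp hf a n).comp ((hr n).isOpenMap _))
  have hcov : K ⊆ ⋃ a, W a '' {y | ‖y.2‖ < 1} := fun x hx => by
    obtain ⟨y, hy, rfl⟩ := hK hx
    obtain ⟨a, ha⟩ := exists_address hf hy
    obtain ⟨y', hy', rfl⟩ := ha (n + 1)
    refine mem_iUnion.2 ⟨a, lift (dir n) (cable (p n) (ρ n)) y', ?_, ?_⟩
    · exact ((hcab n).maps () y' (attractor_subset_solid hf _ hy')).trans (by norm_num)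
    · rw [comp, hsys]; rfl
  have hKE : IsCompact K := ((isCompact_attractor hf 0).image cont).of_isClosed_subset hKc hK
  obtain ⟨F, hF⟩ := hKE.elim_finite_subcover _
    (fun a => hWo a _ (isOpen_lt (by fun_prop) (by fun_prop))) hcov
  have hWK : ∀ a y, ‖y.2‖ ≤ 1 → W a y ∈ K →
      ∃ v, ‖v.2‖ ≤ 1 ∧ lift (dir n) (cable (p n) (ρ n)) v = y := by
    intro a y hy hyK
    obtain ⟨u, hu, hue⟩ := hK hyK
    obtain ⟨a', ha'⟩ := exists_address hf hu
    obtain ⟨y', hy', e⟩ := ha' (n + 1)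
    have hy's := attractor_subset_solid hf _ hy'
    rw [comp, Function.comp_apply] at e
    have e1 := inj hue
    rw [← e] at e1
    have e2 := (comp_inj hf (step_mem_solid hf hy's) (hrs _ _ hy) e1).2
    rw [hsys] at e2
    have hc := (hcab n).maps () y' hy's
    exact ⟨y', hy's, ((hr n).inj _ _ _ y (hc.le.trans (by norm_num)) hy e2).2⟩
  have hWZ : ∀ a, Disjoint (W a '' solid _) K ∨ Disjoint (W a '' solid _) Z := by
    intro a
    by_contra hc
    push Not at hc
    obtain ⟨⟨_, ⟨y, hy, rfl⟩, hyK⟩, ⟨_, ⟨y', hy', rfl⟩, hyZ⟩⟩ :=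
      And.intro (not_disjoint_iff.1 hc.1) (not_disjoint_iff.1 hc.2)
    have c1 : comp (system dir r B p ρ) a n
      (lift (dir n) (ring (2 ^ r n) (B n) (wordEquiv (r n) (a n))) y) ∈ cell _ a n :=
      ⟨_, hrs _ _ hy, rfl⟩
    have c2 : comp (system dir r B p ρ) a n
      (lift (dir n) (ring (2 ^ r n) (B n) (wordEquiv (r n) (a n))) y') ∈ cell _ a n :=
      ⟨_, hrs _ _ hy', rfl⟩
    have hd := hcell a _ c1 _ c2
    refine hdis.ne_of_mem (mem_thickening_iff.2 ⟨_, ⟨comp_mem_solid hf a (hrs _ _ hy), hyK⟩, ?_⟩)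
      (self_subset_thickening hδ _ hyZ) rfl
    rw [dist_comm]
    exact hd.trans_lt (half_lt_self hδ)
  obtain ⟨Φ', h1, h2⟩ := exists_kill (hp n) (hG n hn) (hρ n) (hρ' n) (dir n) (E := W)
    (fun a => cont.comp ((continuous_comp hf a n).comp ((hr n).cont _))) hWo
    (fun a y hy y' hy' he => ((hr n).inj _ _ y y' hy hy'
      (comp_inj hf (hrs _ _ hy) (hrs _ _ hy') (inj he)).2).2) h
    hWK hWZ F
  have : K \ ⋃ a ∈ F, W a '' solid _ = ∅ := by
    refine sdiff_eq_empty.2 (hF.trans (iUnion₂_mono fun a _ => image_mono fun y hy => ?_))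
    exact (show ‖y.2‖ < 1 from hy).le
  rw [this, compl_empty] at h1
  obtain ⟨φ, hφ⟩ := exists_prim_of_lc_univ h1
  exact ⟨φ, (hφ.mono (subset_univ _)).congr h2⟩

/-- Small copies of the attractor tails lie near every point of the attractor. -/
theorem exists_small_copy {T : Type*} [MetricSpace T] [CompactSpace T] {J : ℕ → Type*}
    {f : ∀ k, J k → T × ℂ → T × ℂ} (hf : ∀ k, GoodStep (f k)) (hs : Shrinks f) {E : T × ℂ → Ω}
    (cont : Continuous E) {x : Ω} (hx : x ∈ E '' attractor f 0) {U : Set Ω} (hU : U ∈ 𝓝 x) :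
    ∃ a n, (E ∘ comp f a n) '' solid T ⊆ U := by
  obtain ⟨y, hy, rfl⟩ := hx
  obtain ⟨ε, hε, hεU⟩ := Metric.mem_nhds_iff.1 (cont.continuousAt hU)
  obtain ⟨a, ha⟩ := exists_address hf hy
  obtain ⟨n, hn⟩ := hs (ε / 2) (half_pos hε)
  refine ⟨a, n, ?_⟩
  rintro _ ⟨u, hu, rfl⟩
  obtain ⟨y', hy', rfl⟩ := ha n
  refine hεU (mem_ball.2 ((hn a (comp f a n u) ⟨u, hu, rfl⟩ _
    ⟨y', attractor_subset_solid hf _ hy', rfl⟩).trans_lt (half_lt_self hε)))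

end System

section Groups

open Matrix

variable {F : Type*} [Field F]

/-- The elementary matrices in `GL₃`. -/
def elementary (F : Type*) [Field F] : Set (GL (Fin 3) F) :=
  {g | ∃ i j, i ≠ j ∧ ∃ c, (g : Matrix (Fin 3) (Fin 3) F) = transvection i j c}

theorem exists_coe_eq_transvection {i j : Fin 3} (h : i ≠ j) (c : F) :
    ∃ g ∈ elementary F, (g : Matrix (Fin 3) (Fin 3) F) = transvection i j c :=
  ⟨⟨transvection i j c, transvection i j (-c),
    by rw [transvection_mul_transvection_same _ _ h]; simp,
    by rw [transvection_mul_transvection_same _ _ h]; simp⟩, ⟨i, j, h, c, rfl⟩, rfl⟩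

theorem exists_commutator_of_mem_elementary :
    ∀ z ∈ elementary F, ∃ x ∈ elementary F, ∃ y ∈ elementary F, z = y⁻¹ * x⁻¹ * y * x := by
  rintro z ⟨i, j, hij, c, hz⟩
  obtain ⟨k, hki, hkj⟩ : ∃ k : Fin 3, k ≠ i ∧ k ≠ j := by
    clear hz; revert i j; decide
  obtain ⟨x, hx, hx'⟩ := exists_coe_eq_transvection hkj c
  obtain ⟨y, hy, hy'⟩ := exists_coe_eq_transvection hki.symm (1 : F)
  refine ⟨x, hx, y, hy, ?_⟩
  have : x * y * z = y * x := by
    apply Units.ext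
    rw [Units.val_mul, Units.val_mul, Units.val_mul, hx', hy', hz]
    simp [transvection, mul_add, add_mul, single_mul_single_of_ne, hij.symm, hki,
      add_assoc, add_comm, add_left_comm]
  rw [mul_assoc, ← this]
  group

theorem transvection_pow {i j : Fin 3} (h : i ≠ j) (c : F) (p : ℕ) :
    transvection i j c ^ p = transvection i j (p * c) := by
  induction p with
  | zero => simp
  | succ p ih => rw [pow_succ, ih, transvection_mul_transvection_same _ _ h]; push_cast; ring_nf

theorem exists_root_of_mem_elementary {p : ℕ} (hp : (p : F) ≠ 0) :
    ∀ z ∈ elementary F, ∃ x ∈ elementary F, x ^ p = z := by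
  rintro z ⟨i, j, hij, c, hz⟩
  obtain ⟨x, hx, hx'⟩ := exists_coe_eq_transvection hij (c / p)
  refine ⟨x, hx, Units.ext ?_⟩
  rw [Units.val_pow_eq_pow_val, hx', transvection_pow hij, hz, mul_div_cancel₀ _ hp]

theorem one_mem_elementary : 1 ∈ elementary F :=
  ⟨0, 1, by decide, 0, by simp⟩

theorem exists_mem_elementary_ne_one : ∃ x ∈ elementary F, x ≠ 1 := by
  obtain ⟨x, hx, hx'⟩ := exists_coe_eq_transvection (F := F) (i := 0) (j := 1) (by decide) 1
  refine ⟨x, hx, fun h => ?_⟩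
  rw [h] at hx'
  simpa [transvection] using congrFun (congrFun hx' 0) 1

/-- The order of `GL₃(𝔽_q)`. -/
def orderGL (q : ℕ) : ℕ := (q ^ 3 - 1) * (q ^ 3 - q) * (q ^ 3 - q ^ 2)

theorem pow_orderGL {q : ℕ} [Fact q.Prime] (g : GL (Fin 3) (ZMod q)) : g ^ orderGL q = 1 := by
  have h := Matrix.card_GL_field (𝔽 := ZMod q) 3
  rw [Fin.prod_univ_three, ZMod.card] at h
  simp only [Fin.val_zero, Fin.val_one, Fin.val_two, pow_zero, pow_one] at h
  rw [orderGL, ← h]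
  exact pow_card_eq_one'

theorem orderGL_pos {q : ℕ} (hq : 2 ≤ q) : 0 < orderGL q := by
  have h1 : q ^ 0 < q ^ 3 := Nat.pow_lt_pow_right (by omega) (by norm_num)
  have h2 : q ^ 1 < q ^ 3 := Nat.pow_lt_pow_right (by omega) (by norm_num)
  have h3 : q ^ 2 < q ^ 3 := Nat.pow_lt_pow_right (by omega) (by norm_num)
  simp only [pow_zero, pow_one] at h1 h2
  exact Nat.mul_pos (Nat.mul_pos (by omega) (by omega)) (by omega)

theorem cast_orderGL {R : Type*} [CommRing R] {q : ℕ} (hq : 1 ≤ q) :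
    (orderGL q : R) = (q ^ 3 - 1) * (q ^ 3 - q) * (q ^ 3 - q ^ 2) := by
  have h1 : 1 ≤ q ^ 3 := Nat.one_le_pow _ _ hq
  have h2 : q ≤ q ^ 3 := Nat.le_self_pow (by norm_num) q
  have h3 : q ^ 2 ≤ q ^ 3 := Nat.pow_le_pow_right hq (by norm_num)
  rw [orderGL]
  push_cast [h1, h2, h3]
  ring

theorem exists_primes : ∃ q : ℕ → ℕ, (∀ i, (q i).Prime) ∧
    ∀ i j, i ≠ j → ¬ q i ∣ orderGL (q j) := by
  obtain ⟨q, hq, h⟩ := exists_seq_of_forall_finset_exists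
    (fun q : ℕ => q.Prime ∧ 11 ≤ q) (fun x y => orderGL x < y ∧ y ≡ 2 [MOD x]) fun s hs => by
      have hne : ∏ x ∈ s, x ≠ 0 := Finset.prod_ne_zero_iff.2 fun x hx => (hs x hx).1.ne_zero
      have hco : Nat.Coprime 2 (∏ x ∈ s, x) := Nat.Coprime.prod_right fun x hx =>
        (Nat.coprime_primes Nat.prime_two (hs x hx).1).2 (by have := (hs x hx).2; omega)
      obtain ⟨y, hy, hyp, hy2⟩ := Nat.forall_exists_prime_gt_and_modEq
        (11 + ∑ x ∈ s, orderGL x) hne hco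
      refine ⟨y, ⟨hyp, by omega⟩, fun x hx => ⟨?_, hy2.of_dvd (Finset.dvd_prod_of_mem _ hx)⟩⟩
      have := Finset.single_le_sum (f := orderGL) (fun _ _ => Nat.zero_le _) hx
      omega
  refine ⟨q, fun i => (hq i).1, fun i j hij hd => ?_⟩
  rcases hij.lt_or_gt with hlt | hlt
  · obtain ⟨-, h2⟩ := h i j hlt
    have := Fact.mk (hq i).1
    have e : ((q j : ℕ) : ZMod (q i)) = (2 : ℕ) := (ZMod.natCast_eq_natCast_iff _ _ _).2 h2
    have e0 : ((orderGL (q j) : ℕ) : ZMod (q i)) = 0 := (ZMod.natCast_eq_zero_iff _ _).2 hd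
    rw [cast_orderGL (hq j).1.one_le, e] at e0
    have e1 : ((168 : ℕ) : ZMod (q i)) = 0 := by rw [← e0]; push_cast; norm_num
    have h168 := (ZMod.natCast_eq_zero_iff _ _).1 e1
    rw [show 168 = 2 ^ 3 * (3 * 7) by norm_num] at h168
    have h11 := (hq i).2
    rcases (hq i).1.dvd_mul.1 h168 with h' | h'
    · have := Nat.le_of_dvd (by norm_num) ((hq i).1.dvd_of_dvd_pow h')
      omega
    · rcases (hq i).1.dvd_mul.1 h' with h' | h' <;>
      · have := Nat.le_of_dvd (by norm_num) h'
        omega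
  · obtain ⟨h1, -⟩ := h j i hlt
    exact absurd (Nat.le_of_dvd (orderGL_pos (hq j).1.two_le) hd) (by omega)

end Groups

section TorusChart

theorem isOpenEmbedding_polar : IsOpenEmbedding polar :=
  .of_continuous_injective_isOpenMap continuous_polar polar_injective isOpenMap_polar

theorem exists_isOpenEmbedding_circle_prod (m : ℕ) :
    ∃ f : Circle × EuclideanSpace ℝ (Fin (m + 1)) → EuclideanSpace ℝ (Fin (m + 2)),
      IsOpenEmbedding f := by
  let e : EuclideanSpace ℝ (Fin (m + 1)) ≃L[ℝ] ℝ × EuclideanSpace ℝ (Fin m) :=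
    ContinuousLinearEquiv.ofFinrankEq (by simp [add_comm])
  let e' : (ℂ × EuclideanSpace ℝ (Fin m)) ≃L[ℝ] EuclideanSpace ℝ (Fin (m + 2)) :=
    ContinuousLinearEquiv.ofFinrankEq (by simp [add_comm])
  exact ⟨_, e'.toHomeomorph.isOpenEmbedding.comp <| (isOpenEmbedding_polar.prodMap
    IsOpenEmbedding.id).comp <| (Homeomorph.prodAssoc _ _ _).symm.isOpenEmbedding.comp
      (IsOpenEmbedding.id.prodMap e.toHomeomorph.isOpenEmbedding)⟩

theorem exists_isOpenEmbedding_torus_prod (N d : ℕ) :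
    ∃ f : (Fin N → Circle) × EuclideanSpace ℝ (Fin (d + 1)) → EuclideanSpace ℝ (Fin (N + d + 1)),
      IsOpenEmbedding f := by
  induction N with
  | zero =>
    rw [zero_add]
    exact ⟨_, (Homeomorph.uniqueProd (Fin 0 → Circle) _).isOpenEmbedding⟩
  | succ N ih =>
    obtain ⟨f, hf⟩ := ih
    obtain ⟨g, hg⟩ := exists_isOpenEmbedding_circle_prod (N + d)
    rw [show N + 1 + d + 1 = N + d + 2 by ring]
    let e : (Fin (N + 1) → Circle) ≃ₜ Circle × (Fin N → Circle) :=
      { (Fin.consEquiv fun _ => Circle).symm with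
        continuous_toFun := by
          show Continuous fun q : Fin (N + 1) → Circle => (q 0, fun i : Fin N => q i.succ)
          fun_prop
        continuous_invFun := by
          show Continuous fun q : Circle × (Fin N → Circle) => Fin.cons (α := fun _ => Circle) q.1 q.2
          fun_prop }
    exact ⟨_, hg.comp <| (IsOpenEmbedding.id.prodMap hf).comp <|
      (Homeomorph.prodAssoc _ _ _).isOpenEmbedding.comp
        (e.isOpenEmbedding.prodMap IsOpenEmbedding.id)⟩

theorem exists_isOpenEmbedding_solidTorus (N : ℕ) :
    ∃ f : (Fin N → Circle) × ℂ → EuclideanSpace ℝ (Fin (N + 2)), IsOpenEmbedding f := by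
  obtain ⟨f, hf⟩ := exists_isOpenEmbedding_torus_prod N 1
  let e : ℂ ≃L[ℝ] EuclideanSpace ℝ (Fin 2) := ContinuousLinearEquiv.ofFinrankEq (by simp)
  exact ⟨_, hf.comp (IsOpenEmbedding.id.prodMap e.toHomeomorph.isOpenEmbedding)⟩

end TorusChart

section Family

/-- The winding number of the cables at step `k`: a product of group orders, one for each
`j ≤ k`, selected by the bit `s j`. -/
def winding (q : ℕ → ℕ) (s : ℕ → Bool) (k : ℕ) : ℕ :=
  ∏ j ∈ Finset.range (k + 1), orderGL (q (2 * j + (!s j).toNat))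

/-- An upper bound for `winding q s k`, independent of `s`. -/
def windingBound (q : ℕ → ℕ) (k : ℕ) : ℕ :=
  ∏ j ∈ Finset.range (k + 1), orderGL (q (2 * j)) * orderGL (q (2 * j + 1))

/-- The radius of the cables at step `k`. -/
def radius (s : ℕ → Bool) (k : ℕ) : ℝ := if s k then 3 / 4 else 1 / 4

theorem radius_ge (s : ℕ → Bool) (k : ℕ) : 1 / 4 ≤ radius s k := by
  unfold radius; split_ifs <;> norm_num

theorem radius_le (s : ℕ → Bool) (k : ℕ) : radius s k ≤ 3 / 4 := by
  unfold radius; split_ifs <;> norm_num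

variable {q : ℕ → ℕ}

theorem winding_pos (hq : ∀ i, (q i).Prime) (s : ℕ → Bool) (k : ℕ) : 1 ≤ winding q s k :=
  Finset.prod_pos fun _ _ => orderGL_pos (hq _).two_le

theorem winding_le (hq : ∀ i, (q i).Prime) (s : ℕ → Bool) (k : ℕ) :
    winding q s k ≤ windingBound q k := by
  refine Finset.prod_le_prod' fun j _ => ?_
  have h0 := orderGL_pos (hq (2 * j)).two_le
  have h1 := orderGL_pos (hq (2 * j + 1)).two_le
  cases s j
  · exact Nat.le_mul_of_pos_left _ h0
  · exact Nat.le_mul_of_pos_right _ h1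

theorem winding_congr {s s' : ℕ → Bool} {k : ℕ} (h : ∀ j ≤ k, s j = s' j) :
    winding q s k = winding q s' k :=
  Finset.prod_congr rfl fun j hj => by rw [h j (Nat.lt_succ_iff.1 (Finset.mem_range.1 hj))]

theorem not_dvd_winding (hq : ∀ i, (q i).Prime) (hqc : ∀ i j, i ≠ j → ¬ q i ∣ orderGL (q j))
    (s : ℕ → Bool) (j k : ℕ) : ¬ q (2 * j + (s j).toNat) ∣ winding q s k := by
  intro h
  obtain ⟨j', -, h'⟩ := ((hq _).prime.dvd_finsetProd_iff _).1 h
  refine hqc _ _ (fun he => ?_) h'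
  have h1 := (s j).toNat_le
  have h2 := (!s j').toNat_le
  obtain rfl : j = j' := by omega
  cases hs : s j <;> simp [hs] at he

theorem dvd_winding {s t : ℕ → Bool} {j : ℕ} (h : s j ≠ t j) {k : ℕ} (hk : j ≤ k) :
    orderGL (q (2 * j + (s j).toNat)) ∣ winding q t k := by
  have : s j = !t j := Bool.eq_not.2 h
  rw [this]
  exact Finset.dvd_prod_of_mem (fun j => orderGL (q (2 * j + (!t j).toNat)))
    (Finset.mem_range.2 (Nat.lt_succ_iff.2 hk))

theorem exists_contraction_params (P : ℕ) :
    ∃ (r : ℕ) (B : ℝ), 0 < B ∧ B ≤ 1 / 4 ∧ (4 / 2 ^ r + 3 * B) * (P + 3) ≤ 1 / 2 := by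
  have hP : (0 : ℝ) < P + 3 := by positivity
  obtain ⟨r, hr⟩ := pow_unbounded_of_one_lt (16 * ((P : ℝ) + 3)) (by norm_num : (1 : ℝ) < 2)
  refine ⟨r, 1 / (12 * (P + 3)), by positivity, ?_, ?_⟩
  · rw [div_le_iff₀ (by positivity)]
    have : (0 : ℝ) ≤ P := P.cast_nonneg
    linarith
  · have h1 : (4 : ℝ) / 2 ^ r * (P + 3) ≤ 1 / 4 := by
      rw [div_mul_eq_mul_div, div_le_iff₀ (by positivity)]
      linarith
    have h2 : 3 * (1 / (12 * ((P : ℝ) + 3))) * (P + 3) = 1 / 4 := by field_simp; norm_num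
    rw [add_mul, h2]
    linarith

/-- The family of systems, indexed by binary sequences. -/
def family (N : ℕ) [NeZero N] (q r : ℕ → ℕ) (B : ℕ → ℝ) (s : ℕ → Bool) (k : ℕ)
    (j : Fin (r k + 1) → Bool) : (Fin N → Circle) × ℂ → (Fin N → Circle) × ℂ :=
  system (Fin.ofNat N) r B (winding q s) (radius s) k j

variable {N : ℕ} [NeZero N] {r : ℕ → ℕ} {B : ℕ → ℝ}

theorem goodStep_family (hq : ∀ i, (q i).Prime) (hB : ∀ k, 0 < B k) (hB' : ∀ k, B k ≤ 1 / 4)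
    (s : ℕ → Bool) (k : ℕ) : GoodStep (family N q r B s k) :=
  goodStep_system hB hB' (winding_pos hq s) (radius_ge s) (radius_le s) k

theorem family_congr {s s' : ℕ → Bool} {n : ℕ} (h : ∀ k ≤ n, s k = s' k) :
    family N q r B s n = family N q r B s' n := by
  unfold family system
  rw [winding_congr h, radius, radius, h n le_rfl]

theorem family_ne (hB : ∀ k, 0 < B k) (hB' : ∀ k, B k ≤ 1 / 4) {s s' : ℕ → Bool} {n : ℕ}
    (h : s n ≠ s' n) (j j' : Fin (r n + 1) → Bool) {y y' : (Fin N → Circle) × ℂ}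
    (hy : y ∈ solid _) (hy' : y' ∈ solid _) : family N q r B s n j y ≠ family N q r B s' n j' y' := by
  intro he
  have he' := congrArg (pr (Fin.ofNat N n)) he
  simp only [family, system, pr_lift] at he'
  have hs : s' n = !s n := Bool.eq_not.2 h.symm
  rw [radius, radius, hs] at he'
  cases hsn : s n <;> rw [hsn] at he' <;> simp only [Bool.not_true, Bool.not_false, if_true,
    Bool.false_eq_true, if_false] at he'
  · exact block_ne (hB n) (by exact hy) (by exact hy') (hB' n) j j' he'
  · exact block_ne (hB n) (by exact hy') (by exact hy) (hB' n) j' j he'.symm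

theorem shrinks_family (hq : ∀ i, (q i).Prime) (hB : ∀ k, 0 < B k) (hB' : ∀ k, B k ≤ 1 / 4)
    (hr : ∀ k, (4 / 2 ^ r k + 3 * B k) * (windingBound q k + 3) ≤ 1 / 2) (s : ℕ → Bool) :
    Shrinks (family N q r B s) := by
  refine shrinks_lift (N := N) (fun k => goodStep_block (hB k) (hB' k) (winding_pos hq s k)
    (radius_ge s k) (radius_le s k)) (fun k j y y' hy hy' => ?_) fun k i => ?_
  · refine (block_lipschitz (hB k) (radius_ge s k) (radius_le s k) (winding_pos hq s k) hy hy'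
      j).trans (mul_le_mul_of_nonneg_right (le_trans ?_ (hr k)) dist_nonneg)
    have h1 := hB k
    have h2 : (winding q s k : ℝ) ≤ windingBound q k := by exact_mod_cast winding_le hq s k
    gcongr
  · have hN := NeZero.pos N
    refine ⟨(i + (N - k % N)) % N, Nat.mod_lt _ hN, Fin.ext ?_⟩
    have hk := Nat.mod_lt k hN
    rw [Fin.val_ofNat, Nat.add_mod_mod]
    have : k + (i + (N - k % N)) = i + N * (k / N + 1) := by
      have := Nat.div_add_mod k N
      rw [mul_add, mul_one]
      omega
    rw [this, Nat.add_mul_mod_self_left, Nat.mod_eq_of_lt i.2]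

/-- A continuous injective parametrization of all attractors of the family. -/
theorem exists_param_family (hq : ∀ i, (q i).Prime) (hB : ∀ k, 0 < B k) (hB' : ∀ k, B k ≤ 1 / 4)
    (hr : ∀ k, (4 / 2 ^ r k + 3 * B k) * (windingBound q k + 3) ≤ 1 / 2) :
    ∃ P : (∀ k, Fin (r k + 1) → Bool) × (ℕ → Bool) → (Fin N → Circle) × ℂ,
      Continuous P ∧ Function.Injective P ∧
        ∀ s, range (fun a => P (a, s)) = attractor (family N q r B s) 0 :=
  have hg := goodStep_family (N := N) (r := r) hq hB hB'
  have hs := shrinks_family (N := N) hq hB hB' hr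
  ⟨_, continuous_pt hg (fun _ _ _ h => family_congr h) hs,
    pt_injective hg (fun _ _ _ h => family_congr h)
      (fun _ _ _ _ h j j' _ hy _ hy' => family_ne hB hB' h j j' hy hy'),
    fun s => range_pt (hg s) (hs s)⟩

variable {Ω : Type*} [TopologicalSpace Ω] [T2Space Ω]

theorem exists_nontrivial_family (hq : ∀ i, (q i).Prime)
    (hqc : ∀ i j, i ≠ j → ¬ q i ∣ orderGL (q j)) (hB : ∀ k, 0 < B k) (hB' : ∀ k, B k ≤ 1 / 4)
    (s : ℕ → Bool) (j k : ℕ) {E : (Fin N → Circle) × ℂ → Ω} (cont : Continuous E)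
    (isOpenMap : IsOpenMap E) (inj : InjOn E (solid _)) :
    ∃ Φ : Ω → Ω → GL (Fin 3) (ZMod (q (2 * j + (s j).toNat))),
      LC Φ (E '' attractor (family N q r B s) k)ᶜ ∧ ∃ Z, IsCompact Z ∧
        Disjoint Z (E '' attractor (family N q r B s) k) ∧ ∀ φ, ¬ Prim Φ φ Z := by
  have := Fact.mk (hq (2 * j + (s j).toNat))
  have hroot : ∀ k, ∀ z ∈ elementary (ZMod (q (2 * j + (s j).toNat))),
      ∃ x ∈ elementary (ZMod (q (2 * j + (s j).toNat))), x ^ winding q s k = z := fun k =>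
    exists_root_of_mem_elementary fun h =>
      not_dvd_winding hq hqc s j k ((ZMod.natCast_eq_zero_iff _ _).1 h)
  obtain ⟨x, hx, hx1⟩ := exists_mem_elementary_ne_one (F := ZMod (q (2 * j + (s j).toNat)))
  obtain ⟨ξ, hξ, h1, j₀, hj₀⟩ := exists_ext_block_one (r := r k) (hB k) (hB' k)
    (winding_pos hq s k) (radius_ge s k) (radius_le s k) (hroot k) one_mem_elementary hx hx1
  exact exists_nontrivial (goodStep_family hq hB hB' s) (fun k => (hasExt_block (hB k) (hB' k)
    (winding_pos hq s k) (radius_ge s k) (radius_le s k) exists_commutator_of_mem_elementary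
    (hroot k)).lift (Fin.ofNat N k)) hξ (h1.lift (Fin.ofNat N k)) hj₀ cont isOpenMap inj

end Family

section Euclidean

variable {q : ℕ → ℕ} {N : ℕ} [NeZero N] {r : ℕ → ℕ} {B : ℕ → ℝ}

theorem everywhereWild_family (hq : ∀ i, (q i).Prime)
    (hqc : ∀ i j, i ≠ j → ¬ q i ∣ orderGL (q j)) (hB : ∀ k, 0 < B k) (hB' : ∀ k, B k ≤ 1 / 4)
    (hr : ∀ k, (4 / 2 ^ r k + 3 * B k) * (windingBound q k + 3) ≤ 1 / 2) {n : ℕ} (hn : 3 ≤ n)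
    {f : (Fin N → Circle) × ℂ → EuclideanSpace ℝ (Fin n)} (hf : IsOpenEmbedding f)
    (s : ℕ → Bool) : EverywhereWild (f '' attractor (family N q r B s) 0) := by
  rintro x hx ⟨U, hU, h, hh⟩
  have hg := goodStep_family (N := N) (r := r) hq hB hB' s
  obtain ⟨a, m, ham⟩ := exists_small_copy hg (shrinks_family hq hB hB' hr s) hf.continuous hx hU
  have cont := hf.continuous.comp (continuous_comp hg a m)
  obtain ⟨Φ, hΦ, Z, -, hZ, hφ⟩ := exists_nontrivial_family (N := N) (r := r) hq hqc hB hB' s 0 m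
    cont (hf.isOpenMap.comp (isOpenMap_comp hg a m))
    (fun y hy y' hy' he => (comp_inj hg hy hy' (hf.injective he)).2)
  have hsub : (f ∘ comp (family N q r B s) a m) '' attractor (family N q r B s) m ⊆
      f '' attractor (family N q r B s) 0 ∩ closure U := by
    rintro _ ⟨y, hy, rfl⟩
    exact ⟨⟨_, comp_mem_attractor hg a hy, rfl⟩,
      subset_closure (ham ⟨y, attractor_subset_solid hg m hy, rfl⟩)⟩
  obtain ⟨φ, hφ'⟩ := exists_prim_off_tame hn ((isCompact_attractor hg m).image cont)
    ⟨h, (image_mono hsub).trans hh⟩ hΦ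
  exact hφ φ (hφ'.mono hZ.subset_compl_right)

theorem not_ambientlyEmbeds_family (hq : ∀ i, (q i).Prime)
    (hqc : ∀ i j, i ≠ j → ¬ q i ∣ orderGL (q j)) (hB : ∀ k, 0 < B k) (hB' : ∀ k, B k ≤ 1 / 4)
    (hr : ∀ k, (4 / 2 ^ r k + 3 * B k) * (windingBound q k + 3) ≤ 1 / 2) {n : ℕ}
    {f : (Fin N → Circle) × ℂ → EuclideanSpace ℝ (Fin n)} (hf : IsOpenEmbedding f)
    {s t : ℕ → Bool} (hst : s ≠ t) :
    ¬ AmbientlyEmbeds (f '' attractor (family N q r B s) 0)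
      (f '' attractor (family N q r B t) 0) := by
  rintro ⟨h, hh⟩
  obtain ⟨j, hj⟩ := Function.ne_iff.1 hst
  have := Fact.mk (hq (2 * j + (s j).toNat))
  have hhf := h.isOpenEmbedding.comp hf
  obtain ⟨Φ, hΦ, Z, hZc, hZ, hφ⟩ := exists_nontrivial_family (N := N) (r := r) hq hqc hB hB' s j 0
    hhf.continuous hhf.isOpenMap hhf.injective.injOn
  have hc := (isCompact_attractor (goodStep_family (N := N) (r := r) hq hB hB' s) 0).image
    hhf.continuous
  obtain ⟨φ, hφ'⟩ := exists_prim_of_exponent (n₀ := j) hB hB' (winding_pos hq t) (radius_ge t)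
    (radius_le t) (shrinks_family hq hB hB' hr t) (fun m hm g => by
      obtain ⟨c, hc⟩ := dvd_winding (q := q) hj hm
      rw [hc, pow_mul, pow_orderGL, one_pow]) hf.continuous hf.isOpenMap hf.injective
    (by rw [image_comp]; exact hh) hc.isClosed hZc.isClosed hZ.symm hΦ
  exact hφ φ hφ'

theorem nonempty_homeomorph_pi_words (r : ℕ → ℕ) :
    Nonempty (cantorSet ≃ₜ ∀ k, Fin (r k + 1) → Bool) := by
  obtain ⟨e⟩ : Nonempty (ℕ ≃ Σ k, Fin (r k + 1)) := nonempty_equiv_of_countable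
  let e' : ((Σ k, Fin (r k + 1)) → Bool) ≃ₜ ∀ k, Fin (r k + 1) → Bool :=
    { Equiv.piCurry fun _ _ => Bool with
      continuous_toFun := continuous_pi fun k => continuous_pi fun i =>
        continuous_apply (⟨k, i⟩ : Σ k, Fin (r k + 1))
      continuous_invFun := continuous_pi fun p =>
        (continuous_apply p.2).comp (continuous_apply p.1) }
  exact ⟨cantorSetHomeomorphNatToBool.trans
    ((Homeomorph.piCongrLeft (Y := fun _ => Bool) e).trans e')⟩

end Euclidean

end WildCantor

open WildCantor

/-- **Theorem 2 (Frolkina).** For each `n ≥ 3` there is an embedding `A : 𝒞 × 𝒞 → ℝⁿ` such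
that each slice `𝒜_s = A(𝒞 × {s})` is an everywhere wild Cantor set, and for `s ≠ t` the
sets `𝒜_s`, `𝒜_t` are ambiently incomparable. -/
theorem cantor_family_of_everywhere_wild_cantor_sets (n : ℕ) (hn : 3 ≤ n) :
    ∃ A : ↥cantorSet × ↥cantorSet → EuclideanSpace ℝ (Fin n), Topology.IsEmbedding A ∧
      (∀ s : ↥cantorSet,
        IsCantorSet (Set.range (fun x : ↥cantorSet => A (x, s))) ∧
        EverywhereWild (Set.range (fun x : ↥cantorSet => A (x, s)))) ∧
      (∀ s t : ↥cantorSet, s ≠ t →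
        AmbientlyIncomparable (Set.range (fun x : ↥cantorSet => A (x, s)))
          (Set.range (fun x : ↥cantorSet => A (x, t)))) := by
  obtain ⟨N, rfl⟩ : ∃ N, n = N + 2 := ⟨n - 2, by omega⟩
  have : NeZero N := ⟨by omega⟩
  obtain ⟨q, hq, hqc⟩ := exists_primes
  choose r B hB hB' hr using fun k => exists_contraction_params (windingBound q k)
  obtain ⟨f, hf⟩ := exists_isOpenEmbedding_solidTorus N
  obtain ⟨e⟩ := nonempty_homeomorph_pi_words r
  obtain ⟨P, hPc, hPi, hPr⟩ := exists_param_family (N := N) hq hB hB' hr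
  obtain ⟨c⟩ : Nonempty (cantorSet ≃ₜ (ℕ → Bool)) := ⟨cantorSetHomeomorphNatToBool⟩
  have : CompactSpace cantorSet := c.symm.compactSpace
  let A : cantorSet × cantorSet → EuclideanSpace ℝ (Fin (N + 2)) := f ∘ P ∘ Prod.map e c
  have hA : IsClosedEmbedding A :=
    (hf.continuous.comp (hPc.comp (e.continuous.prodMap c.continuous))).isClosedEmbedding
      (hf.injective.comp (hPi.comp (e.injective.prodMap c.injective)))
  have hrange : ∀ s, range (fun x => A (x, s)) = f '' attractor (family N q r B (c s)) 0 := by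
    intro s
    rw [← hPr, ← range_comp, ← e.surjective.range_comp]
    rfl
  refine ⟨A, hA.isEmbedding, fun s => ⟨?_, ?_⟩, fun s t hst => ?_⟩
  · exact ⟨(hA.isEmbedding.comp (isEmbedding_prodMkLeft s)).toHomeomorph.symm⟩
  · rw [hrange]
    exact everywhereWild_family hq hqc hB hB' hr hn hf _
  · rw [hrange, hrange]
    have h := c.injective.ne hst
    exact ⟨not_ambientlyEmbeds_family hq hqc hB hB' hr hf h,
      not_ambientlyEmbeds_family hq hqc hB hB' hr hf h.symm⟩

end
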